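/- arXiv:2204.12455 — 4 statements merged into one kernel-verified Lean document; each statement's English description precedes it below -/
import Mathlib

section
/- For every positive integer k there is a constant C = C(k) such that every finite simple graph on n ≥ 4 vertices with average degree at least C · log₂ log₂ n contains a nonempty k-regular subgraph. -/
variable {V : Type*}

/-- `G` is a bipartite graph with parts `A` and `B`: the parts are disjoint, cover all
vertices, and every edge goes between `A` and `B`. -/
def BipartiteWith (G : SimpleGraph V) (A B : Set V) : Prop :=
  Disjoint A B ∧ A ∪ B = Set.univ ∧
    ∀ ⦃u v : V⦄, G.Adj u v → (u ∈ A ∧ v ∈ B) ∨ (u ∈ B ∧ v ∈ A)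

/-- `G` contains no complete bipartite subgraph `K_{k,k}`. -/
def KkkFree (G : SimpleGraph V) (k : ℕ) : Prop :=
  ¬ ∃ (S T : Finset V), Disjoint S T ∧ S.card = k ∧ T.card = k ∧
      ∀ u ∈ S, ∀ v ∈ T, G.Adj u v

/-- The number of edges of `G`. -/
noncomputable def edgeCount (G : SimpleGraph V) : ℕ := G.edgeSet.ncard

/-- The degree of `v` in `G`. -/
noncomputable def deg (G : SimpleGraph V) (v : V) : ℕ := (G.neighborSet v).ncard

/-- The codegree of `u` and `u'` in `G`: the number of their common neighbours. -/
noncomputable def codeg (G : SimpleGraph V) (u u' : V) : ℕ :=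
  (G.neighborSet u ∩ G.neighborSet u').ncard

/-- The average degree of `G`, as a real number. -/
noncomputable def avgDeg [Fintype V] (G : SimpleGraph V) : ℝ :=
  2 * (edgeCount G : ℝ) / (Fintype.card V : ℝ)

/-- The number of edges of a subgraph. -/
noncomputable def subEdgeCount {G : SimpleGraph V} (H : G.Subgraph) : ℕ := H.edgeSet.ncard

/-- The degree of a vertex in a subgraph. -/
noncomputable def subDeg {G : SimpleGraph V} (H : G.Subgraph) (v : V) : ℕ :=
  (H.neighborSet v).ncard

/-- The average degree of a subgraph. -/
noncomputable def subAvgDeg {G : SimpleGraph V} (H : G.Subgraph) : ℝ :=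
  2 * (subEdgeCount H : ℝ) / (H.verts.ncard : ℝ)

/-- A subgraph `H` is `K`-almost-regular: its maximum degree is at most `K` times its
minimum degree. -/
def SubAlmostRegular {G : SimpleGraph V} (H : G.Subgraph) (K : ℝ) : Prop :=
  ∀ v ∈ H.verts, ∀ w ∈ H.verts, (subDeg H v : ℝ) ≤ K * (subDeg H w : ℝ)

/-- `G` has a nonempty `k`-regular subgraph. -/
def HasRegularSubgraph (G : SimpleGraph V) (k : ℕ) : Prop :=
  ∃ H : G.Subgraph, H.verts.Nonempty ∧ ∀ v ∈ H.verts, subDeg H v = k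

/-- `G` has a nonempty `K`-almost-regular subgraph with average degree at least `c`. -/
def HasAlmostRegularSubgraph (G : SimpleGraph V) (K : ℝ) (c : ℝ) : Prop :=
  ∃ H : G.Subgraph, H.verts.Nonempty ∧ SubAlmostRegular H K ∧ c ≤ subAvgDeg H

/-- `G` is `(L, d)`-almost-biregular with parts `A` and `B`. -/
def IsAlmostBiregular (G : SimpleGraph V) (A B : Set V) (L : ℝ) (d : ℕ) : Prop :=
  BipartiteWith G A B ∧ A.Nonempty ∧
    (∀ v ∈ B, deg G v = d) ∧
    (d : ℝ) ≤ (edgeCount G : ℝ) / (A.ncard : ℝ) ∧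
    ∀ u ∈ A, (deg G u : ℝ) ≤ L * ((edgeCount G : ℝ) / (A.ncard : ℝ))

/-- A subgraph `H` of `G` is `(L, d)`-almost-biregular with parts `A` and `B`. -/
def SubIsAlmostBiregular {G : SimpleGraph V} (H : G.Subgraph) (A B : Set V)
    (L : ℝ) (d : ℕ) : Prop :=
  Disjoint A B ∧ A ∪ B = H.verts ∧
    (∀ ⦃u v : V⦄, H.Adj u v → (u ∈ A ∧ v ∈ B) ∨ (u ∈ B ∧ v ∈ A)) ∧
    A.Nonempty ∧
    (∀ v ∈ B, subDeg H v = d) ∧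
    (d : ℝ) ≤ (subEdgeCount H : ℝ) / (A.ncard : ℝ) ∧
    ∀ u ∈ A, (subDeg H u : ℝ) ≤ L * ((subEdgeCount H : ℝ) / (A.ncard : ℝ))

/-- The number of pairs of `E` with first coordinate `a`. -/
def rowDeg {α β : Type*} [DecidableEq α] (E : Finset (α × β)) (a : α) : ℕ :=
  (E.filter fun e => e.1 = a).card

/-- The number of pairs of `E` with second coordinate `b`. -/
def colDeg {α β : Type*} [DecidableEq β] (E : Finset (α × β)) (b : β) : ℕ :=
  (E.filter fun e => e.2 = b).card

/-- The bipartite graph with edge set `E` contains a nonempty `k`-regular subgraph. -/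
def HasRegularPart {α β : Type*} [DecidableEq α] [DecidableEq β]
    (E : Finset (α × β)) (k : ℕ) : Prop :=
  ∃ F ⊆ E, F.Nonempty ∧ (∀ a, rowDeg F a = 0 ∨ rowDeg F a = k) ∧
    ∀ b, colDeg F b = 0 ∨ colDeg F b = k

section Bipartite

variable {α β : Type*} [DecidableEq α] [DecidableEq β]

theorem HasRegularPart.mono {E F : Finset (α × β)} {k : ℕ} (h : HasRegularPart E k)
    (hEF : E ⊆ F) : HasRegularPart F k := by
  obtain ⟨H, hH, h⟩ := h
  exact ⟨H, hH.trans hEF, h⟩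

omit [DecidableEq β] in
theorem rowDeg_mono {E F : Finset (α × β)} (h : E ⊆ F) (a : α) : rowDeg E a ≤ rowDeg F a :=
  Finset.card_le_card (Finset.filter_subset_filter _ h)

omit [DecidableEq α] in
theorem colDeg_mono {E F : Finset (α × β)} (h : E ⊆ F) (b : β) : colDeg E b ≤ colDeg F b :=
  Finset.card_le_card (Finset.filter_subset_filter _ h)

omit [DecidableEq β] in
theorem sum_rowDeg {E : Finset (α × β)} {A : Finset α} (h : ∀ e ∈ E, e.1 ∈ A) :
    ∑ a ∈ A, rowDeg E a = E.card :=
  (Finset.card_eq_sum_card_fiberwise h).symm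

omit [DecidableEq α] in
theorem sum_colDeg {E : Finset (α × β)} {B : Finset β} (h : ∀ e ∈ E, e.2 ∈ B) :
    ∑ b ∈ B, colDeg E b = E.card :=
  (Finset.card_eq_sum_card_fiberwise h).symm

/-- A bipartite graph of maximum degree at most `D + 1` contains a matching which covers all
vertices of degree `D + 1` and uses at most a `1 / (D + 1)` fraction of the edges. -/
theorem exists_subset_degree_le_pred [Fintype α] [Fintype β] (E : Finset (α × β)) (D : ℕ)
    (hr : ∀ a, rowDeg E a ≤ D + 1) (hc : ∀ b, colDeg E b ≤ D + 1) :
    ∃ F ⊆ E, (∀ a, rowDeg F a ≤ D) ∧ (∀ b, colDeg F b ≤ D) ∧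
      D * E.card ≤ (D + 1) * F.card := by
  classical
  obtain ⟨M, h11, h12, h21, h22⟩ : ∃ M : Matrix (α ⊕ β) (α ⊕ β) ℝ,
      (∀ a a', M (.inl a) (.inl a') =
        (D + 1 : ℝ)⁻¹ * if a = a' then (D + 1 : ℝ) - rowDeg E a else 0) ∧
      (∀ a b, M (.inl a) (.inr b) = (D + 1 : ℝ)⁻¹ * if (a, b) ∈ E then 1 else 0) ∧
      (∀ b a, M (.inr b) (.inl a) = (D + 1 : ℝ)⁻¹ * if (a, b) ∈ E then 1 else 0) ∧
      ∀ b b', M (.inr b) (.inr b') =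
        (D + 1 : ℝ)⁻¹ * if b = b' then (D + 1 : ℝ) - colDeg E b else 0 :=
    ⟨Matrix.of fun i j => (D + 1 : ℝ)⁻¹ * Sum.elim
      (fun a => Sum.elim (fun a' => if a = a' then (D + 1 : ℝ) - rowDeg E a else 0)
        fun b => if (a, b) ∈ E then 1 else 0)
      (fun b => Sum.elim (fun a => if (a, b) ∈ E then 1 else 0)
        fun b' => if b = b' then (D + 1 : ℝ) - colDeg E b else 0) i j,
      fun _ _ => rfl, fun _ _ => rfl, fun _ _ => rfl, fun _ _ => rfl⟩
  have hD : (0 : ℝ) < D + 1 := by positivity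
  have hr' : ∀ a, (rowDeg E a : ℝ) ≤ D + 1 := fun a => by exact_mod_cast hr a
  have hc' : ∀ b, (colDeg E b : ℝ) ≤ D + 1 := fun b => by exact_mod_cast hc b
  have hrow : ∀ a, ∑ b, (if (a, b) ∈ E then (1 : ℝ) else 0) = rowDeg E a := by
    intro a
    rw [Finset.sum_boole]
    congr 1
    refine Finset.card_bij (fun b _ => (a, b)) ?_ ?_ ?_
    · simp
    · simp
    · rintro ⟨a', b⟩ h
      simp only [Finset.mem_filter] at h
      exact ⟨b, by simpa [← h.2] using h.1, by simp [← h.2]⟩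
  have hcol : ∀ b, ∑ a, (if (a, b) ∈ E then (1 : ℝ) else 0) = colDeg E b := by
    intro b
    rw [Finset.sum_boole]
    congr 1
    refine Finset.card_bij (fun a _ => (a, b)) ?_ ?_ ?_
    · simp
    · simp
    · rintro ⟨a, b'⟩ h
      simp only [Finset.mem_filter] at h
      exact ⟨a, by simpa [← h.2] using h.1, by simp [← h.2]⟩
  have hds : M ∈ doublyStochastic ℝ (α ⊕ β) := by
    rw [mem_doublyStochastic_iff_sum]
    refine ⟨?_, ?_, ?_⟩
    · rintro (a | b) (a' | b')
      · simp only [h11]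
        have := hr' a
        split_ifs <;> positivity
      · simp only [h12]
        split_ifs <;> positivity
      · simp only [h21]
        split_ifs <;> positivity
      · simp only [h22]
        have := hc' b
        split_ifs <;> positivity
    · rintro (a | b)
      · rw [Fintype.sum_sum_type]
        simp only [h11, h12, ← Finset.mul_sum,
          hrow, Finset.sum_ite_eq, Finset.mem_univ, if_true]
        field_simp
        ring
      · rw [Fintype.sum_sum_type]
        simp only [h21, h22, ← Finset.mul_sum,
          hcol, Finset.sum_ite_eq, Finset.mem_univ, if_true]
        field_simp
        ring
    · rintro (a | b)
      · rw [Fintype.sum_sum_type]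
        simp only [h11, h21, ← Finset.mul_sum,
          hrow, Finset.sum_ite_eq', Finset.mem_univ, if_true]
        field_simp
        ring
      · rw [Fintype.sum_sum_type]
        simp only [h12, h22, ← Finset.mul_sum,
          hcol, Finset.sum_ite_eq', Finset.mem_univ, if_true]
        field_simp
        ring
  obtain ⟨w, hw0, hw1, hwM⟩ := exists_eq_sum_perm_of_mem_doublyStochastic hds
  have hwij : ∀ i j, ∑ σ, (if σ i = j then w σ else 0) = M i j := by
    intro i j
    rw [← hwM, Matrix.sum_apply]
    refine Finset.sum_congr rfl fun σ _ => ?_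
    simp [Equiv.toPEquiv_apply, PEquiv.toMatrix_apply, eq_comm]
  have hpos : ∀ σ, 0 < w σ → ∀ i, M i (σ i) ≠ 0 := by
    intro σ hσ i h
    rw [← hwij] at h
    rw [Finset.sum_eq_zero_iff_of_nonneg (fun τ _ => by split_ifs <;> simp [hw0])] at h
    have := h σ (Finset.mem_univ _)
    simp at this
    linarith
  set f : Equiv.Perm (α ⊕ β) → Finset (α × β) :=
    fun σ => E.filter fun e => σ (.inl e.1) = .inr e.2 with hf
  have hsum : ∑ σ, w σ * ((f σ).card : ℝ) = E.card / (D + 1) := by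
    have : ∀ σ, w σ * ((f σ).card : ℝ) = ∑ e ∈ E, if σ (.inl e.1) = .inr e.2 then w σ else 0 := by
      intro σ
      rw [← Finset.sum_filter, Finset.sum_const, nsmul_eq_mul, mul_comm]
    simp_rw [this]
    rw [Finset.sum_comm]
    simp_rw [hwij]
    rw [Finset.sum_congr rfl (g := fun _ => (D + 1 : ℝ)⁻¹)]
    · simp [div_eq_mul_inv]
    · rintro ⟨a, b⟩ he
      simp [h12, he]
  obtain ⟨σ, hσ, hcard⟩ : ∃ σ, 0 < w σ ∧ ((f σ).card : ℝ) ≤ E.card / (D + 1) := by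
    by_contra! hcon
    have h1 : ∑ σ, w σ * ((E.card : ℝ) / (D + 1)) < ∑ σ, w σ * ((f σ).card : ℝ) := by
      apply Finset.sum_lt_sum
      · intro σ _
        rcases (hw0 σ).eq_or_lt with h | h
        · simp [← h]
        · exact mul_le_mul_of_nonneg_left (hcon σ h).le h.le
      · obtain ⟨σ, -, h⟩ : ∃ σ ∈ Finset.univ, 0 < w σ := by
          apply Finset.exists_lt_of_sum_lt
          simp [hw1]
        exact ⟨σ, Finset.mem_univ _, mul_lt_mul_of_pos_left (hcon σ h) h⟩
    rw [← Finset.sum_mul, hw1, hsum] at h1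
    linarith
  have hr0 : ∀ a, rowDeg E a = D + 1 → ∃ e ∈ f σ, e.1 = a := by
    intro a ha
    have h := hpos σ hσ (.inl a)
    rcases hs : σ (.inl a) with a' | b
    · rw [hs] at h
      simp [h11, ha] at h
    · rw [hs] at h
      have hab : (a, b) ∈ E := by
        by_contra hab
        simp [h12, hab] at h
      exact ⟨(a, b), by simp [hf, hab, hs], rfl⟩
  have hc0 : ∀ b, colDeg E b = D + 1 → ∃ e ∈ f σ, e.2 = b := by
    intro b hb
    have h := hpos σ hσ (σ.symm (.inr b))
    rw [Equiv.apply_symm_apply] at h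
    rcases hs : σ.symm (.inr b) with a | b'
    · rw [hs] at h
      have hab : (a, b) ∈ E := by
        by_contra hab
        simp [h12, hab] at h
      exact ⟨(a, b), by simp [hf, hab, ← hs], rfl⟩
    · rw [hs] at h
      by_cases hbb : b' = b
      · simp [h22, hbb, hb] at h
      · simp [h22, hbb] at h
  refine ⟨E \ f σ, Finset.sdiff_subset, ?_, ?_, ?_⟩
  · intro a
    rcases (hr a).eq_or_lt with h | h
    · obtain ⟨e, he, hea⟩ := hr0 a h
      apply Nat.le_of_lt_succ
      rw [Nat.succ_eq_add_one, ← h]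
      apply Finset.card_lt_card
      refine Finset.ssubset_iff_subset_ne.2
        ⟨Finset.filter_subset_filter _ Finset.sdiff_subset, fun heq => ?_⟩
      have : e ∈ E.filter fun e => e.1 = a :=
        Finset.mem_filter.2 ⟨(Finset.mem_filter.1 he).1, hea⟩
      rw [← heq] at this
      simp [he] at this
    · exact (rowDeg_mono Finset.sdiff_subset a).trans (Nat.le_of_lt_succ h)
  · intro b
    rcases (hc b).eq_or_lt with h | h
    · obtain ⟨e, he, heb⟩ := hc0 b h
      apply Nat.le_of_lt_succ
      rw [Nat.succ_eq_add_one, ← h]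
      apply Finset.card_lt_card
      refine Finset.ssubset_iff_subset_ne.2
        ⟨Finset.filter_subset_filter _ Finset.sdiff_subset, fun heq => ?_⟩
      have : e ∈ E.filter fun e => e.2 = b :=
        Finset.mem_filter.2 ⟨(Finset.mem_filter.1 he).1, heb⟩
      rw [← heq] at this
      simp [he] at this
    · exact (colDeg_mono Finset.sdiff_subset b).trans (Nat.le_of_lt_succ h)
  · have hfE : f σ ⊆ E := Finset.filter_subset _ _
    have h1 := Finset.card_sdiff_add_card_eq_card hfE
    rw [le_div_iff₀ hD] at hcard
    have h2 : (f σ).card * (D + 1) ≤ E.card := by exact_mod_cast hcard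
    nlinarith

/-- A bipartite graph of maximum degree at most `D` has a subgraph of maximum degree at most
`m` containing at least an `m / D` fraction of the edges. -/
theorem exists_subset_degree_le [Fintype α] [Fintype β] (E : Finset (α × β)) {D m : ℕ}
    (hm : m ≤ D) (hr : ∀ a, rowDeg E a ≤ D) (hc : ∀ b, colDeg E b ≤ D) :
    ∃ F ⊆ E, (∀ a, rowDeg F a ≤ m) ∧ (∀ b, colDeg F b ≤ m) ∧
      m * E.card ≤ D * F.card := by
  induction D, hm using Nat.le_induction generalizing E with
  | base => exact ⟨E, subset_rfl, hr, hc, le_rfl⟩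
  | succ D hmD ih =>
    obtain ⟨F, hF, hFr, hFc, hcard⟩ := exists_subset_degree_le_pred E D hr hc
    obtain ⟨H, hH, hHr, hHc, hcard'⟩ := ih F hFr hFc
    refine ⟨H, hH.trans hF, hHr, hHc, ?_⟩
    rcases Nat.eq_zero_or_pos D with rfl | hD
    · simp [Nat.le_zero.1 hmD]
    · refine Nat.le_of_mul_le_mul_left ?_ hD
      calc D * (m * E.card) = m * (D * E.card) := by ring
        _ ≤ m * ((D + 1) * F.card) := by gcongr
        _ = (D + 1) * (m * F.card) := by ring
        _ ≤ (D + 1) * (D * H.card) := by gcongr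
        _ = D * ((D + 1) * H.card) := by ring

theorem HasRegularPart.of_le [Fintype α] [Fintype β] {E : Finset (α × β)} {k q : ℕ} (hk : 0 < k)
    (hkq : k ≤ q) (h : HasRegularPart E q) : HasRegularPart E k := by
  classical
  obtain ⟨F, hFE, hne, hr, hc⟩ := h
  obtain ⟨H, hHF, hHr, hHc, hcard⟩ := exists_subset_degree_le F hkq
    (fun a => by rcases hr a with h | h <;> omega) (fun b => by rcases hc b with h | h <;> omega)
  have hq : 0 < q := hk.trans_le hkq
  have key : ∀ {x y : ℕ}, (y = 0 ∨ y = q) → x ≤ y → x ≤ k → q * x ≤ k * y := by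
    rintro x y (rfl | rfl) h1 h2
    · simp [Nat.le_zero.1 h1]
    · rw [mul_comm]; gcongr
  have fin : ∀ {x y : ℕ}, (y = 0 ∨ y = q) → q * x = k * y → x = 0 ∨ x = k := by
    rintro x y (rfl | rfl) h
    · left; simpa [hq.ne'] using h
    · right; exact Nat.eq_of_mul_eq_mul_left hq (by linarith)
  refine ⟨H, hHF.trans hFE, ?_, ?_, ?_⟩
  · rw [← Finset.card_pos]
    have := Finset.card_pos.2 hne
    by_contra h0
    simp only [not_lt, Nat.le_zero] at h0
    rw [h0] at hcard
    have := Nat.mul_pos hk this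
    omega
  · have h1 : ∑ a, q * rowDeg H a ≤ ∑ a, k * rowDeg F a :=
      Finset.sum_le_sum fun a _ => key (hr a) (rowDeg_mono hHF a) (hHr a)
    have h2 : ∑ a, q * rowDeg H a = ∑ a, k * rowDeg F a := by
      refine le_antisymm h1 ?_
      rw [← Finset.mul_sum, ← Finset.mul_sum, sum_rowDeg (by simp), sum_rowDeg (by simp)]
      exact hcard
    intro a
    exact fin (hr a) ((Finset.sum_eq_sum_iff_of_le
      fun a _ => key (hr a) (rowDeg_mono hHF a) (hHr a)).1 h2 a (Finset.mem_univ _))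
  · have h1 : ∑ b, q * colDeg H b ≤ ∑ b, k * colDeg F b :=
      Finset.sum_le_sum fun b _ => key (hc b) (colDeg_mono hHF b) (hHc b)
    have h2 : ∑ b, q * colDeg H b = ∑ b, k * colDeg F b := by
      refine le_antisymm h1 ?_
      rw [← Finset.mul_sum, ← Finset.mul_sum, sum_colDeg (by simp), sum_colDeg (by simp)]
      exact hcard
    intro b
    exact fin (hc b) ((Finset.sum_eq_sum_iff_of_le
      fun b _ => key (hc b) (colDeg_mono hHF b) (hHc b)).1 h2 b (Finset.mem_univ _))

/-- **Alon–Friedland–Kalai** for bipartite graphs and prime `q`. -/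
theorem hasRegularPart_of_card_lt (q : ℕ) [hq : Fact q.Prime] {E : Finset (α × β)}
    {A : Finset α} {B : Finset β} (hA : ∀ e ∈ E, e.1 ∈ A) (hB : ∀ e ∈ E, e.2 ∈ B)
    (hr : ∀ a, rowDeg E a < 2 * q) (hc : ∀ b, colDeg E b < 2 * q)
    (hcard : (q - 1) * (A.card + B.card) < E.card) : HasRegularPart E q := by
  classical
  have hq1 : q - 1 ≠ 0 := by have := hq.out.two_le; omega
  let f : α ⊕ β → MvPolynomial E (ZMod q) := fun i =>
    ∑ e : E, if (Sum.elim (fun a => e.1.1 = a) (fun b => e.1.2 = b) i) then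
      MvPolynomial.X e ^ (q - 1) else 0
  have hdeg : ∀ i, (f i).totalDegree ≤ q - 1 := by
    intro i
    refine MvPolynomial.totalDegree_finsetSum_le fun e _ => ?_
    split_ifs
    · refine (MvPolynomial.totalDegree_pow _ _).trans ?_
      simp
    · simp
  have hlt : ∑ i ∈ A.disjSum B, (f i).totalDegree < Fintype.card E := by
    refine (Finset.sum_le_card_nsmul _ _ _ fun i _ => hdeg i).trans_lt ?_
    simpa [mul_comm] using hcard
  have hdvd := char_dvd_card_solutions_of_sum_lt q hlt
  have hzero : ∀ i ∈ A.disjSum B, MvPolynomial.eval (0 : E → ZMod q) (f i) = 0 := by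
    intro i _
    simp only [f, map_sum]
    refine Finset.sum_eq_zero fun e _ => ?_
    split_ifs <;> simp [hq1]
  obtain ⟨⟨x, hx⟩, hne⟩ : ∃ y : {x : E → ZMod q // ∀ i ∈ A.disjSum B,
      MvPolynomial.eval x (f i) = 0}, y ≠ ⟨0, hzero⟩ := by
    apply Fintype.exists_ne_of_one_lt_card
    refine hq.out.one_lt.trans_le (Nat.le_of_dvd (Fintype.card_pos_iff.2 ⟨⟨0, hzero⟩⟩) hdvd)
  have hx0 : ∃ e, x e ≠ 0 := by
    by_contra! h
    exact hne (Subtype.ext (funext h))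
  set F : Finset (α × β) := (Finset.univ.filter fun e : E => x e ≠ 0).map
    (Function.Embedding.subtype _) with hF
  have hFE : F ⊆ E := by
    intro e he
    simp only [hF, Finset.mem_map, Function.Embedding.subtype_apply] at he
    obtain ⟨e, -, rfl⟩ := he
    exact e.2
  have hev : ∀ i, MvPolynomial.eval x (f i) =
      ((F.filter fun e => Sum.elim (fun a => e.1 = a) (fun b => e.2 = b) i).card : ZMod q) := by
    intro i
    simp only [f, map_sum, hF]
    rw [Finset.filter_map, Finset.card_map, Finset.filter_filter, Finset.card_filter,
      Nat.cast_sum]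
    refine Finset.sum_congr rfl fun e _ => ?_
    by_cases h1 : Sum.elim (fun a => e.1.1 = a) (fun b => e.1.2 = b) i
    · by_cases h2 : x e = 0
      · rw [if_pos h1]
        simp [h2, hq1]
      · rw [if_pos h1]
        simp [h1, h2, ZMod.pow_card_sub_one_eq_one]
    · simp [h1]
  have fin : ∀ {x : ℕ}, x < 2 * q → q ∣ x → x = 0 ∨ x = q := by
    rintro x h ⟨y, rfl⟩
    have : y < 2 := by
      by_contra! h2
      nlinarith
    interval_cases y <;> simp
  refine ⟨F, hFE, ?_, ?_, ?_⟩
  · obtain ⟨e, he⟩ := hx0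
    exact ⟨e.1, by simp [hF, he]⟩
  · intro a
    by_cases ha : a ∈ A
    · refine fin ((rowDeg_mono hFE a).trans_lt (hr a)) ?_
      have := hx (.inl a) (by simpa using ha)
      rw [hev, ZMod.natCast_eq_zero_iff] at this
      convert this
      unfold rowDeg
      congr
    · left
      rw [rowDeg, Finset.card_eq_zero, Finset.filter_eq_empty_iff]
      rintro e he rfl
      exact ha (hA e (hFE he))
  · intro b
    by_cases hb : b ∈ B
    · refine fin ((colDeg_mono hFE b).trans_lt (hc b)) ?_
      have := hx (.inr b) (by simpa using hb)
      rw [hev, ZMod.natCast_eq_zero_iff] at this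
      convert this
      unfold colDeg
      congr
    · left
      rw [colDeg, Finset.card_eq_zero, Finset.filter_eq_empty_iff]
      rintro e he rfl
      exact hb (hB e (hFE he))

/-- A bipartite graph which is close to being regular contains a `q`-regular subgraph. -/
theorem hasRegularPart_of_nearly_regular [Fintype α] [Fintype β] (q : ℕ) [hq : Fact q.Prime]
    {E : Finset (α × β)} {A : Finset α} {B : Finset β} {D : ℕ} (hA : ∀ e ∈ E, e.1 ∈ A)
    (hB : ∀ e ∈ E, e.2 ∈ B) (hne : E.Nonempty) (hD : 2 * q ≤ D)
    (hr : ∀ a, rowDeg E a ≤ D) (hc : ∀ b, colDeg E b ≤ D)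
    (hcard : (2 * q - 1) * D * (A.card + B.card) ≤ 4 * q * E.card) : HasRegularPart E q := by
  obtain ⟨F, hFE, hFr, hFc, hF⟩ := exists_subset_degree_le E (m := 2 * q - 1) (by omega) hr hc
  have hq2 := hq.out.two_le
  refine (hasRegularPart_of_card_lt q (A := A) (B := B) (fun e he => hA e (hFE he))
    (fun e he => hB e (hFE he)) (fun a => ?_) (fun b => ?_) ?_).mono hFE
  · have := hFr a; omega
  · have := hFc b; omega
  · obtain ⟨p, rfl⟩ : ∃ p, q = p + 1 := ⟨q - 1, by omega⟩
    obtain ⟨e, he⟩ := hne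
    have hApos : 0 < A.card := Finset.card_pos.2 ⟨_, hA e he⟩
    set V := A.card + B.card with hV
    have e1 : 2 * (p + 1) - 1 = 2 * p + 1 := by omega
    rw [e1] at hF hcard
    rw [Nat.add_sub_cancel]
    have hDpos : 0 < D := by omega
    have h1 : D * ((2 * p + 1) * (2 * p + 1) * V) ≤ D * (4 * (p + 1) * F.card) := by
      calc D * ((2 * p + 1) * (2 * p + 1) * V) = (2 * p + 1) * ((2 * p + 1) * D * V) := by ring
        _ ≤ (2 * p + 1) * (4 * (p + 1) * E.card) := by gcongr
        _ = 4 * (p + 1) * ((2 * p + 1) * E.card) := by ring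
        _ ≤ 4 * (p + 1) * (D * F.card) := by gcongr
        _ = D * (4 * (p + 1) * F.card) := by ring
    have h2 := Nat.le_of_mul_le_mul_left h1 hDpos
    have hVpos : 0 < V := by omega
    by_contra! hcon
    have h3 : 4 * (p + 1) * F.card ≤ 4 * (p + 1) * (p * V) := by gcongr
    nlinarith

end Bipartite

section RandomSubset

variable {ι : Type*} [Fintype ι] [DecidableEq ι]

/-- The probability of the outcome `S` when every `i` is selected independently with
probability `p i`. -/
def setWeight (p : ι → ℝ) (S : Finset ι) : ℝ := (∏ i ∈ S, p i) * ∏ i ∈ Sᶜ, (1 - p i)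

theorem setWeight_nonneg {p : ι → ℝ} (h0 : ∀ i, 0 ≤ p i) (h1 : ∀ i, p i ≤ 1) (S : Finset ι) :
    0 ≤ setWeight p S :=
  mul_nonneg (Finset.prod_nonneg fun i _ => h0 i)
    (Finset.prod_nonneg fun i _ => sub_nonneg.2 (h1 i))

theorem sum_setWeight_mul_indicator (p : ι → ℝ) (T : Finset ι) :
    ∑ S, setWeight p S * (if T ⊆ S then 1 else 0) = ∏ i ∈ T, p i := by
  have h := Fintype.prod_add p (fun i => if i ∈ T then 0 else 1 - p i)
  have h1 : ∏ i, (p i + if i ∈ T then 0 else 1 - p i) = ∏ i ∈ T, p i := by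
    rw [← Finset.prod_subset (Finset.subset_univ T)]
    · exact Finset.prod_congr rfl fun i hi => by simp [hi]
    · intro i _ hi
      simp [hi]
  rw [← h1, h]
  refine Finset.sum_congr rfl fun S _ => ?_
  by_cases hS : T ⊆ S
  · rw [if_pos hS, mul_one, setWeight]
    congr 1
    refine Finset.prod_congr rfl fun i hi => ?_
    rw [if_neg fun h => Finset.mem_compl.1 hi (hS h)]
  · rw [if_neg hS, mul_zero]
    obtain ⟨i, hiT, hiS⟩ := Finset.not_subset.1 hS
    rw [Finset.prod_eq_zero (i := i) (s := Sᶜ) (by simpa using hiS) (by simp [hiT]), mul_zero]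

theorem sum_setWeight_mul_card {γ : Type*} (p : ι → ℝ) (J : Finset γ) (T : γ → Finset ι) :
    ∑ S, setWeight p S * ((J.filter fun e => T e ⊆ S).card : ℝ) = ∑ e ∈ J, ∏ i ∈ T e, p i := by
  simp_rw [Finset.card_filter, Nat.cast_sum, Finset.mul_sum]
  rw [Finset.sum_comm]
  refine Finset.sum_congr rfl fun e _ => ?_
  rw [← sum_setWeight_mul_indicator]
  simp

theorem sum_setWeight_mul_card_sq {γ : Type*} (p : ι → ℝ) (J : Finset γ) (T : γ → Finset ι) :
    ∑ S, setWeight p S * ((J.filter fun e => T e ⊆ S).card : ℝ) ^ 2 =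
      ∑ e ∈ J, ∑ e' ∈ J, ∏ i ∈ T e ∪ T e', p i := by
  have h : ∀ S, ((J.filter fun e => T e ⊆ S).card : ℝ) ^ 2 =
      (((J ×ˢ J).filter fun e => T e.1 ∪ T e.2 ⊆ S).card : ℝ) := by
    intro S
    rw [sq, ← Nat.cast_mul, ← Finset.card_product]
    congr 2
    ext e
    simp only [Finset.mem_product, Finset.mem_filter, Finset.union_subset_iff]
    tauto
  simp_rw [h]
  rw [sum_setWeight_mul_card p (J ×ˢ J) fun e => T e.1 ∪ T e.2, Finset.sum_product]

/-- Conditionally on `T₀ ⊆ S`, the number of `e ∈ J` with `T e ⊆ S` has mean at most `t` and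
variance at most `2 * t`. -/
def HasSmallVariance {γ : Type*} (p : ι → ℝ) (T₀ : Finset ι) (J : Finset γ)
    (T : γ → Finset ι) (t : ℝ) : Prop :=
  ∃ μ, 0 ≤ μ ∧ μ ≤ t ∧ ∑ e ∈ J, ∏ i ∈ T e, p i = μ * ∏ i ∈ T₀, p i ∧
    ∑ e ∈ J, ∑ e' ∈ J, ∏ i ∈ T e ∪ T e', p i ≤ (μ ^ 2 + 2 * t) * ∏ i ∈ T₀, p i

theorem le_mul_sub_sq {t δ μ x : ℝ} (ht : 0 < t) (hδ : 0 < δ) (hμ : μ ≤ t)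
    (hx : (1 + δ) * t ≤ x) : x ≤ (1 + δ) / (δ ^ 2 * t) * (x - μ) ^ 2 := by
  have h0 : 0 < δ * t := mul_pos hδ ht
  have h1 : (x - t) ^ 2 ≤ (x - μ) ^ 2 := by
    apply pow_le_pow_left₀ <;> nlinarith
  rw [div_mul_eq_mul_div, le_div_iff₀ (by positivity)]
  have h2 : 0 ≤ x - t - δ * t := by linarith
  have h3 : x * (δ ^ 2 * t) ≤ (1 + δ) * (x - t) ^ 2 := by
    have : (1 + δ) * (x - t) ^ 2 - x * (δ ^ 2 * t) =
      (x - t - δ * t) * ((1 + δ) * (x - t - δ * t) + (2 + δ) * (δ * t)) := by ring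
    have : 0 ≤ (x - t - δ * t) * ((1 + δ) * (x - t - δ * t) + (2 + δ) * (δ * t)) := by positivity
    linarith
  nlinarith

theorem HasSmallVariance.sum_overflow_le {γ : Type*} {p : ι → ℝ} (h0 : ∀ i, 0 ≤ p i)
    (h1 : ∀ i, p i ≤ 1) {T₀ : Finset ι} {J : Finset γ} {T : γ → Finset ι} {t δ : ℝ}
    (h : HasSmallVariance p T₀ J T t) (ht : 0 < t) (hδ : 0 < δ) (hT : ∀ e ∈ J, T₀ ⊆ T e) :
    ∑ S, setWeight p S * (if (1 + δ) * t ≤ (J.filter fun e => T e ⊆ S).card then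
      ((J.filter fun e => T e ⊆ S).card : ℝ) else 0) ≤
      2 * (1 + δ) / δ ^ 2 * ∏ i ∈ T₀, p i := by
  obtain ⟨μ, hμ0, hμt, hmean, hvar⟩ := h
  set x : Finset ι → ℝ := fun S => ((J.filter fun e => T e ⊆ S).card : ℝ) with hx
  set c := (1 + δ) / (δ ^ 2 * t) with hc
  have hc0 : 0 < c := by positivity
  have hx0 : ∀ S, ¬ T₀ ⊆ S → x S = 0 := by
    intro S hS
    simp only [hx, Nat.cast_eq_zero, Finset.card_eq_zero, Finset.filter_eq_empty_iff]
    exact fun e he h => hS ((hT e he).trans h)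
  have key : ∀ S, setWeight p S * (if (1 + δ) * t ≤ x S then x S else 0) ≤
      c * (setWeight p S * x S ^ 2 - 2 * μ * (setWeight p S * x S) +
        μ ^ 2 * (setWeight p S * if T₀ ⊆ S then 1 else 0)) := by
    intro S
    have hw := setWeight_nonneg h0 h1 S
    by_cases hS : T₀ ⊆ S
    · rw [if_pos hS]
      calc setWeight p S * (if (1 + δ) * t ≤ x S then x S else 0)
          ≤ setWeight p S * (c * (x S - μ) ^ 2) := by
            refine mul_le_mul_of_nonneg_left ?_ hw
            split_ifs with h
            · exact le_mul_sub_sq ht hδ hμt h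
            · positivity
        _ = _ := by ring
    · rw [if_neg hS, hx0 S hS]
      simp
  calc ∑ S, setWeight p S * (if (1 + δ) * t ≤ x S then x S else 0)
      ≤ ∑ S, c * (setWeight p S * x S ^ 2 - 2 * μ * (setWeight p S * x S) +
        μ ^ 2 * (setWeight p S * if T₀ ⊆ S then 1 else 0)) := Finset.sum_le_sum fun S _ => key S
    _ = c * (∑ e ∈ J, ∑ e' ∈ J, ∏ i ∈ T e ∪ T e', p i - 2 * μ * ∑ e ∈ J, ∏ i ∈ T e, p i +
        μ ^ 2 * ∏ i ∈ T₀, p i) := by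
      rw [← Finset.mul_sum, Finset.sum_add_distrib, Finset.sum_sub_distrib, ← Finset.mul_sum,
        ← Finset.mul_sum, sum_setWeight_mul_indicator, sum_setWeight_mul_card_sq,
        sum_setWeight_mul_card]
    _ ≤ c * (2 * t * ∏ i ∈ T₀, p i) := by
      refine mul_le_mul_of_nonneg_left ?_ hc0.le
      rw [hmean]
      linarith
    _ = _ := by
      rw [hc]
      field_simp

end RandomSubset

section RandomSubgraph

variable {α β ι : Type*} [DecidableEq α] [DecidableEq β] [Fintype α] [Fintype β]
  [Fintype ι] [DecidableEq ι]

omit [Fintype α] [Fintype β] in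
theorem card_le_card_add_overflow {E : Finset (α × β)} {A : Finset α} {B : Finset β}
    (hA : ∀ e ∈ E, e.1 ∈ A) (hB : ∀ e ∈ E, e.2 ∈ B) (D : ℕ) :
    (E.card : ℝ) ≤ ((E.filter fun e => rowDeg E e.1 ≤ D ∧ colDeg E e.2 ≤ D).card : ℝ) +
      (∑ a ∈ A, if (D : ℝ) ≤ rowDeg E a then (rowDeg E a : ℝ) else 0) +
      ∑ b ∈ B, if (D : ℝ) ≤ colDeg E b then (colDeg E b : ℝ) else 0 := by
  have h1 : ∑ a ∈ A, (if (D : ℝ) ≤ rowDeg E a then (rowDeg E a : ℝ) else 0) =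
      ∑ e ∈ E, if D ≤ rowDeg E e.1 then (1 : ℝ) else 0 := by
    rw [← Finset.sum_fiberwise_of_maps_to hA]
    refine Finset.sum_congr rfl fun a _ => ?_
    rw [Finset.sum_congr rfl (g := fun _ => if D ≤ rowDeg E a then (1 : ℝ) else 0)]
    · rw [Finset.sum_const, nsmul_eq_mul]
      change _ = (rowDeg E a : ℝ) * _
      by_cases h : D ≤ rowDeg E a
      · simp [h]
      · simp [h]
    · intro e he
      rw [(Finset.mem_filter.1 he).2]
  have h2 : ∑ b ∈ B, (if (D : ℝ) ≤ colDeg E b then (colDeg E b : ℝ) else 0) =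
      ∑ e ∈ E, if D ≤ colDeg E e.2 then (1 : ℝ) else 0 := by
    rw [← Finset.sum_fiberwise_of_maps_to hB]
    refine Finset.sum_congr rfl fun b _ => ?_
    rw [Finset.sum_congr rfl (g := fun _ => if D ≤ colDeg E b then (1 : ℝ) else 0)]
    · rw [Finset.sum_const, nsmul_eq_mul]
      change _ = (colDeg E b : ℝ) * _
      by_cases h : D ≤ colDeg E b
      · simp [h]
      · simp [h]
    · intro e he
      rw [(Finset.mem_filter.1 he).2]
  rw [h1, h2, ← Finset.sum_boole, ← Finset.sum_add_distrib, ← Finset.sum_add_distrib,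
    Finset.card_eq_sum_ones, Nat.cast_sum]
  refine Finset.sum_le_sum fun e _ => ?_
  push_cast
  by_cases h1 : D ≤ rowDeg E e.1
  · rw [if_pos h1]
    have : (0 : ℝ) ≤ if rowDeg E e.1 ≤ D ∧ colDeg E e.2 ≤ D then 1 else 0 := by positivity
    have : (0 : ℝ) ≤ if D ≤ colDeg E e.2 then 1 else 0 := by positivity
    linarith
  · rw [if_neg h1]
    by_cases h2 : D ≤ colDeg E e.2
    · rw [if_pos h2]
      have : (0 : ℝ) ≤ if rowDeg E e.1 ≤ D ∧ colDeg E e.2 ≤ D then 1 else 0 := by positivity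
      linarith
    · rw [if_pos ⟨by omega, by omega⟩]
      split_ifs
      norm_num

/-- If a random induced-type subgraph of `E` is close to regular on average, then `E` contains
a `q`-regular subgraph. A vertex or edge `w` survives when its set `T w` is selected. -/
theorem hasRegularPart_of_hasSmallVariance (q : ℕ) [hq : Fact q.Prime] {t : ℝ}
    (ht : t = 2048 * (q : ℝ) ^ 3) {E : Finset (α × β)} {A : Finset α} {B : Finset β}
    (hA : ∀ e ∈ E, e.1 ∈ A) (hB : ∀ e ∈ E, e.2 ∈ B) {p : ι → ℝ} (h0 : ∀ i, 0 ≤ p i)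
    (h1 : ∀ i, p i ≤ 1) (TA : α → Finset ι) (TB : β → Finset ι) (TE : α × β → Finset ι)
    (hTA : ∀ e ∈ E, TA e.1 ⊆ TE e) (hTB : ∀ e ∈ E, TB e.2 ⊆ TE e)
    (hvA : ∀ a ∈ A, HasSmallVariance p (TA a) (E.filter fun e => e.1 = a) TE t)
    (hvB : ∀ b ∈ B, HasSmallVariance p (TB b) (E.filter fun e => e.2 = b) TE t)
    (hpos : 0 < ∑ a ∈ A, ∏ i ∈ TA a, p i + ∑ b ∈ B, ∏ i ∈ TB b, p i)
    (hedge : (1 - 1 / (8 * q)) * (t / 2) *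
      (∑ a ∈ A, ∏ i ∈ TA a, p i + ∑ b ∈ B, ∏ i ∈ TB b, p i) ≤ ∑ e ∈ E, ∏ i ∈ TE e, p i) :
    HasRegularPart E q := by
  have hq2 : (2 : ℝ) ≤ q := by exact_mod_cast hq.out.two_le
  set δ : ℝ := 1 / (8 * q) with hδ
  have hδ0 : 0 < δ := by positivity
  have hqδ : q * δ = 1 / 8 := by rw [hδ]; field_simp
  have ht0 : 0 < t := by rw [ht]; positivity
  set D : ℕ := 256 * q ^ 2 * (8 * q + 1) with hD
  have hDt : (D : ℝ) = (1 + δ) * t := by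
    rw [hD, ht, hδ]
    push_cast
    field_simp
    ring
  set W := ∑ a ∈ A, ∏ i ∈ TA a, p i + ∑ b ∈ B, ∏ i ∈ TB b, p i with hW
  set ES : Finset ι → Finset (α × β) := fun S => E.filter fun e => TE e ⊆ S with hES
  set FS : Finset ι → Finset (α × β) := fun S =>
    (ES S).filter fun e => rowDeg (ES S) e.1 ≤ D ∧ colDeg (ES S) e.2 ≤ D with hFS
  set AS : Finset ι → Finset α := fun S => A.filter fun a => TA a ⊆ S with hAS
  set BS : Finset ι → Finset β := fun S => B.filter fun b => TB b ⊆ S with hBS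
  have hrow : ∀ S a, rowDeg (ES S) a =
      ((E.filter fun e => e.1 = a).filter fun e => TE e ⊆ S).card := by
    intro S a
    rw [rowDeg, hES, Finset.filter_comm]
  have hcol : ∀ S b, colDeg (ES S) b =
      ((E.filter fun e => e.2 = b).filter fun e => TE e ⊆ S).card := by
    intro S b
    rw [colDeg, hES, Finset.filter_comm]
  have hF : ∑ e ∈ E, ∏ i ∈ TE e, p i - 2 * (1 + δ) / δ ^ 2 * W ≤
      ∑ S, setWeight p S * ((FS S).card : ℝ) := by
    have hSle : ∀ S, setWeight p S * ((ES S).card : ℝ) ≤ setWeight p S * ((FS S).card : ℝ) +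
        (∑ a ∈ A, setWeight p S *
          if (D : ℝ) ≤ rowDeg (ES S) a then (rowDeg (ES S) a : ℝ) else 0) +
        ∑ b ∈ B, setWeight p S *
          if (D : ℝ) ≤ colDeg (ES S) b then (colDeg (ES S) b : ℝ) else 0 := by
      intro S
      rw [← Finset.mul_sum, ← Finset.mul_sum, ← mul_add, ← mul_add]
      exact mul_le_mul_of_nonneg_left (card_le_card_add_overflow
        (fun e he => hA e (Finset.mem_filter.1 he).1)
        (fun e he => hB e (Finset.mem_filter.1 he).1) D) (setWeight_nonneg h0 h1 S)
    have hsum := Finset.sum_le_sum fun S (_ : S ∈ Finset.univ) => hSle S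
    rw [Finset.sum_add_distrib, Finset.sum_add_distrib, sum_setWeight_mul_card,
      Finset.sum_comm (t := A), Finset.sum_comm (t := B)] at hsum
    have hAle : ∑ a ∈ A, ∑ S, setWeight p S *
        (if (D : ℝ) ≤ rowDeg (ES S) a then (rowDeg (ES S) a : ℝ) else 0) ≤
        ∑ a ∈ A, 2 * (1 + δ) / δ ^ 2 * ∏ i ∈ TA a, p i := by
      refine Finset.sum_le_sum fun a ha => ?_
      simp_rw [hrow, hDt]
      refine (hvA a ha).sum_overflow_le h0 h1 ht0 hδ0 fun e he => ?_
      rw [Finset.mem_filter] at he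
      exact he.2 ▸ hTA e he.1
    have hBle : ∑ b ∈ B, ∑ S, setWeight p S *
        (if (D : ℝ) ≤ colDeg (ES S) b then (colDeg (ES S) b : ℝ) else 0) ≤
        ∑ b ∈ B, 2 * (1 + δ) / δ ^ 2 * ∏ i ∈ TB b, p i := by
      refine Finset.sum_le_sum fun b hb => ?_
      simp_rw [hcol, hDt]
      refine (hvB b hb).sum_overflow_le h0 h1 ht0 hδ0 fun e he => ?_
      rw [Finset.mem_filter] at he
      exact he.2 ▸ hTB e he.1
    rw [← Finset.mul_sum] at hAle hBle
    rw [hW, mul_add]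
    linarith
  obtain ⟨S, -, hS⟩ : ∃ S ∈ Finset.univ, (0 : ℝ) < setWeight p S * (4 * q * (FS S).card -
      (2 * q - 1) * D * ((AS S).card + (BS S).card)) := by
    apply Finset.exists_lt_of_sum_lt
    rw [Finset.sum_const_zero]
    have hsplit : ∑ S, setWeight p S * (4 * q * ((FS S).card : ℝ) -
        (2 * q - 1) * D * ((AS S).card + (BS S).card)) =
        4 * q * ∑ S, setWeight p S * ((FS S).card : ℝ) - (2 * q - 1) * D * W := by
      rw [hW, ← sum_setWeight_mul_card p A TA, ← sum_setWeight_mul_card p B TB,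
        ← Finset.sum_add_distrib, Finset.mul_sum, Finset.mul_sum, ← Finset.sum_sub_distrib]
      refine Finset.sum_congr rfl fun S _ => ?_
      ring
    rw [hsplit, hDt]
    have h2 : 4 * q * ((1 - δ) * (t / 2) * W - 2 * (1 + δ) / δ ^ 2 * W) ≤
        4 * q * ∑ S, setWeight p S * ((FS S).card : ℝ) := by
      refine mul_le_mul_of_nonneg_left ?_ (by positivity)
      linarith
    have h3 : (1 + δ) / δ ^ 2 = 64 * q ^ 2 * (1 + δ) := by
      rw [hδ]
      field_simp
      norm_num
    have h4 : 4 * q * ((1 - δ) * (t / 2) * W - 2 * (1 + δ) / δ ^ 2 * W) -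
        (2 * q - 1) * ((1 + δ) * t) * W =
        W * (t * (1 + δ - 4 * (q * δ)) - 512 * q ^ 3 * (1 + δ)) := by
      rw [mul_div_assoc, h3]
      ring
    have h5 : 0 < W * (t * (1 + δ - 4 * (q * δ)) - 512 * q ^ 3 * (1 + δ)) := by
      refine mul_pos hpos ?_
      rw [hqδ, ht]
      have : (0 : ℝ) < q ^ 3 * (1 + 3 * δ) := by positivity
      nlinarith
    linarith
  have hw := setWeight_nonneg h0 h1 S
  have hS' := pos_of_mul_pos_right hS hw
  have hFSE : FS S ⊆ ES S := Finset.filter_subset _ _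
  have hESE : ES S ⊆ E := Finset.filter_subset _ _
  have hq1 := hq.out.one_le
  refine (hasRegularPart_of_nearly_regular q (A := AS S) (B := BS S) (D := D)
    (E := FS S) ?_ ?_ ?_ ?_ ?_ ?_ ?_).mono (hFSE.trans hESE)
  · intro e he
    have := Finset.mem_filter.1 (hFSE he)
    exact Finset.mem_filter.2 ⟨hA e this.1, (hTA e this.1).trans this.2⟩
  · intro e he
    have := Finset.mem_filter.1 (hFSE he)
    exact Finset.mem_filter.2 ⟨hB e this.1, (hTB e this.1).trans this.2⟩
  · rw [← Finset.card_pos]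
    by_contra hcon
    have h0 : (FS S).card = 0 := by omega
    rw [h0] at hS'
    have : 0 ≤ (2 * (q : ℝ) - 1) * D * ((AS S).card + (BS S).card) := by
      have : 0 ≤ 2 * (q : ℝ) - 1 := by linarith
      positivity
    simp at hS'
    linarith
  · rw [hD]
    nlinarith
  · intro a
    by_contra! hcon
    have : 0 < rowDeg (FS S) a := by omega
    obtain ⟨e, he⟩ := Finset.card_pos.1 this
    rw [Finset.mem_filter] at he
    have h6 := (Finset.mem_filter.1 he.1).2.1
    rw [he.2] at h6
    exact absurd ((rowDeg_mono hFSE a).trans h6) (by omega)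
  · intro b
    by_contra! hcon
    have : 0 < colDeg (FS S) b := by omega
    obtain ⟨e, he⟩ := Finset.card_pos.1 this
    rw [Finset.mem_filter] at he
    have h6 := (Finset.mem_filter.1 he.1).2.2
    rw [he.2] at h6
    exact absurd ((colDeg_mono hFSE b).trans h6) (by omega)
  · have e1 : ((2 * q - 1 : ℕ) : ℝ) = 2 * q - 1 := by
      rw [Nat.cast_sub (by omega)]
      push_cast
      rfl
    have : (((2 * q - 1) * D * ((AS S).card + (BS S).card) : ℕ) : ℝ) ≤
        ((4 * q * (FS S).card : ℕ) : ℝ) := by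
      push_cast [e1]
      linarith
    exact_mod_cast this

end RandomSubgraph

theorem HasSmallVariance.of_pairwise {γ ι : Type*} [DecidableEq ι] {p : ι → ℝ}
    {T₀ : Finset ι} {J : Finset γ} {T : γ → Finset ι} {s t : ℝ} (g : γ → γ → ℝ)
    (hp : 0 < ∏ i ∈ T₀, p i) (hs : 0 ≤ s) (hJ : J.card * s ≤ t * ∏ i ∈ T₀, p i)
    (hT : ∀ e ∈ J, ∏ i ∈ T e, p i = s) (hg : ∀ e ∈ J, ∀ e' ∈ J, 0 ≤ g e e')
    (hgsum : ∑ e ∈ J, ∑ e' ∈ J, g e e' ≤ t * ∏ i ∈ T₀, p i)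
    (hpair : ∀ e ∈ J, ∀ e' ∈ J, e ≠ e' →
      ∏ i ∈ T e ∪ T e', p i ≤ s ^ 2 / ∏ i ∈ T₀, p i + g e e') :
    HasSmallVariance p T₀ J T t := by
  classical
  set P := ∏ i ∈ T₀, p i with hP
  refine ⟨J.card * s / P, by positivity, (div_le_iff₀ hp).2 hJ, ?_, ?_⟩
  · rw [Finset.sum_congr rfl hT, Finset.sum_const, nsmul_eq_mul]
    exact (div_mul_cancel₀ _ hp.ne').symm
  · calc ∑ e ∈ J, ∑ e' ∈ J, ∏ i ∈ T e ∪ T e', p i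
        ≤ ∑ e ∈ J, ∑ e' ∈ J, (s ^ 2 / P + g e e' + if e = e' then s else 0) := by
          refine Finset.sum_le_sum fun e he => Finset.sum_le_sum fun e' he' => ?_
          split_ifs with h
          · rw [← h, Finset.union_self, hT e he]
            have := hg e he e he
            have : 0 ≤ s ^ 2 / P := by positivity
            linarith
          · linarith [hpair e he e' he' h]
      _ = J.card ^ 2 * (s ^ 2 / P) + ∑ e ∈ J, ∑ e' ∈ J, g e e' + J.card * s := by
          simp_rw [Finset.sum_add_distrib, Finset.sum_const, nsmul_eq_mul, Finset.sum_ite_eq]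
          rw [Finset.sum_congr rfl (g := fun _ => s) (fun e he => if_pos he), Finset.sum_const,
            nsmul_eq_mul]
          ring
      _ ≤ J.card ^ 2 * (s ^ 2 / P) + t * P + t * P := by linarith
      _ = ((J.card * s / P) ^ 2 + 2 * t) * P := by
          field_simp
          ring

section Dense

variable {α β : Type*} [DecidableEq α] [DecidableEq β] [Fintype α] [Fintype β]

/-- A bipartite graph whose edges are numerous compared to its maximum degree contains a
`q`-regular subgraph. -/
theorem hasRegularPart_of_card_sq (q : ℕ) [hq : Fact q.Prime] {E : Finset (α × β)}
    {A : Finset α} {B : Finset β} {Δ : ℕ} (hA : ∀ e ∈ E, e.1 ∈ A) (hB : ∀ e ∈ E, e.2 ∈ B)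
    (hne : E.Nonempty) (hr : ∀ a, rowDeg E a ≤ Δ) (hc : ∀ b, colDeg E b ≤ Δ)
    (hcard : 262144 * (q : ℝ) ^ 5 * Δ * A.card * B.card ≤ (E.card : ℝ) ^ 2) :
    HasRegularPart E q := by
  have hq2 : (2 : ℝ) ≤ q := by exact_mod_cast hq.out.two_le
  obtain ⟨t, ht⟩ : ∃ t : ℝ, t = 2048 * (q : ℝ) ^ 3 := ⟨_, rfl⟩
  obtain ⟨δ, hδ⟩ : ∃ δ : ℝ, δ = 1 / (8 * q) := ⟨_, rfl⟩
  have hδ0 : 0 < δ := by rw [hδ]; positivity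
  have hδ1 : δ ≤ 1 := by
    rw [hδ, div_le_one (by positivity)]
    linarith
  have ht0 : 0 < t := by rw [ht]; positivity
  have hm : (0 : ℝ) < E.card := by exact_mod_cast Finset.card_pos.2 hne
  obtain ⟨e₀, he₀⟩ := hne
  have hnA : (0 : ℝ) < A.card := by exact_mod_cast Finset.card_pos.2 ⟨_, hA e₀ he₀⟩
  have hnB : (0 : ℝ) < B.card := by exact_mod_cast Finset.card_pos.2 ⟨_, hB e₀ he₀⟩
  have hmA : (E.card : ℝ) ≤ A.card * Δ := by
    rw [← sum_rowDeg hA]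
    exact_mod_cast Finset.sum_le_card_nsmul _ _ _ fun a _ => hr a
  have hmB : (E.card : ℝ) ≤ B.card * Δ := by
    rw [← sum_colDeg hB]
    exact_mod_cast Finset.sum_le_card_nsmul _ _ _ fun b _ => hc b
  have hΔ : (0 : ℝ) < Δ := by
    by_contra h
    have : (Δ : ℝ) = 0 := le_antisymm (not_lt.1 h) (by positivity)
    rw [this, mul_zero] at hmA
    linarith
  set s := t / (2 * Δ) with hs
  have hs0 : 0 < s := by positivity
  set m := (E.card : ℝ) with hm'
  set θA := δ * m / (A.card * (2 * Δ)) with hθA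
  set θB := δ * m / (B.card * (2 * Δ)) with hθB
  have hθA0 : 0 < θA := by positivity
  have hθB0 : 0 < θB := by positivity
  have hθ1 : ∀ n : ℝ, 0 < n → m ≤ n * Δ → δ * m / (n * (2 * Δ)) ≤ 1 / 2 := by
    intro n hn h
    rw [div_le_div_iff₀ (by positivity) (by positivity)]
    nlinarith
  have hsθ : s ≤ θA * θB := by
    have h1 : t * (2 * Δ * A.card * B.card) ≤ δ ^ 2 * m ^ 2 := by
      have : t * (2 * Δ * A.card * B.card) =
          δ ^ 2 * (262144 * (q : ℝ) ^ 5 * Δ * A.card * B.card) := by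
        rw [ht, hδ]
        field_simp
        norm_num
      rw [this]
      gcongr
    rw [hs, hθA, hθB, div_mul_div_comm, div_le_div_iff₀ (by positivity) (by positivity)]
    have h2 : (0 : ℝ) ≤ 2 * Δ := by positivity
    calc t * (A.card * (2 * Δ) * (B.card * (2 * Δ)))
        = t * (2 * Δ * A.card * B.card) * (2 * Δ) := by ring
      _ ≤ δ ^ 2 * m ^ 2 * (2 * Δ) := by gcongr
      _ = δ * m * (δ * m) * (2 * Δ) := by ring
  set πA : α → ℝ := fun a => rowDeg E a / (2 * Δ) + θA with hπA
  set πB : β → ℝ := fun b => colDeg E b / (2 * Δ) + θB with hπB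
  have hπAθ : ∀ a, θA ≤ πA a := fun a => le_add_of_nonneg_left (by positivity)
  have hπBθ : ∀ b, θB ≤ πB b := fun b => le_add_of_nonneg_left (by positivity)
  have hπA0 : ∀ a, 0 < πA a := fun a => hθA0.trans_le (hπAθ a)
  have hπB0 : ∀ b, 0 < πB b := fun b => hθB0.trans_le (hπBθ b)
  have half : ∀ n : ℕ, n ≤ Δ → (n : ℝ) / (2 * Δ) ≤ 1 / 2 := by
    intro n hn
    have : (n : ℝ) ≤ Δ := by exact_mod_cast hn
    rw [div_le_div_iff₀ (by positivity) (by positivity)]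
    linarith
  obtain ⟨p, hpA, hpB, hpE⟩ : ∃ p : α ⊕ β ⊕ (α × β) → ℝ, (∀ a, p (.inl a) = πA a) ∧
      (∀ b, p (.inr (.inl b)) = πB b) ∧
      ∀ e, p (.inr (.inr e)) = s / (πA e.1 * πB e.2) :=
    ⟨Sum.elim πA (Sum.elim πB fun e => s / (πA e.1 * πB e.2)), fun _ => rfl, fun _ => rfl,
      fun _ => rfl⟩
  have hp0 : ∀ i, 0 ≤ p i := by
    rintro (a | b | e)
    · rw [hpA]; exact (hπA0 a).le
    · rw [hpB]; exact (hπB0 b).le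
    · rw [hpE]
      have := hπA0 e.1
      have := hπB0 e.2
      positivity
  have hp1 : ∀ i, p i ≤ 1 := by
    rintro (a | b | e)
    · rw [hpA]
      linarith [half _ (hr a), hθ1 _ hnA hmA]
    · rw [hpB]
      linarith [half _ (hc b), hθ1 _ hnB hmB]
    · rw [hpE, div_le_one (mul_pos (hπA0 _) (hπB0 _))]
      exact hsθ.trans (mul_le_mul (hπAθ _) (hπBθ _) hθB0.le (hπA0 _).le)
  obtain ⟨TA, hTA⟩ : ∃ TA : α → Finset (α ⊕ β ⊕ (α × β)), ∀ a, TA a = {.inl a} :=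
    ⟨_, fun _ => rfl⟩
  obtain ⟨TB, hTB⟩ : ∃ TB : β → Finset (α ⊕ β ⊕ (α × β)), ∀ b, TB b = {.inr (.inl b)} :=
    ⟨_, fun _ => rfl⟩
  obtain ⟨TE, hTE⟩ : ∃ TE : α × β → Finset (α ⊕ β ⊕ (α × β)), ∀ e, TE e =
      {.inl e.1, .inr (.inl e.2), .inr (.inr e)} := ⟨_, fun _ => rfl⟩
  have hPA : ∀ a, ∏ i ∈ TA a, p i = πA a := by simp [hTA, hpA]
  have hPB : ∀ b, ∏ i ∈ TB b, p i = πB b := by simp [hTB, hpB]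
  have hPE : ∀ e, ∏ i ∈ TE e, p i = s := by
    intro e
    have := hπA0 e.1
    have := hπB0 e.2
    rw [hTE, Finset.prod_insert (by simp), Finset.prod_insert (by simp), Finset.prod_singleton,
      hpA, hpB, hpE]
    field_simp
  have hsum : ∀ n : ℕ, (n : ℝ) * s = t * (n / (2 * Δ)) := by
    intro n
    rw [hs]
    ring
  refine hasRegularPart_of_hasSmallVariance q ht hA hB hp0 hp1 TA TB TE ?_ ?_ ?_ ?_ ?_ ?_
  · intro e _
    simp [hTA, hTE]
  · intro e _
    simp [hTB, hTE]
  · intro a _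
    refine HasSmallVariance.of_pairwise (s := s) (fun _ _ => 0) ?_ hs0.le ?_ (fun e _ => hPE e)
      (fun _ _ _ _ => le_rfl) ?_ ?_
    · rw [hPA]
      exact hπA0 a
    · rw [hPA, hsum]
      exact mul_le_mul_of_nonneg_left (le_add_of_nonneg_right hθA0.le) ht0.le
    · simp only [Finset.sum_const_zero, hPA]
      exact mul_nonneg ht0.le (hπA0 a).le
    · rintro ⟨a₁, b⟩ he ⟨a₂, b'⟩ he' hee
      obtain rfl : a₁ = a := (Finset.mem_filter.1 he).2
      obtain rfl : a₂ = a₁ := (Finset.mem_filter.1 he').2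
      have hbb : b ≠ b' := fun h => hee (by rw [h])
      have hU : TE (a₂, b) ∪ TE (a₂, b') = {.inl a₂, .inr (.inl b), .inr (.inl b'),
          .inr (.inr (a₂, b)), .inr (.inr (a₂, b'))} := by
        rw [hTE, hTE]
        ext i
        simp only [Finset.mem_union, Finset.mem_insert, Finset.mem_singleton]
        tauto
      have := hπA0 a₂
      have := hπB0 b
      have := hπB0 b'
      rw [hPA, hU, Finset.prod_insert (by simp), Finset.prod_insert (by simp [hbb]),
        Finset.prod_insert (by simp), Finset.prod_insert (by simp [hbb]),
        Finset.prod_singleton, hpA, hpB, hpB, hpE, hpE]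
      apply le_of_eq
      field_simp
      ring
  · intro b _
    refine HasSmallVariance.of_pairwise (s := s) (fun _ _ => 0) ?_ hs0.le ?_ (fun e _ => hPE e)
      (fun _ _ _ _ => le_rfl) ?_ ?_
    · rw [hPB]
      exact hπB0 b
    · rw [hPB, hsum]
      exact mul_le_mul_of_nonneg_left (le_add_of_nonneg_right hθB0.le) ht0.le
    · simp only [Finset.sum_const_zero, hPB]
      exact mul_nonneg ht0.le (hπB0 b).le
    · rintro ⟨a, b₁⟩ he ⟨a', b₂⟩ he' hee
      obtain rfl : b₁ = b := (Finset.mem_filter.1 he).2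
      obtain rfl : b₂ = b₁ := (Finset.mem_filter.1 he').2
      have haa : a ≠ a' := fun h => hee (by rw [h])
      have hU : TE (a, b₂) ∪ TE (a', b₂) = {.inl a, .inl a', .inr (.inl b₂),
          .inr (.inr (a, b₂)), .inr (.inr (a', b₂))} := by
        rw [hTE, hTE]
        ext i
        simp only [Finset.mem_union, Finset.mem_insert, Finset.mem_singleton]
        tauto
      have := hπB0 b₂
      have := hπA0 a
      have := hπA0 a'
      rw [hPB, hU, Finset.prod_insert (by simp [haa]), Finset.prod_insert (by simp),
        Finset.prod_insert (by simp), Finset.prod_insert (by simp [haa]),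
        Finset.prod_singleton, hpA, hpA, hpB, hpE, hpE]
      apply le_of_eq
      field_simp
      ring
  · simp_rw [hPA, hPB]
    refine add_pos_of_nonneg_of_pos (Finset.sum_nonneg fun a _ => (hπA0 a).le) ?_
    exact Finset.sum_pos (fun b _ => hπB0 b) ⟨_, hB e₀ he₀⟩
  · have h1 : ∑ a ∈ A, πA a = (1 + δ) * m / (2 * Δ) := by
      rw [hπA, Finset.sum_add_distrib, ← Finset.sum_div, ← Nat.cast_sum, sum_rowDeg hA,
        Finset.sum_const, nsmul_eq_mul, hθA, ← hm']
      field_simp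
    have h2 : ∑ b ∈ B, πB b = (1 + δ) * m / (2 * Δ) := by
      rw [hπB, Finset.sum_add_distrib, ← Finset.sum_div, ← Nat.cast_sum, sum_colDeg hB,
        Finset.sum_const, nsmul_eq_mul, hθB, ← hm']
      field_simp
    simp_rw [hPA, hPB, hPE]
    rw [h1, h2, Finset.sum_const, nsmul_eq_mul, ← hδ, ← hm', hs]
    have h3 : (1 - δ) * (t / 2) * ((1 + δ) * m / (2 * Δ) + (1 + δ) * m / (2 * Δ)) =
        m * (t / (2 * Δ)) - δ ^ 2 * (m * (t / (2 * Δ))) := by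
      field_simp
      ring
    rw [h3]
    have : 0 ≤ δ ^ 2 * (m * (t / (2 * Δ))) := by positivity
    linarith

end Dense

section SmallCodegree

variable {α β : Type*} [DecidableEq α] [DecidableEq β] [Fintype α]

/-- The vertices adjacent to `b`. -/
def colNbhd (E : Finset (α × β)) (b : β) : Finset α := Finset.univ.filter fun a => (a, b) ∈ E

@[simp]
theorem mem_colNbhd {E : Finset (α × β)} {a : α} {b : β} : a ∈ colNbhd E b ↔ (a, b) ∈ E := by
  simp [colNbhd]

theorem card_colNbhd (E : Finset (α × β)) (b : β) : (colNbhd E b).card = colDeg E b := by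
  refine Finset.card_bij (fun a _ => (a, b)) (by simp) (by simp) ?_
  rintro ⟨a, b'⟩ h
  simp only [Finset.mem_filter] at h
  exact ⟨a, by simpa [← h.2] using h.1, by simp [← h.2]⟩

/-- A bipartite graph of small codegrees which is regular on one side contains a `q`-regular
subgraph. -/
theorem hasRegularPart_of_codegree_le [Fintype β] (q : ℕ) [hq : Fact q.Prime] {τ l Δ : ℕ}
    (hτ : τ = 2048 * q ^ 3) {θ : ℝ} {E : Finset (α × β)} {A : Finset α} {B : Finset β}
    (hA : ∀ e ∈ E, e.1 ∈ A) (hB : ∀ e ∈ E, e.2 ∈ B) (hne : B.Nonempty)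
    (hc : ∀ b ∈ B, colDeg E b = τ) (hr : ∀ a, rowDeg E a ≤ Δ)
    (hcodeg : ∀ a a', a ≠ a' → (B.filter fun b => (a, b) ∈ E ∧ (a', b) ∈ E).card ≤ l)
    (hl : 1 ≤ l) (hθ0 : 0 < θ) (hθ1 : θ ≤ 1 / 2) (hθA : θ * A.card * Δ ≤ B.card)
    (hθl : τ ^ 2 * l ≤ θ ^ τ * (2 * Δ)) : HasRegularPart E q := by
  have hq2 : (2 : ℝ) ≤ q := by exact_mod_cast hq.out.two_le
  obtain ⟨t, ht⟩ : ∃ t : ℝ, t = 2048 * (q : ℝ) ^ 3 := ⟨_, rfl⟩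
  have hτt : (τ : ℝ) = t := by
    rw [hτ, ht]
    push_cast
    rfl
  have ht1 : 1 ≤ t := by
    have : (1 : ℝ) ≤ q ^ 3 := one_le_pow₀ (by linarith)
    linarith
  have ht0 : 0 < t := by linarith
  obtain ⟨δ, hδ⟩ : ∃ δ : ℝ, δ = 1 / (8 * q) := ⟨_, rfl⟩
  have hδ0 : 0 < δ := by rw [hδ]; positivity
  have hδ1 : δ ≤ 1 := by
    rw [hδ, div_le_one (by positivity)]
    linarith
  have hδt : 1 ≤ δ * t := by
    rw [hδ, ht, div_mul_eq_mul_div, le_div_iff₀ (by positivity)]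
    have : (q : ℝ) ≤ q ^ 3 := le_self_pow₀ (by linarith) (by norm_num)
    linarith
  have hl' : (1 : ℝ) ≤ l := by exact_mod_cast hl
  rw [hτt] at hθl
  have hΔ : (0 : ℝ) < Δ := by
    by_contra h
    have : (Δ : ℝ) = 0 := le_antisymm (not_lt.1 h) (by positivity)
    rw [this, mul_zero, mul_zero] at hθl
    have : 0 < t ^ 2 * l := by positivity
    linarith
  set s := t / (2 * Δ) with hs
  have hs0 : 0 < s := by positivity
  have hsl : t * l * s ≤ θ ^ τ := by
    rw [hs, mul_div_assoc', div_le_iff₀ (by positivity)]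
    linarith
  have hsθ : s ≤ θ ^ τ := by
    refine le_trans ?_ hsl
    have : 1 ≤ t * l := one_le_mul_of_one_le_of_one_le ht1 hl'
    exact le_mul_of_one_le_left hs0.le this
  have hθ1' : θ ≤ 1 := by linarith
  set π : α → ℝ := fun a => rowDeg E a / (2 * Δ) + θ with hπ
  have hπθ : ∀ a, θ ≤ π a := fun a => le_add_of_nonneg_left (by positivity)
  have hπ0 : ∀ a, 0 < π a := fun a => hθ0.trans_le (hπθ a)
  have hπ1 : ∀ a, π a ≤ 1 := by
    intro a
    have h1 : (rowDeg E a : ℝ) ≤ Δ := by exact_mod_cast hr a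
    have h2 : (rowDeg E a : ℝ) / (2 * Δ) ≤ 1 / 2 := by
      rw [div_le_div_iff₀ (by positivity) (by positivity)]
      linarith
    change (rowDeg E a : ℝ) / (2 * Δ) + θ ≤ 1
    linarith
  have hprod0 : ∀ S : Finset α, 0 < ∏ a ∈ S, π a := fun S => Finset.prod_pos fun a _ => hπ0 a
  have hN : ∀ b, (colNbhd E b).card ≤ τ := by
    intro b
    rw [card_colNbhd]
    by_cases hb : b ∈ B
    · exact (hc b hb).le
    · have : colDeg E b = 0 := by
        rw [colDeg, Finset.card_eq_zero, Finset.filter_eq_empty_iff]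
        rintro e he rfl
        exact hb (hB e he)
      omega
  have hprodθ : ∀ S : Finset α, S.card ≤ τ → θ ^ τ ≤ ∏ a ∈ S, π a := by
    intro S hS
    refine (pow_le_pow_of_le_one hθ0.le hθ1' hS).trans ?_
    rw [← Finset.prod_const]
    exact Finset.prod_le_prod (fun _ _ => hθ0.le) fun a _ => hπθ a
  set r : β → ℝ := fun b => s / ∏ a ∈ colNbhd E b, π a with hr'
  have hr0 : ∀ b, 0 < r b := fun b => div_pos hs0 (hprod0 _)
  obtain ⟨p, hpA, hpB⟩ : ∃ p : α ⊕ β → ℝ, (∀ a, p (.inl a) = π a) ∧ ∀ b, p (.inr b) = r b :=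
    ⟨Sum.elim π r, fun _ => rfl, fun _ => rfl⟩
  have hp0 : ∀ i, 0 ≤ p i := by
    rintro (a | b)
    · rw [hpA]; exact (hπ0 a).le
    · rw [hpB]; exact (hr0 b).le
  have hp1 : ∀ i, p i ≤ 1 := by
    rintro (a | b)
    · rw [hpA]; exact hπ1 a
    · rw [hpB, hr', div_le_one (hprod0 _)]
      exact hsθ.trans (hprodθ _ (hN b))
  have hprod : ∀ (S : Finset α) (T : Finset β), ∏ i ∈ S.disjSum T, p i =
      (∏ a ∈ S, π a) * ∏ b ∈ T, r b := by
    intro S T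
    rw [Finset.prod_disjSum]
    simp_rw [hpA, hpB]
  obtain ⟨TA, hTA⟩ : ∃ TA : α → Finset (α ⊕ β), ∀ a, TA a = ({a} : Finset α).disjSum ∅ :=
    ⟨_, fun _ => rfl⟩
  obtain ⟨TB, hTB⟩ : ∃ TB : β → Finset (α ⊕ β), ∀ b, TB b = (colNbhd E b).disjSum {b} :=
    ⟨_, fun _ => rfl⟩
  have hPA : ∀ a, ∏ i ∈ TA a, p i = π a := by
    intro a
    rw [hTA, hprod]
    simp
  have hPB : ∀ b, ∏ i ∈ TB b, p i = s := by
    intro b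
    rw [hTB, hprod, Finset.prod_singleton, hr']
    exact mul_div_cancel₀ _ (hprod0 _).ne'
  have hdeg : ∀ a, (rowDeg E a : ℝ) ≤ 2 * Δ * π a := by
    intro a
    change _ ≤ 2 * Δ * ((rowDeg E a : ℝ) / (2 * Δ) + θ)
    rw [mul_add, mul_div_cancel₀ _ (by positivity)]
    exact le_add_of_nonneg_right (by positivity)
  refine hasRegularPart_of_hasSmallVariance q ht hA hB hp0 hp1 TA TB (fun e => TB e.2)
    ?_ (fun _ _ => subset_rfl) ?_ ?_ ?_ ?_
  · rintro ⟨a, b⟩ he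
    rw [hTA, hTB]
    exact Finset.disjSum_mono (by simpa using he) (by simp)
  · intro a _
    set J := E.filter fun e => e.1 = a with hJ
    have hJdeg : (J.card : ℝ) = rowDeg E a := rfl
    set c := s ^ 2 / θ ^ τ with hc'
    have hc0 : 0 ≤ c := by positivity
    refine HasSmallVariance.of_pairwise (s := s)
      (fun e e' => if colNbhd E e.2 ∩ colNbhd E e'.2 = {a} then 0 else c) ?_ hs0.le ?_
      (fun e _ => hPB e.2) (fun _ _ _ _ => by positivity) ?_ ?_
    · rw [hPA]
      exact hπ0 a
    · rw [hPA, hJdeg]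
      calc (rowDeg E a : ℝ) * s ≤ 2 * Δ * π a * s := by gcongr; exact hdeg a
        _ = t * π a := by rw [hs]; field_simp
    · have hcount : ∀ e ∈ J, ∑ e' ∈ J,
          (if colNbhd E e.2 ∩ colNbhd E e'.2 = {a} then 0 else c) ≤ t * l * c := by
        rintro ⟨a₁, b⟩ he
        obtain ⟨heE, rfl⟩ := Finset.mem_filter.1 he
        rw [Finset.sum_ite, Finset.sum_const_zero, zero_add, Finset.sum_const, nsmul_eq_mul]
        refine mul_le_mul_of_nonneg_right ?_ hc0
        have hsub : (J.filter fun e' => ¬ colNbhd E b ∩ colNbhd E e'.2 = {a₁}) ⊆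
            ((colNbhd E b).erase a₁).biUnion fun a' =>
              (B.filter fun b' => (a₁, b') ∈ E ∧ (a', b') ∈ E).map
                ⟨fun b' => (a₁, b'), fun _ _ h => (Prod.ext_iff.1 h).2⟩ := by
          rintro ⟨a₂, b'⟩ h
          obtain ⟨h, h'⟩ := Finset.mem_filter.1 h
          obtain ⟨hE, rfl⟩ := Finset.mem_filter.1 h
          obtain ⟨a', ha', haa⟩ : ∃ a' ∈ colNbhd E b ∩ colNbhd E b', a' ≠ a₂ := by
            by_contra! hcon
            refine h' (Finset.eq_singleton_iff_unique_mem.2 ⟨?_, hcon⟩)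
            simp only [Finset.mem_inter, mem_colNbhd]
            exact ⟨heE, hE⟩
          simp only [Finset.mem_inter, mem_colNbhd] at ha'
          simp only [Finset.mem_biUnion, Finset.mem_erase, mem_colNbhd, Finset.mem_map,
            Finset.mem_filter]
          exact ⟨a', ⟨haa, ha'.1⟩, b', ⟨hB (_, b') hE, hE, ha'.2⟩, rfl⟩
        have h1 := (Finset.card_le_card hsub).trans (Finset.card_biUnion_le_card_mul _ _ l ?_)
        · have h2 : ((colNbhd E b).erase a₁).card * l ≤ τ * l :=
            Nat.mul_le_mul_right _ ((Finset.card_erase_le).trans (hN b))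
          rw [← hτt]
          exact_mod_cast h1.trans h2
        · intro a' ha'
          rw [Finset.card_map]
          exact hcodeg _ _ (Finset.ne_of_mem_erase ha').symm
      refine (Finset.sum_le_card_nsmul _ _ _ hcount).trans ?_
      rw [nsmul_eq_mul, hPA, hJdeg]
      calc (rowDeg E a : ℝ) * (t * l * c) ≤ 2 * Δ * π a * (t * l * c) := by
            gcongr
            exact hdeg a
        _ = 2 * Δ * s * π a * (t * l * s / θ ^ τ) := by rw [hc']; ring
        _ ≤ 2 * Δ * s * π a * 1 := by
          have := hπ0 a
          refine mul_le_mul_of_nonneg_left ?_ (by positivity)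
          exact (div_le_one (by positivity)).2 hsl
        _ = t * π a := by rw [hs]; field_simp
    · rintro ⟨a₁, b⟩ he ⟨a₂, b'⟩ he' hee
      obtain rfl : a₁ = a := (Finset.mem_filter.1 he).2
      obtain rfl : a₂ = a₁ := (Finset.mem_filter.1 he').2
      have hbb : b ≠ b' := fun h => hee (by rw [h])
      have hU : TB b ∪ TB b' = (colNbhd E b ∪ colNbhd E b').disjSum {b, b'} := by
        rw [hTB, hTB]
        ext (i | i) <;> simp
      have hui := Finset.prod_union_inter (s₁ := colNbhd E b) (s₂ := colNbhd E b') (f := π)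
      have hP : ∏ i ∈ TB b ∪ TB b', p i = s ^ 2 / ∏ a ∈ colNbhd E b ∩ colNbhd E b', π a := by
        have h1 := (hprod0 (colNbhd E b)).ne'
        have h2 := (hprod0 (colNbhd E b')).ne'
        have h3 := (hprod0 (colNbhd E b ∩ colNbhd E b')).ne'
        rw [hU, hprod, Finset.prod_pair hbb, eq_div_iff h3]
        calc _ = ((∏ a ∈ colNbhd E b ∪ colNbhd E b', π a) *
              ∏ a ∈ colNbhd E b ∩ colNbhd E b', π a) * (r b * r b') := by ring
          _ = s ^ 2 := by
            rw [hui, hr']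
            field_simp
      change ∏ i ∈ TB b ∪ TB b', p i ≤ _
      rw [hP, hPA]
      dsimp only
      split_ifs with h
      · rw [h, Finset.prod_singleton, add_zero]
      · have h1 : s ^ 2 / ∏ a ∈ colNbhd E b ∩ colNbhd E b', π a ≤ c := by
          refine div_le_div_of_nonneg_left (by positivity) (by positivity) (hprodθ _ ?_)
          exact (Finset.card_le_card Finset.inter_subset_left).trans (hN b)
        have := hπ0 a₂
        have : 0 ≤ s ^ 2 / π a₂ := by positivity
        linarith
  · intro b hb
    have hcard : ((E.filter fun e => e.2 = b).card : ℝ) = t := by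
      rw [← hτt]
      exact_mod_cast hc b hb
    refine ⟨t, ht0.le, le_rfl, ?_, ?_⟩
    · simp_rw [hPB]
      rw [Finset.sum_const, nsmul_eq_mul, hcard]
    · rw [Finset.sum_congr rfl (g := fun _ => t * s)]
      · rw [Finset.sum_const, nsmul_eq_mul, hcard, hPB]
        nlinarith [mul_pos ht0 hs0]
      · intro e he
        rw [Finset.sum_congr rfl (g := fun _ => s)]
        · rw [Finset.sum_const, nsmul_eq_mul, hcard]
        · intro e' he'
          change ∏ i ∈ TB e.2 ∪ TB e'.2, p i = s
          rw [(Finset.mem_filter.1 he).2, (Finset.mem_filter.1 he').2, Finset.union_self, hPB]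
  · simp_rw [hPA, hPB]
    refine add_pos_of_nonneg_of_pos (Finset.sum_nonneg fun a _ => (hπ0 a).le) ?_
    exact Finset.sum_pos (fun _ _ => hs0) hne
  · have hcardE : (E.card : ℝ) = B.card * t := by
      rw [← sum_colDeg hB, Finset.sum_congr rfl hc, Finset.sum_const, smul_eq_mul, ← hτt]
      push_cast
      rfl
    have h1 : ∑ a ∈ A, π a = B.card * s + A.card * θ := by
      rw [hπ, Finset.sum_add_distrib, ← Finset.sum_div, ← Nat.cast_sum, sum_rowDeg hA,
        Finset.sum_const, nsmul_eq_mul, hcardE, hs]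
      ring
    have h2 : A.card * θ ≤ 2 * δ * (B.card * s) := by
      rw [hs, mul_div_assoc', mul_div_assoc', le_div_iff₀ (by positivity)]
      have h3 : (B.card : ℝ) ≤ B.card * (δ * t) := le_mul_of_one_le_right (by positivity) hδt
      nlinarith
    simp_rw [hPA, hPB]
    rw [h1, Finset.sum_const, Finset.sum_const, nsmul_eq_mul, nsmul_eq_mul, hcardE, ← hδ]
    have hBs : (0 : ℝ) ≤ B.card * s := by positivity
    have h4 : (1 - δ) * (B.card * s + A.card * θ + B.card * s) ≤ 2 * (B.card * s) := by
      have : (1 - δ) * (A.card * θ) ≤ (1 - δ) * (2 * δ * (B.card * s)) :=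
        mul_le_mul_of_nonneg_left h2 (by linarith)
      nlinarith [mul_nonneg (sq_nonneg δ) hBs]
    nlinarith

end SmallCodegree

theorem exists_card_eq_pairwise_not {α : Type*} {R : α → α → Prop}
    [DecidableRel R] (hR : ∀ a a', R a a' → R a' a) {N : Finset α} {q τ : ℕ} (hq : 0 < q)
    (h : ∀ a ∈ N, (N.filter (R a)).card < q) (hN : q * τ ≤ N.card) :
    ∃ S ⊆ N, S.card = τ ∧ ∀ a ∈ S, ∀ a' ∈ S, a ≠ a' → ¬ R a a' := by
  classical
  induction τ with
  | zero => exact ⟨∅, by simp⟩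
  | succ τ ih =>
    obtain ⟨S, hSN, hS, hind⟩ := ih (by nlinarith)
    have hcard : (S ∪ S.biUnion fun a => N.filter (R a)).card < N.card := by
      have h1 : (S.biUnion fun a => N.filter (R a)).card ≤ S.card * (q - 1) :=
        Finset.card_biUnion_le_card_mul _ _ _ fun a ha => Nat.le_sub_one_of_lt (h a (hSN ha))
      have h2 := Finset.card_union_le S (S.biUnion fun a => N.filter (R a))
      rw [hS] at h1 h2
      obtain ⟨r, rfl⟩ : ∃ r, q = r + 1 := ⟨q - 1, by omega⟩
      rw [Nat.add_sub_cancel] at h1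
      nlinarith
    obtain ⟨v, hvN, hv⟩ := Finset.exists_mem_notMem_of_card_lt_card hcard
    simp only [Finset.mem_union, Finset.mem_biUnion, Finset.mem_filter, not_or, not_exists,
      not_and] at hv
    have hvS : ∀ a ∈ S, ¬ R a v := fun a ha => hv.2 a ha hvN
    refine ⟨insert v S, Finset.insert_subset hvN hSN, by rw [Finset.card_insert_of_notMem hv.1, hS],
      ?_⟩
    intro a ha a' ha' hne
    rcases Finset.mem_insert.1 ha with rfl | haS <;>
      rcases Finset.mem_insert.1 ha' with rfl | haS'
    · exact absurd rfl hne
    · exact fun h => hvS a' haS' (hR _ _ h)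
    · exact hvS a haS
    · exact hind a haS a' haS' hne

section Codegree

variable {α β : Type*} [DecidableEq α] [DecidableEq β]

theorem hasRegularPart_of_complete {E : Finset (α × β)} {k : ℕ} (hk : 0 < k) {Q : Finset α}
    {R : Finset β} (hQ : Q.card = k) (hR : R.card = k) (h : ∀ a ∈ Q, ∀ b ∈ R, (a, b) ∈ E) :
    HasRegularPart E k := by
  refine ⟨Q ×ˢ R, ?_, ?_, ?_, ?_⟩
  · rintro ⟨a, b⟩ hab
    exact h a (Finset.mem_product.1 hab).1 b (Finset.mem_product.1 hab).2
  · rw [← Finset.card_pos, Finset.card_product, hQ, hR]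
    positivity
  · intro a
    by_cases ha : a ∈ Q
    · right
      have : (Q ×ˢ R).filter (fun e => e.1 = a) = {a} ×ˢ R := by
        ext ⟨x, y⟩
        simp only [Finset.mem_filter, Finset.mem_product, Finset.mem_singleton]
        constructor
        · rintro ⟨⟨_, hy⟩, hx⟩
          exact ⟨hx, hy⟩
        · rintro ⟨rfl, hy⟩
          exact ⟨⟨ha, hy⟩, rfl⟩
      rw [rowDeg, this, Finset.card_product, Finset.card_singleton, hR, one_mul]
    · left
      rw [rowDeg, Finset.card_eq_zero, Finset.filter_eq_empty_iff]
      rintro e he rfl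
      exact ha (Finset.mem_product.1 he).1
  · intro b
    by_cases hb : b ∈ R
    · right
      have : (Q ×ˢ R).filter (fun e => e.2 = b) = Q ×ˢ {b} := by
        ext ⟨x, y⟩
        simp only [Finset.mem_filter, Finset.mem_product, Finset.mem_singleton]
        constructor
        · rintro ⟨⟨hx, _⟩, hy⟩
          exact ⟨hx, hy⟩
        · rintro ⟨hx, rfl⟩
          exact ⟨⟨hx, hb⟩, rfl⟩
      rw [colDeg, this, Finset.card_product, Finset.card_singleton, hQ, mul_one]
    · left
      rw [colDeg, Finset.card_eq_zero, Finset.filter_eq_empty_iff]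
      rintro e he rfl
      exact hb (Finset.mem_product.1 he).2

variable [Fintype α]

/-- In a bipartite graph, each vertex has few vertices with which it has more than `l` common
neighbours. -/
theorem card_heavy_mul_le {E : Finset (α × β)} {B : Finset β} {d Δ : ℕ} (l : ℕ)
    (hr : ∀ a, rowDeg E a ≤ Δ) (hc : ∀ b ∈ B, colDeg E b ≤ d) (a : α) :
    (Finset.univ.filter fun a' =>
      l < (B.filter fun b => (a, b) ∈ E ∧ (a', b) ∈ E).card).card * l ≤ d * Δ := by
  set R : Finset β := B.filter fun b => (a, b) ∈ E with hR
  have hRle : R.card ≤ Δ := by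
    refine le_trans ?_ (hr a)
    refine Finset.card_le_card_of_injOn (fun b => (a, b)) ?_ (by simp [Set.InjOn])
    intro b hb
    simpa using (Finset.mem_filter.1 hb).2
  have hsum : ∑ a', (B.filter fun b => (a, b) ∈ E ∧ (a', b) ∈ E).card = ∑ b ∈ R, colDeg E b := by
    simp_rw [← card_colNbhd, colNbhd, ← Finset.filter_filter, ← hR, Finset.card_filter]
    exact Finset.sum_comm
  calc _ ≤ ∑ a' ∈ Finset.univ.filter fun a' =>
        l < (B.filter fun b => (a, b) ∈ E ∧ (a', b) ∈ E).card,
        (B.filter fun b => (a, b) ∈ E ∧ (a', b) ∈ E).card := by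
        rw [← smul_eq_mul]
        exact Finset.card_nsmul_le_sum _ _ _ fun a' ha' => (Finset.mem_filter.1 ha').2.le
    _ ≤ ∑ a', (B.filter fun b => (a, b) ∈ E ∧ (a', b) ∈ E).card :=
        Finset.sum_le_sum_of_subset (Finset.filter_subset _ _)
    _ = ∑ b ∈ R, colDeg E b := hsum
    _ ≤ R.card * d := by
        rw [← smul_eq_mul]
        exact Finset.sum_le_card_nsmul _ _ _ fun b hb => hc b (Finset.mem_filter.1 hb).1
    _ ≤ d * Δ := by
        rw [mul_comm]
        exact Nat.mul_le_mul_left _ hRle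

/-- A bipartite graph whose vertices in `B` have small degree, and in which `A` is much smaller
than `B`, contains a `q`-regular subgraph. -/
theorem hasRegularPart_of_unbalanced [Fintype β] (q : ℕ) [hq : Fact q.Prime] {τ l d Δ h : ℕ}
    (hτ : τ = 2048 * q ^ 3) {θ : ℝ} {E : Finset (α × β)} {A : Finset α} {B : Finset β}
    (hA : ∀ e ∈ E, e.1 ∈ A) (hne : B.Nonempty)
    (hcq : ∀ b ∈ B, q * τ ≤ colDeg E b) (hcd : ∀ b ∈ B, colDeg E b ≤ d)
    (hr : ∀ a, rowDeg E a ≤ Δ) (hl : 1 ≤ l) (hh : d * Δ ≤ h * l)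
    (hAB : 2 * (A.card * (h ^ q * q)) ≤ B.card) (hθ0 : 0 < θ) (hθ1 : θ ≤ 1 / 2)
    (hθA : 2 * (θ * A.card * Δ) ≤ B.card) (hθl : τ ^ 2 * l ≤ θ ^ τ * (2 * Δ)) :
    HasRegularPart E q := by
  classical
  by_contra hcon
  have hq0 := hq.out.pos
  set codeg : α → α → ℕ := fun a a' => (B.filter fun b => (a, b) ∈ E ∧ (a', b) ∈ E).card
    with hcodeg
  have hcomm : ∀ a a', codeg a a' = codeg a' a := by
    intro a a'
    simp only [hcodeg]
    congr 1
    exact Finset.filter_congr fun b _ => and_comm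
  set H : α → Finset α := fun a => Finset.univ.filter fun a' => l < codeg a a' with hH
  have hHcard : ∀ a, (H a).card ≤ h := fun a =>
    Nat.le_of_mul_le_mul_right ((card_heavy_mul_le l hr hcd a).trans hh) hl
  have hQ : ∀ Q : Finset α, Q.card = q → (B.filter fun b => Q ⊆ colNbhd E b).card ≤ q := by
    intro Q hQ
    by_contra! hlt
    obtain ⟨R, hR, hRq⟩ := Finset.exists_subset_card_eq hlt.le
    refine hcon (hasRegularPart_of_complete hq0 hQ hRq fun a ha b hb => ?_)
    exact mem_colNbhd.1 ((Finset.mem_filter.1 (hR hb)).2 ha)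
  set bad := A.biUnion fun a => ((H a).powersetCard q).biUnion fun Q =>
    B.filter fun b => Q ⊆ colNbhd E b with hbad
  have hbadcard : bad.card ≤ A.card * (h ^ q * q) := by
    refine Finset.card_biUnion_le_card_mul _ _ _ fun a _ => ?_
    refine (Finset.card_biUnion_le_card_mul _ _ q fun Q hQ' =>
      hQ Q (Finset.mem_powersetCard.1 hQ').2).trans ?_
    refine Nat.mul_le_mul_right _ ?_
    rw [Finset.card_powersetCard]
    exact (Nat.choose_le_pow _ _).trans (Nat.pow_le_pow_left (hHcard a) _)
  set B' := B \ bad with hB'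
  have hB'B : B' ⊆ B := Finset.sdiff_subset
  have hB'card : B.card ≤ 2 * B'.card := by
    have : B.card - bad.card ≤ B'.card := Finset.le_card_sdiff bad B
    omega
  have hgood : ∀ b ∈ B', ∃ S ⊆ colNbhd E b, S.card = τ ∧
      ∀ a ∈ S, ∀ a' ∈ S, a ≠ a' → ¬ l < codeg a a' := by
    intro b hb
    obtain ⟨hb, hbad'⟩ := Finset.mem_sdiff.1 hb
    refine exists_card_eq_pairwise_not (fun a a' h => hcomm a a' ▸ h) hq0 ?_
      (card_colNbhd E b ▸ hcq b hb)
    intro a ha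
    by_contra! hlt
    obtain ⟨Q, hQ, hQq⟩ := Finset.exists_subset_card_eq hlt
    refine hbad' ?_
    simp only [hbad, Finset.mem_biUnion, Finset.mem_powersetCard, Finset.mem_filter]
    refine ⟨a, hA _ (mem_colNbhd.1 ha), Q, ⟨fun a' ha' => ?_, hQq⟩, hb,
      hQ.trans (Finset.filter_subset _ _)⟩
    exact Finset.mem_filter.2 ⟨Finset.mem_univ _, (Finset.mem_filter.1 (hQ ha')).2⟩
  choose! S hSN hSτ hSl using hgood
  set E' := E.filter fun e => e.2 ∈ B' ∧ e.1 ∈ S e.2 with hE'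
  have hE'E : E' ⊆ E := Finset.filter_subset _ _
  have hB'0 : 0 < B'.card := by
    have := Finset.card_pos.2 hne
    omega
  have hB'card' : (B.card : ℝ) ≤ 2 * B'.card := by exact_mod_cast hB'card
  refine hcon ((hasRegularPart_of_codegree_le q hτ (A := A) (B := B') (E := E') (Δ := Δ)
    (fun e he => hA e (hE'E he)) (fun e he => (Finset.mem_filter.1 he).2.1)
    (Finset.card_pos.1 hB'0) ?_ (fun a => (rowDeg_mono hE'E a).trans (hr a)) ?_ hl hθ0 hθ1
    (by linarith) hθl).mono hE'E)
  · intro b hb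
    rw [← card_colNbhd, ← hSτ b hb]
    congr 1
    ext a
    simp only [mem_colNbhd, hE', Finset.mem_filter]
    exact ⟨fun h => h.2.2, fun h => ⟨mem_colNbhd.1 (hSN b hb h), hb, h⟩⟩
  · intro a a' haa
    by_cases hex : ∃ b ∈ B', (a, b) ∈ E' ∧ (a', b) ∈ E'
    · obtain ⟨b, hb, h1, h2⟩ := hex
      refine (Finset.card_le_card ?_).trans (not_lt.1 (hSl b hb a (Finset.mem_filter.1 h1).2.2 a'
        (Finset.mem_filter.1 h2).2.2 haa))
      intro b' hb'
      obtain ⟨hb', h3, h4⟩ := Finset.mem_filter.1 hb'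
      exact Finset.mem_filter.2 ⟨hB'B hb', hE'E h3, hE'E h4⟩
    · rw [Finset.card_eq_zero.2 (Finset.filter_eq_empty_iff.2 fun b hb h => hex ⟨b, hb, h⟩)]
      exact Nat.zero_le _

end Codegree

section Bipartite

variable {α β : Type*} [DecidableEq α] [DecidableEq β]

omit [DecidableEq β] in
theorem rowDeg_filter_of_pos {E : Finset (α × β)} (P : α → Prop) [DecidablePred P] {a : α}
    (ha : P a) : rowDeg (E.filter fun e => P e.1) a = rowDeg E a := by
  rw [rowDeg, rowDeg, Finset.filter_filter]
  congr 1
  exact Finset.filter_congr fun e _ => ⟨fun h => h.2, fun h => ⟨h ▸ ha, h⟩⟩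

omit [DecidableEq α] in
theorem colDeg_filter_of_pos {E : Finset (α × β)} (P : β → Prop) [DecidablePred P] {b : β}
    (hb : P b) : colDeg (E.filter fun e => P e.2) b = colDeg E b := by
  rw [colDeg, colDeg, Finset.filter_filter]
  congr 1
  exact Finset.filter_congr fun e _ => ⟨fun h => h.2, fun h => ⟨h ▸ hb, h⟩⟩

variable [Fintype α] [Fintype β]

theorem hasRegularPart_of_card_mul_pow_le (q : ℕ) [hq : Fact q.Prime] {τ d y m : ℕ}
    (hτ : τ = 2048 * q ^ 3) {E : Finset (α × β)} {A : Finset α} {B : Finset β}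
    (hA : ∀ e ∈ E, e.1 ∈ A) (hne : B.Nonempty) (hcq : ∀ b ∈ B, q * τ ≤ colDeg E b)
    (hcd : ∀ b ∈ B, colDeg E b ≤ d) (hr : ∀ a, rowDeg E a ≤ y ^ (m + 2))
    (hAB : A.card * y ^ m ≤ B.card) (hyτ : 2 * τ ^ 2 ≤ y) (hyq : 2 * q ≤ y) (hyd : d ≤ y)
    (hm : (3 * τ + 1) * q + 1 ≤ m) : HasRegularPart E q := by
  have hq2 := hq.out.two_le
  have hy0 : 0 < y := by omega
  have hy1 : (1 : ℝ) ≤ y := by exact_mod_cast hy0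
  have hτ1 : 1 ≤ τ := by
    rw [hτ]
    have : 0 < q ^ 3 := by positivity
    omega
  obtain ⟨x, hx⟩ : ∃ x, m + 2 = 3 * τ + x := ⟨m + 2 - 3 * τ, by
    have : 3 * τ * 1 ≤ (3 * τ + 1) * q := Nat.mul_le_mul (by omega) (by omega)
    omega⟩
  refine hasRegularPart_of_unbalanced q (l := y ^ x) (h := d * y ^ (3 * τ)) (d := d)
    (Δ := y ^ (m + 2)) (θ := 1 / (2 * (y : ℝ) ^ 2)) hτ hA hne hcq hcd hr (Nat.one_le_pow _ _ hy0)
    ?_ ?_ (by positivity) ?_ ?_ ?_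
  · rw [hx, pow_add, mul_assoc]
  · refine le_trans ?_ hAB
    calc 2 * (A.card * ((d * y ^ (3 * τ)) ^ q * q))
        = A.card * ((d * y ^ (3 * τ)) ^ q * (2 * q)) := by ring
      _ ≤ A.card * ((y * y ^ (3 * τ)) ^ q * y) := by gcongr
      _ = A.card * y ^ ((3 * τ + 1) * q + 1) := by
        rw [← pow_succ', ← pow_mul, ← pow_succ]
      _ ≤ A.card * y ^ m := by
        gcongr
  · rw [div_le_div_iff₀ (by positivity) (by positivity)]
    nlinarith
  · have h1 : 2 * (1 / (2 * (y : ℝ) ^ 2) * A.card * ((y ^ (m + 2) : ℕ) : ℝ)) =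
        ((A.card * y ^ m : ℕ) : ℝ) := by
      push_cast
      field_simp
      ring
    rw [h1]
    exact_mod_cast hAB
  · have h1 : (τ : ℝ) ^ 2 * 2 ^ τ ≤ y ^ τ := by
      have h2 : τ ^ 2 * 2 ^ τ ≤ y ^ τ :=
        calc τ ^ 2 * 2 ^ τ ≤ (τ ^ 2) ^ τ * 2 ^ τ :=
              Nat.mul_le_mul_right _ (Nat.le_self_pow (by omega) _)
          _ = (2 * τ ^ 2) ^ τ := by rw [mul_pow, mul_comm]
          _ ≤ y ^ τ := by gcongr
      exact_mod_cast h2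
    have h2 : (y : ℝ) ^ (m + 2) = y ^ x * (y ^ τ * (y ^ 2) ^ τ) := by
      rw [hx, ← pow_mul, ← pow_add, ← pow_add]
      congr 1
      ring
    rw [one_div, inv_pow, mul_pow, ← div_eq_inv_mul, le_div_iff₀ (by positivity)]
    push_cast
    rw [h2]
    calc (τ : ℝ) ^ 2 * (y : ℝ) ^ x * (2 ^ τ * ((y : ℝ) ^ 2) ^ τ)
        = (y : ℝ) ^ x * ((y : ℝ) ^ 2) ^ τ * ((τ : ℝ) ^ 2 * 2 ^ τ) := by ring
      _ ≤ (y : ℝ) ^ x * ((y : ℝ) ^ 2) ^ τ * (y : ℝ) ^ τ := by gcongr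
      _ ≤ 2 * ((y : ℝ) ^ x * ((y : ℝ) ^ τ * ((y : ℝ) ^ 2) ^ τ)) := by
        have : 0 ≤ (y : ℝ) ^ x * ((y : ℝ) ^ τ * ((y : ℝ) ^ 2) ^ τ) := by positivity
        linarith

omit [DecidableEq α] [Fintype α] [Fintype β] in
/-- If the vertices of one side are split into few classes, then many vertices of the other side
have large degree to the same class. -/
theorem exists_class {κ : Type*} [DecidableEq κ] {I : Finset κ} {f : α → κ} {E : Finset (α × β)}
    {B : Finset β} {d m : ℕ} (hB : ∀ e ∈ E, e.2 ∈ B) (hf : ∀ e ∈ E, f e.1 ∈ I)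
    (hne : B.Nonempty) (hd : 0 < d) (hcd : ∀ b ∈ B, colDeg E b ≤ d)
    (hE : d * B.card ≤ 2 * E.card) (hI : 4 * I.card * m ≤ d) :
    ∃ i ∈ I, B.card ≤ 4 * I.card *
      (B.filter fun b => m ≤ colDeg (E.filter fun e => f e.1 = i) b).card := by
  by_contra! hcon
  have hB0 := Finset.card_pos.2 hne
  have hE0 : 0 < E.card := by
    have := Nat.mul_pos hd hB0
    omega
  obtain ⟨e₀, he₀⟩ := Finset.card_pos.1 hE0
  have key : ∀ i ∈ I, 4 * I.card * (E.filter fun e => f e.1 = i).card < 2 * (d * B.card) := by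
    intro i hi
    set Ei := E.filter fun e => f e.1 = i with hEi
    have h1 : Ei.card ≤ (B.filter fun b => m ≤ colDeg Ei b).card * d + B.card * m := by
      rw [← sum_colDeg (B := B) fun e he => hB e (Finset.mem_filter.1 he).1,
        ← Finset.sum_filter_add_sum_filter_not B fun b => m ≤ colDeg Ei b]
      refine add_le_add ?_ ?_
      · rw [← smul_eq_mul]
        refine Finset.sum_le_card_nsmul _ _ _ fun b hb => ?_
        exact (colDeg_mono (Finset.filter_subset _ _) b).trans (hcd b (Finset.mem_filter.1 hb).1)
      · refine (Finset.sum_le_card_nsmul _ _ m fun b hb => ?_).trans ?_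
        · exact (not_le.1 (Finset.mem_filter.1 hb).2).le
        · rw [smul_eq_mul]
          exact Nat.mul_le_mul_right _ (Finset.card_filter_le _ _)
    calc 4 * I.card * Ei.card
        ≤ 4 * I.card * ((B.filter fun b => m ≤ colDeg Ei b).card * d + B.card * m) := by gcongr
      _ = 4 * I.card * (B.filter fun b => m ≤ colDeg Ei b).card * d +
          B.card * (4 * I.card * m) := by ring
      _ < B.card * d + B.card * d :=
        add_lt_add_of_lt_of_le (Nat.mul_lt_mul_of_pos_right (hcon i hi) hd)
          (Nat.mul_le_mul_left _ hI)
      _ = 2 * (d * B.card) := by ring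
  have h2 := Finset.sum_lt_sum_of_nonempty ⟨_, hf e₀ he₀⟩ key
  rw [← Finset.mul_sum, ← Finset.card_eq_sum_card_fiberwise hf, Finset.sum_const,
    smul_eq_mul] at h2
  nlinarith

/-- The case where all vertices in `A` have degree much larger than the vertices in `B`. -/
theorem hasRegularPart_of_lt_rowDeg (q : ℕ) [hq : Fact q.Prime] {τ s d n : ℕ}
    (hτ : τ = 2048 * q ^ 3) (hs : (3 * τ + 1) * q + 2 ≤ 2 ^ s) {E : Finset (α × β)}
    {B : Finset β} (hB : ∀ e ∈ E, e.2 ∈ B) (hne : B.Nonempty)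
    (hcd : ∀ b ∈ B, colDeg E b ≤ d) (hr : ∀ a, rowDeg E a ≤ n)
    (hdeg : ∀ e ∈ E, d ^ (4 * 2 ^ s) < rowDeg E e.1) (hE : d * B.card ≤ 2 * E.card)
    (hdτ : 2 * τ ^ 2 ≤ d) (hdq : 2 * q ≤ d)
    (hdn : 4 * ((Nat.log 2 (Nat.log 2 n) + 1) * (2 * 2 ^ s)) * (q * τ) ≤ d) :
    HasRegularPart E q := by
  have hq2 := hq.out.two_le
  have hτ1 : 1 ≤ τ := by
    rw [hτ]
    have : 0 < q ^ 3 := by positivity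
    omega
  have hqτ : 1 ≤ q * τ := Nat.mul_pos (by omega) hτ1
  have hd2 : 2 ≤ d := by omega
  set w : α → ℕ := fun a => Nat.log 2 (Nat.log 2 (rowDeg E a)) - s with hw
  set f : α → ℕ × ℕ := fun a => (w a, Nat.log 2 (rowDeg E a) / 2 ^ w a) with hf
  set I := Finset.range (Nat.log 2 (Nat.log 2 n) + 1) ×ˢ Finset.range (2 * 2 ^ s) with hI
  have hIcard : I.card = (Nat.log 2 (Nat.log 2 n) + 1) * (2 * 2 ^ s) := by
    rw [hI, Finset.card_product, Finset.card_range, Finset.card_range]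
  rw [← hIcard] at hdn
  have hfa : ∀ e ∈ E, f e.1 ∈ I ∧ 2 ^ s ≤ (f e.1).2 ∧
      (2 ^ 2 ^ (f e.1).1) ^ (f e.1).2 ≤ rowDeg E e.1 ∧
      rowDeg E e.1 < (2 ^ 2 ^ (f e.1).1) ^ ((f e.1).2 + 1) := by
    intro e he
    set L := Nat.log 2 (rowDeg E e.1) with hL
    have hdpos : rowDeg E e.1 ≠ 0 := by have := hdeg e he; omega
    have hLs : 2 ^ s ≤ L := by
      refine Nat.le_log_of_pow_le (by norm_num) ((hdeg e he).le.trans' ?_)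
      exact (Nat.pow_le_pow_left hd2 _).trans (Nat.pow_le_pow_right (by omega) (by omega))
    have hL0 : L ≠ 0 := by
      have : 0 < 2 ^ s := by positivity
      omega
    have hsj : s ≤ Nat.log 2 L := Nat.le_log_of_pow_le (by norm_num) hLs
    have hf1 : (f e.1).1 = Nat.log 2 L - s := rfl
    have hf2 : (f e.1).2 = L / 2 ^ (f e.1).1 := rfl
    have hpow : 2 ^ Nat.log 2 L = 2 ^ (f e.1).1 * 2 ^ s := by
      rw [hf1, ← pow_add, Nat.sub_add_cancel hsj]
    have h1 : 2 ^ Nat.log 2 L ≤ L := Nat.pow_log_le_self 2 hL0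
    have h2 : L < 2 ^ (Nat.log 2 L + 1) := Nat.lt_pow_succ_log_self (by norm_num) L
    have hw0 : 0 < 2 ^ (f e.1).1 := by positivity
    refine ⟨?_, ?_, ?_, ?_⟩
    · rw [hI, Finset.mem_product, Finset.mem_range, Finset.mem_range]
      constructor
      · rw [hf1]
        have : Nat.log 2 L ≤ Nat.log 2 (Nat.log 2 n) :=
          Nat.log_mono_right (Nat.log_mono_right (hr _))
        omega
      · rw [hf2, Nat.div_lt_iff_lt_mul hw0]
        calc L < 2 ^ (Nat.log 2 L + 1) := h2
          _ = 2 * 2 ^ s * 2 ^ (f e.1).1 := by rw [pow_succ, hpow]; ring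
    · rw [hf2, Nat.le_div_iff_mul_le hw0, mul_comm, ← hpow]
      exact h1
    · rw [← pow_mul]
      refine (Nat.pow_le_pow_right (by norm_num) ?_).trans (Nat.pow_log_le_self 2 hdpos)
      rw [hf2]
      exact Nat.mul_div_le _ _
    · rw [← pow_mul]
      refine (Nat.lt_pow_succ_log_self (by norm_num) _).trans_le
        (Nat.pow_le_pow_right (by norm_num) ?_)
      rw [hf2]
      exact Nat.lt_mul_div_succ L hw0
  obtain ⟨⟨j, r⟩, hi, hBi⟩ := exists_class (f := f) hB (fun e he => (hfa e he).1) hne (by omega)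
    hcd hE hdn
  set Ei := E.filter fun e => f e.1 = (j, r) with hEi
  set B' := B.filter fun b => q * τ ≤ colDeg Ei b with hB'
  set E' := Ei.filter fun e => e.2 ∈ B' with hE'
  have hE'Ei : E' ⊆ Ei := Finset.filter_subset _ _
  have hEiE : Ei ⊆ E := Finset.filter_subset _ _
  have hB'B : B' ⊆ B := Finset.filter_subset _ _
  set y := 2 ^ 2 ^ j with hy
  have hB0 := Finset.card_pos.2 hne
  have hB'0 : 0 < B'.card := by
    by_contra h
    rw [Nat.eq_zero_of_not_pos h] at hBi
    omega
  have hEi' : ∀ e ∈ Ei, 2 ^ s ≤ r ∧ y ^ r ≤ rowDeg E e.1 ∧ rowDeg E e.1 < y ^ (r + 1) := by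
    intro e he
    obtain ⟨heE, hef⟩ := Finset.mem_filter.1 he
    have := (hfa e heE).2
    rw [hef] at this
    exact this
  obtain ⟨b₀, hb₀⟩ := Finset.card_pos.1 hB'0
  obtain ⟨e₀, he₀⟩ : Ei.Nonempty := by
    have h1 : 0 < colDeg Ei b₀ := hqτ.trans (Finset.mem_filter.1 hb₀).2
    obtain ⟨e, he⟩ := Finset.card_pos.1 h1
    exact ⟨e, (Finset.mem_filter.1 he).1⟩
  have hyd : d ^ 2 ≤ y := by
    by_contra! hlt
    have h1 := (hdeg e₀ (hEiE he₀)).trans (hEi' e₀ he₀).2.2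
    have h2 : r + 1 ≤ 2 * 2 ^ s := Finset.mem_range.1 (Finset.mem_product.1 hi).2
    have h3 : y ^ (r + 1) ≤ d ^ (4 * 2 ^ s) :=
      calc y ^ (r + 1) ≤ (d ^ 2) ^ (r + 1) := Nat.pow_le_pow_left hlt.le _
        _ = d ^ (2 * (r + 1)) := by rw [← pow_mul]
        _ ≤ d ^ (4 * 2 ^ s) := Nat.pow_le_pow_right (by omega) (by omega)
    omega
  have hdy : d ≤ y := le_trans (Nat.le_self_pow (by norm_num) d) hyd
  have hsr := (hEi' e₀ he₀).1
  obtain ⟨m, rfl⟩ : ∃ m, r = m + 1 := ⟨r - 1, by omega⟩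
  set A' := Ei.image Prod.fst with hA'
  have hA'card : A'.card * y ^ m ≤ B'.card := by
    have hy0 : 0 < y := by positivity
    refine Nat.le_of_mul_le_mul_right ?_ hy0
    calc A'.card * y ^ m * y = A'.card * y ^ (m + 1) := by rw [pow_succ]; ring
      _ ≤ ∑ a ∈ A', rowDeg E a := by
        rw [← smul_eq_mul]
        refine Finset.card_nsmul_le_sum _ _ _ fun a ha => ?_
        obtain ⟨e, he, rfl⟩ := Finset.mem_image.1 ha
        exact (hEi' e he).2.1
      _ ≤ ∑ a, rowDeg E a := Finset.sum_le_sum_of_subset (Finset.subset_univ _)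
      _ = ∑ b ∈ B, colDeg E b := by rw [sum_rowDeg (by simp), sum_colDeg hB]
      _ ≤ B.card * d := by
        rw [← smul_eq_mul]
        exact Finset.sum_le_card_nsmul _ _ _ hcd
      _ ≤ 4 * I.card * B'.card * d := Nat.mul_le_mul_right _ hBi
      _ ≤ d * B'.card * d := by
        gcongr
        exact (Nat.le_mul_of_pos_right _ hqτ).trans hdn
      _ = B'.card * d ^ 2 := by ring
      _ ≤ B'.card * y := Nat.mul_le_mul_left _ hyd
  refine (hasRegularPart_of_card_mul_pow_le q hτ (A := A') (B := B') (E := E') (d := d) (y := y)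
    (m := m) ?_ (Finset.card_pos.1 hB'0) ?_ ?_ ?_ hA'card (hdτ.trans hdy) (hdq.trans hdy) hdy
    (by omega)).mono (hE'Ei.trans hEiE)
  · intro e he
    exact Finset.mem_image_of_mem _ (hE'Ei he)
  · intro b hb
    rw [hE', colDeg_filter_of_pos (fun b => b ∈ B') hb]
    exact (Finset.mem_filter.1 hb).2
  · intro b hb
    exact (colDeg_mono (hE'Ei.trans hEiE) b).trans (hcd b (hB'B hb))
  · intro a
    by_cases ha : ∃ e ∈ Ei, e.1 = a
    · obtain ⟨e, he, rfl⟩ := ha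
      exact (rowDeg_mono (hE'Ei.trans hEiE) _).trans (hEi' e he).2.2.le
    · rw [rowDeg, Finset.card_eq_zero.2 (Finset.filter_eq_empty_iff.2
        fun e he h => ha ⟨e, hE'Ei he, h⟩)]
      exact Nat.zero_le _

end Bipartite

section Bipartite

variable {α β : Type*} [DecidableEq α] [DecidableEq β] [Fintype α] [Fintype β]

theorem hasRegularPart_of_rowDeg_lt (q : ℕ) [hq : Fact q.Prime] {E : Finset (α × β)}
    {A : Finset α} {B : Finset β} {d J : ℕ} (hA : ∀ e ∈ E, e.1 ∈ A) (hB : ∀ e ∈ E, e.2 ∈ B)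
    (hAB : A.card ≤ B.card) (hne : B.Nonempty) (hc : ∀ b, colDeg E b ≤ d)
    (hr : ∀ a, rowDeg E a < 2 ^ J) (hE : d * B.card ≤ 2 * E.card)
    (hd : 128 * (262144 * q ^ 5) * J ≤ 3 * d) (hd0 : 0 < d) : HasRegularPart E q := by
  have hq2 := hq.out.two_le
  have hB0 := Finset.card_pos.2 hne
  have hdB := Nat.mul_pos hd0 hB0
  set T := 262144 * q ^ 5 with hT
  have hT0 : 0 < T := by positivity
  set E' := E.filter fun e => d ≤ 8 * rowDeg E e.1 with hE'
  have hE'E : E' ⊆ E := Finset.filter_subset _ _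
  have hE'card : 3 * (d * B.card) ≤ 8 * E'.card := by
    have h1 : E'.card + (E.filter fun e => ¬ d ≤ 8 * rowDeg E e.1).card = E.card :=
      Finset.card_filter_add_card_filter_not _
    have h2 : 8 * (E.filter fun e => ¬ d ≤ 8 * rowDeg E e.1).card ≤ d * B.card := by
      rw [← sum_rowDeg (A := A) fun e he => hA e (Finset.mem_filter.1 he).1, Finset.mul_sum]
      calc ∑ a ∈ A, 8 * rowDeg (E.filter fun e => ¬ d ≤ 8 * rowDeg E e.1) a
          ≤ A.card • d := by
            refine Finset.sum_le_card_nsmul _ _ _ fun a _ => ?_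
            by_cases ha : d ≤ 8 * rowDeg E a
            · rw [rowDeg, Finset.card_eq_zero.2]
              · omega
              · refine Finset.filter_eq_empty_iff.2 fun e he h => ?_
                exact (Finset.mem_filter.1 he).2 (h ▸ ha)
            · have := rowDeg_mono (E.filter_subset fun e => ¬ d ≤ 8 * rowDeg E e.1) a
              omega
        _ ≤ d * B.card := by rw [smul_eq_mul, mul_comm]; gcongr
    omega
  have hlog : ∀ e ∈ E', Nat.log 2 (rowDeg E e.1) ∈ Finset.range J := by
    intro e he
    rw [Finset.mem_range]
    have h1 := (Finset.mem_filter.1 he).2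
    exact Nat.log_lt_of_lt_pow (by omega) (hr _)
  have hE'0 : 0 < E'.card := by omega
  have hJ : (Finset.range J).Nonempty := by
    obtain ⟨e, he⟩ := Finset.card_pos.1 hE'0
    exact ⟨_, hlog e he⟩
  obtain ⟨j, -, hj⟩ := Finset.exists_le_card_fiber_of_mul_le_card_of_maps_to
    (n := 16 * T * B.card) hlog hJ (by
      rw [Finset.card_range]
      have : 128 * T * J * B.card ≤ 3 * d * B.card := by gcongr
      nlinarith)
  set F := E'.filter fun e => Nat.log 2 (rowDeg E e.1) = j with hF
  have hFE : F ⊆ E := (Finset.filter_subset _ _).trans hE'E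
  have hFr : ∀ e ∈ F, d ≤ 8 * rowDeg E e.1 ∧ 2 ^ j ≤ rowDeg E e.1 ∧
      rowDeg E e.1 < 2 ^ (j + 1) := by
    intro e he
    obtain ⟨h1, h2⟩ := Finset.mem_filter.1 he
    have h3 := (Finset.mem_filter.1 h1).2
    refine ⟨h3, ?_, ?_⟩
    · rw [← h2]
      exact Nat.pow_log_le_self 2 (by omega)
    · rw [← h2]
      exact Nat.lt_pow_succ_log_self (by norm_num) _
  have hFeq : ∀ e ∈ F, rowDeg F e.1 = rowDeg E e.1 := by
    intro e he
    obtain ⟨h1, h2⟩ := Finset.mem_filter.1 he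
    rw [hF, rowDeg_filter_of_pos (fun a => Nat.log 2 (rowDeg E a) = j) h2, hE',
      rowDeg_filter_of_pos (fun a => d ≤ 8 * rowDeg E a) (Finset.mem_filter.1 h1).2]
  have hFne : F.Nonempty := Finset.card_pos.1 (lt_of_lt_of_le (by positivity) hj)
  obtain ⟨e₀, he₀⟩ := hFne
  have hd16 : d ≤ 16 * 2 ^ j := by
    have := hFr e₀ he₀
    rw [pow_succ] at this
    omega
  have hcardA : (F.image Prod.fst).card * 2 ^ j ≤ F.card := by
    rw [← sum_rowDeg (A := F.image Prod.fst) fun e he => Finset.mem_image_of_mem _ he,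
      ← smul_eq_mul]
    refine Finset.card_nsmul_le_sum _ _ _ fun a ha => ?_
    obtain ⟨e, he, rfl⟩ := Finset.mem_image.1 ha
    rw [hFeq e he]
    exact (hFr e he).2.1
  refine (hasRegularPart_of_card_sq q (A := F.image Prod.fst) (B := B) (Δ := 16 * 2 ^ j)
    (fun e he => Finset.mem_image_of_mem _ he) (fun e he => hB e (hFE he)) ⟨e₀, he₀⟩ ?_ ?_
    ?_).mono hFE
  · intro a
    by_cases ha : ∃ e ∈ F, e.1 = a
    · obtain ⟨e, he, rfl⟩ := ha
      have := (hFr e he).2.2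
      rw [pow_succ] at this
      have := rowDeg_mono hFE e.1
      omega
    · rw [rowDeg, Finset.card_eq_zero.2 (Finset.filter_eq_empty_iff.2
        fun e he h => ha ⟨e, he, h⟩)]
      exact Nat.zero_le _
  · exact fun b => (colDeg_mono hFE b).trans ((hc b).trans hd16)
  · have : T * (16 * 2 ^ j) * (F.image Prod.fst).card * B.card ≤ F.card ^ 2 :=
      calc T * (16 * 2 ^ j) * (F.image Prod.fst).card * B.card
          = ((F.image Prod.fst).card * 2 ^ j) * (16 * T * B.card) := by ring
        _ ≤ F.card * F.card := Nat.mul_le_mul hcardA hj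
        _ = F.card ^ 2 := (sq _).symm
    rw [hT] at this
    exact_mod_cast this

theorem exists_forall_mul_log_pow_le (c K : ℕ) :
    ∃ d₀ : ℕ, ∀ d, d₀ ≤ d → c * (Nat.log 2 (d ^ K) + 1) ≤ d := by
  have h := (Real.isLittleO_log_id_atTop.comp_tendsto tendsto_natCast_atTop_atTop).bound
    (show (0 : ℝ) < Real.log 2 / (2 * (c * K + 1)) by
      have := Real.log_pos one_lt_two
      positivity)
  obtain ⟨N, hN⟩ := Filter.eventually_atTop.1 h
  refine ⟨max (max N 1) (2 * c), fun d hd => ?_⟩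
  have hdN : N ≤ d := by omega
  have hd1 : 1 ≤ d := by omega
  have hdc : 2 * c ≤ d := by omega
  have hlog := hN d hdN
  have hl2 := Real.log_pos one_lt_two
  have hd1' : (1 : ℝ) ≤ d := by exact_mod_cast hd1
  simp only [Function.comp, id, Real.norm_natCast] at hlog
  rw [Real.norm_of_nonneg (Real.log_nonneg hd1'), div_mul_eq_mul_div,
    le_div_iff₀ (by positivity)] at hlog
  have h1 : (Nat.log 2 (d ^ K) : ℝ) * Real.log 2 ≤ K * Real.log d := by
    have := Real.natLog_le_logb (d ^ K) 2
    rw [Real.logb, le_div_iff₀ (by exact_mod_cast hl2)] at this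
    push_cast at this
    rwa [Real.log_pow] at this
  have h2 : (c : ℝ) * Nat.log 2 (d ^ K) * 2 ≤ d := by
    refine le_of_mul_le_mul_right ?_ hl2
    have h3 : 0 ≤ Real.log d := Real.log_nonneg hd1'
    have h4 : (c : ℝ) * (Nat.log 2 (d ^ K) * Real.log 2) ≤ c * (K * Real.log d) := by gcongr
    nlinarith
  have h3 : c * Nat.log 2 (d ^ K) * 2 ≤ d := by exact_mod_cast h2
  rw [mul_add]
  omega

end Bipartite

theorem exists_forall_hasRegularPart (q : ℕ) [hq : Fact q.Prime] :
    ∃ c : ℕ, ∀ (α : Type*) (β : Type*) [DecidableEq α] [DecidableEq β] [Fintype α] [Fintype β]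
      (E : Finset (α × β)) (A : Finset α) (B : Finset β) (d n : ℕ),
      (∀ e ∈ E, e.1 ∈ A) → (∀ e ∈ E, e.2 ∈ B) → A.card ≤ B.card → B.Nonempty →
      (∀ b ∈ B, colDeg E b = d) → (∀ a, rowDeg E a ≤ n) →
      c * (Nat.log 2 (Nat.log 2 n) + 1) ≤ d → HasRegularPart E q := by
  obtain ⟨τ, hτ⟩ : ∃ τ, τ = 2048 * q ^ 3 := ⟨_, rfl⟩
  obtain ⟨s, hs⟩ : ∃ s, (3 * τ + 1) * q + 2 ≤ 2 ^ s := ⟨_, Nat.lt_two_pow_self.le⟩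
  obtain ⟨d₀, hd₀⟩ := exists_forall_mul_log_pow_le (128 * (262144 * q ^ 5)) (4 * 2 ^ s)
  refine ⟨d₀ + 2 * τ ^ 2 + 2 * q + 4 * (2 * 2 ^ s) * (q * τ), ?_⟩
  intro α β _ _ _ _ E A B d n hA hB hAB hne hc hr hd
  have hq2 := hq.out.two_le
  have hdl : d₀ + 2 * τ ^ 2 + 2 * q + 4 * (2 * 2 ^ s) * (q * τ) ≤ d :=
    (Nat.le_mul_of_pos_right _ (Nat.succ_pos _)).trans hd
  have hdn : 4 * ((Nat.log 2 (Nat.log 2 n) + 1) * (2 * 2 ^ s)) * (q * τ) ≤ d := by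
    refine le_trans ?_ hd
    calc 4 * ((Nat.log 2 (Nat.log 2 n) + 1) * (2 * 2 ^ s)) * (q * τ)
        = 4 * (2 * 2 ^ s) * (q * τ) * (Nat.log 2 (Nat.log 2 n) + 1) := by ring
      _ ≤ _ := by
        gcongr
        exact Nat.le_add_left _ _
  have hcd : ∀ b, colDeg E b ≤ d := by
    intro b
    by_cases hb : b ∈ B
    · exact (hc b hb).le
    · rw [colDeg, Finset.card_eq_zero.2 (Finset.filter_eq_empty_iff.2
        fun e he (h : e.2 = b) => hb (h ▸ hB e he))]
      exact Nat.zero_le _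
  have hcard : E.card = d * B.card := by
    rw [← sum_colDeg hB, Finset.sum_congr rfl hc, Finset.sum_const, smul_eq_mul, mul_comm]
  have hsplit : (E.filter fun e => rowDeg E e.1 ≤ d ^ (4 * 2 ^ s)).card +
      (E.filter fun e => ¬ rowDeg E e.1 ≤ d ^ (4 * 2 ^ s)).card = E.card :=
    Finset.card_filter_add_card_filter_not _
  by_cases hlow : d * B.card ≤ 2 * (E.filter fun e => rowDeg E e.1 ≤ d ^ (4 * 2 ^ s)).card
  · have hsub : E.filter (fun e => rowDeg E e.1 ≤ d ^ (4 * 2 ^ s)) ⊆ E := Finset.filter_subset _ _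
    refine (hasRegularPart_of_rowDeg_lt q (J := Nat.log 2 (d ^ (4 * 2 ^ s)) + 1)
      (fun e he => hA e (hsub he)) (fun e he => hB e (hsub he)) hAB hne
      (fun b => (colDeg_mono hsub b).trans (hcd b)) ?_ hlow ?_ (by omega)).mono hsub
    · intro a
      refine lt_of_le_of_lt ?_ (Nat.lt_pow_succ_log_self one_lt_two _)
      by_cases ha : rowDeg E a ≤ d ^ (4 * 2 ^ s)
      · exact (rowDeg_mono hsub a).trans ha
      · rw [rowDeg, Finset.card_eq_zero.2 (Finset.filter_eq_empty_iff.2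
          fun e he (h : e.1 = a) => ha (h ▸ (Finset.mem_filter.1 he).2))]
        exact Nat.zero_le _
    · have := hd₀ d (by omega)
      omega
  · have hsub : E.filter (fun e => ¬ rowDeg E e.1 ≤ d ^ (4 * 2 ^ s)) ⊆ E :=
      Finset.filter_subset _ _
    refine (hasRegularPart_of_lt_rowDeg q hτ hs (B := B) (d := d) (n := n)
      (fun e he => hB e (hsub he)) hne (fun b _ => (colDeg_mono hsub b).trans (hcd b))
      (fun a => (rowDeg_mono hsub a).trans (hr a)) ?_ (by omega) (by omega) (by omega)
      hdn).mono hsub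
    intro e he
    have h := (Finset.mem_filter.1 he).2
    rw [rowDeg_filter_of_pos (fun a => ¬ rowDeg E a ≤ d ^ (4 * 2 ^ s)) h]
    exact not_le.1 h

section Bipartite

variable {α β : Type*} [DecidableEq α] [DecidableEq β]

omit [DecidableEq α] in
theorem rowDeg_map_prodComm (E : Finset (α × β)) (b : β) :
    rowDeg (E.map (Equiv.prodComm α β).toEmbedding) b = colDeg E b := by
  rw [rowDeg, colDeg, Finset.filter_map, Finset.card_map]
  rfl

omit [DecidableEq β] in
theorem colDeg_map_prodComm (E : Finset (α × β)) (a : α) :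
    colDeg (E.map (Equiv.prodComm α β).toEmbedding) a = rowDeg E a := by
  rw [rowDeg, colDeg, Finset.filter_map, Finset.card_map]
  rfl

theorem HasRegularPart.of_map_prodComm {E : Finset (α × β)} {k : ℕ}
    (h : HasRegularPart (E.map (Equiv.prodComm α β).toEmbedding) k) : HasRegularPart E k := by
  obtain ⟨F, hF, hne, hr, hc⟩ := h
  refine ⟨F.map (Equiv.prodComm β α).toEmbedding, fun e he => ?_, hne.map, fun a => ?_,
    fun b => ?_⟩
  · obtain ⟨f, hf, rfl⟩ := Finset.mem_map.1 he
    obtain ⟨g, hg, rfl⟩ := Finset.mem_map.1 (hF hf)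
    exact hg
  · rw [rowDeg_map_prodComm]
    exact hc a
  · rw [colDeg_map_prodComm]
    exact hr b

/-- A bipartite graph with sufficiently many edges has a subgraph of large minimum degree. -/
theorem exists_subset_lt_degree {E : Finset (α × β)} {A : Finset α} {B : Finset β} {d : ℕ}
    (hA : ∀ e ∈ E, e.1 ∈ A) (hB : ∀ e ∈ E, e.2 ∈ B) (h : d * (A.card + B.card) < E.card) :
    ∃ F ⊆ E, F.Nonempty ∧ ∀ e ∈ F, d < rowDeg F e.1 ∧ d < colDeg F e.2 := by
  induction hN : A.card + B.card generalizing E A B with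
  | zero =>
    obtain ⟨e, he⟩ := Finset.card_pos.1 ((Nat.zero_le _).trans_lt h)
    have := Finset.card_pos.2 ⟨_, hA e he⟩
    omega
  | succ N ih =>
    by_cases hrow : ∃ e ∈ E, rowDeg E e.1 ≤ d
    · obtain ⟨e, he, hed⟩ := hrow
      have h1 : rowDeg E e.1 + (E.filter fun f => ¬ f.1 = e.1).card = E.card :=
        Finset.card_filter_add_card_filter_not _
      have h2 := Finset.card_erase_add_one (hA e he)
      rw [hN, mul_add] at h
      have h3 : (A.erase e.1).card + B.card = N := by omega
      obtain ⟨F, hF, hF'⟩ := ih (E := E.filter fun f => ¬ f.1 = e.1) (A := A.erase e.1) (B := B)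
        (fun f hf => Finset.mem_erase.2
          ⟨(Finset.mem_filter.1 hf).2, hA f (Finset.mem_filter.1 hf).1⟩)
        (fun f hf => hB f (Finset.mem_filter.1 hf).1) (by rw [h3]; omega) h3
      exact ⟨F, hF.trans (Finset.filter_subset _ _), hF'⟩
    by_cases hcol : ∃ e ∈ E, colDeg E e.2 ≤ d
    · obtain ⟨e, he, hed⟩ := hcol
      have h1 : colDeg E e.2 + (E.filter fun f => ¬ f.2 = e.2).card = E.card :=
        Finset.card_filter_add_card_filter_not _
      have h2 := Finset.card_erase_add_one (hB e he)
      rw [hN, mul_add] at h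
      have h3 : A.card + (B.erase e.2).card = N := by omega
      obtain ⟨F, hF, hF'⟩ := ih (E := E.filter fun f => ¬ f.2 = e.2) (A := A) (B := B.erase e.2)
        (fun f hf => hA f (Finset.mem_filter.1 hf).1)
        (fun f hf => Finset.mem_erase.2
          ⟨(Finset.mem_filter.1 hf).2, hB f (Finset.mem_filter.1 hf).1⟩)
        (by rw [h3]; omega) h3
      exact ⟨F, hF.trans (Finset.filter_subset _ _), hF'⟩
    push Not at hrow hcol
    exact ⟨E, subset_rfl, Finset.card_pos.1 ((Nat.zero_le _).trans_lt h),
      fun e he => ⟨hrow e he, hcol e he⟩⟩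

theorem exists_subset_colDeg_eq {E : Finset (α × β)} {B : Finset β} {d : ℕ}
    (h : ∀ b ∈ B, d ≤ colDeg E b) :
    ∃ F ⊆ E, (∀ e ∈ F, e.2 ∈ B) ∧ ∀ b ∈ B, colDeg F b = d := by
  choose! T hT hTd using fun b hb => Finset.exists_subset_card_eq (h b hb)
  have hTm : ∀ b ∈ B, ∀ e ∈ T b, e ∈ E ∧ e.2 = b := fun b hb e he =>
    Finset.mem_filter.1 (hT b hb he)
  refine ⟨B.biUnion T, fun e he => ?_, fun e he => ?_, fun b hb => ?_⟩
  · obtain ⟨b, hb, heb⟩ := Finset.mem_biUnion.1 he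
    exact (hTm b hb e heb).1
  · obtain ⟨b, hb, heb⟩ := Finset.mem_biUnion.1 he
    rwa [(hTm b hb e heb).2]
  · rw [← hTd b hb, colDeg]
    congr 1
    ext e
    rw [Finset.mem_filter, Finset.mem_biUnion]
    constructor
    · rintro ⟨⟨c, hc, hec⟩, rfl⟩
      rwa [(hTm c hc e hec).2]
    · exact fun he => ⟨⟨b, hb, he⟩, (hTm b hb e he).2⟩

end Bipartite

/-- Every directed graph has a directed cut containing at least a quarter of its edges. -/
theorem exists_cut {W : Type*} [Fintype W] [DecidableEq W] (E : Finset (W × W))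
    (hE : ∀ e ∈ E, e.1 ≠ e.2) :
    ∃ S : Finset W, E.card ≤ 4 * (E.filter fun e => e.1 ∈ S ∧ e.2 ∉ S).card := by
  obtain ⟨S, hS⟩ : ∃ S : Finset W,
      E.card ≤ 2 * (E.filter fun e => ¬ (e.1 ∈ S ↔ e.2 ∈ S)).card := by
    have key : ∀ e ∈ E, 2 * (Finset.univ.filter fun S : Finset W =>
        ¬ (e.1 ∈ S ↔ e.2 ∈ S)).card = Fintype.card (Finset W) := by
      intro e he
      have h1 : (Finset.univ.filter fun S : Finset W => (e.1 ∈ S ↔ e.2 ∈ S)).card =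
          (Finset.univ.filter fun S : Finset W => ¬ (e.1 ∈ S ↔ e.2 ∈ S)).card := by
        have hne := hE e he
        refine Finset.card_nbij' (fun S => symmDiff S {e.1}) (fun S => symmDiff S {e.1})
          ?_ ?_ ?_ ?_
        · intro S hS
          simp_all [Finset.mem_symmDiff, Ne.symm hne]
        · intro S hS
          simp_all [Finset.mem_symmDiff, Ne.symm hne]
          tauto
        · exact fun S _ => symmDiff_symmDiff_cancel_right _ _
        · exact fun S _ => symmDiff_symmDiff_cancel_right _ _
      have h2 := Finset.card_filter_add_card_filter_not (s := (Finset.univ : Finset (Finset W)))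
        (fun S => (e.1 ∈ S ↔ e.2 ∈ S))
      rw [Finset.card_univ] at h2
      omega
    by_contra hcon
    have h1 : ∑ S : Finset W, 2 * (E.filter fun e => ¬ (e.1 ∈ S ↔ e.2 ∈ S)).card <
        ∑ _S : Finset W, E.card :=
      Finset.sum_lt_sum_of_nonempty Finset.univ_nonempty fun S _ =>
        not_le.1 (not_exists.1 hcon S)
    refine h1.ne ?_
    have h2 := Finset.sum_card_bipartiteAbove_eq_sum_card_bipartiteBelow
      (s := (Finset.univ : Finset (Finset W))) (t := E) fun S e => ¬ (e.1 ∈ S ↔ e.2 ∈ S)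
    simp only [Finset.bipartiteAbove, Finset.bipartiteBelow] at h2
    rw [← Finset.mul_sum, h2, Finset.mul_sum, Finset.sum_congr rfl key, Finset.sum_const,
      Finset.sum_const, Finset.card_univ, smul_eq_mul, smul_eq_mul, mul_comm]
  have h1 : (E.filter fun e => ¬ (e.1 ∈ S ↔ e.2 ∈ S)).card ≤
      (E.filter fun e => e.1 ∈ S ∧ e.2 ∉ S).card +
      (E.filter fun e => e.1 ∈ Sᶜ ∧ e.2 ∉ Sᶜ).card := by
    refine le_trans (Finset.card_le_card fun e he => ?_) (Finset.card_union_le _ _)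
    rw [Finset.mem_union, Finset.mem_filter, Finset.mem_filter, Finset.mem_compl,
      Finset.mem_compl]
    rw [Finset.mem_filter] at he
    tauto
  rcases le_total (E.filter fun e => e.1 ∈ S ∧ e.2 ∉ S).card
    (E.filter fun e => e.1 ∈ Sᶜ ∧ e.2 ∉ Sᶜ).card with h | h
  · exact ⟨Sᶜ, by omega⟩
  · exact ⟨S, by omega⟩

theorem HasRegularPart.hasRegularSubgraph {W : Type*} [DecidableEq W] {G : SimpleGraph W}
    {E : Finset (W × W)} {S : Finset W} {k : ℕ} (h : HasRegularPart E k)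
    (hG : ∀ e ∈ E, G.Adj e.1 e.2) (hS : ∀ e ∈ E, e.1 ∈ S ∧ e.2 ∉ S) :
    HasRegularSubgraph G k := by
  obtain ⟨F, hFE, ⟨e₀, he₀⟩, hr, hc⟩ := h
  refine ⟨{
    verts := {v | ∃ e ∈ F, e.1 = v ∨ e.2 = v}
    Adj := fun u v => (u, v) ∈ F ∨ (v, u) ∈ F
    adj_sub := fun h => h.elim (fun h => hG _ (hFE h)) fun h => (hG _ (hFE h)).symm
    edge_vert := fun h => h.elim (fun h => ⟨_, h, Or.inl rfl⟩) fun h => ⟨_, h, Or.inr rfl⟩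
    symm := ⟨fun _ _ h => h.symm⟩ }, ⟨e₀.1, e₀, he₀, Or.inl rfl⟩, ?_⟩
  rintro v ⟨e, he, rfl | rfl⟩
  · have h0 : 0 < rowDeg F e.1 := Finset.card_pos.2 ⟨e, Finset.mem_filter.2 ⟨he, rfl⟩⟩
    have h1 : rowDeg F e.1 = k := (hr e.1).resolve_left h0.ne'
    have h2 : ((F.filter fun f => f.1 = e.1).image Prod.snd).card = rowDeg F e.1 := by
      refine Finset.card_image_of_injOn fun f hf g hg hfg => Prod.ext ?_ hfg
      exact (Finset.mem_filter.1 hf).2.trans (Finset.mem_filter.1 hg).2.symm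
    rw [subDeg, ← h1, ← h2, ← Set.ncard_coe_finset]
    congr 1
    ext w
    rw [SimpleGraph.Subgraph.mem_neighborSet, Finset.mem_coe, Finset.mem_image]
    constructor
    · rintro (hw | hw)
      · exact ⟨_, Finset.mem_filter.2 ⟨hw, rfl⟩, rfl⟩
      · exact absurd (hS e (hFE he)).1 (hS _ (hFE hw)).2
    · rintro ⟨f, hf, rfl⟩
      obtain ⟨hf, hfe⟩ := Finset.mem_filter.1 hf
      rw [← hfe]
      exact Or.inl hf
  · have h0 : 0 < colDeg F e.2 := Finset.card_pos.2 ⟨e, Finset.mem_filter.2 ⟨he, rfl⟩⟩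
    have h1 : colDeg F e.2 = k := (hc e.2).resolve_left h0.ne'
    have h2 : ((F.filter fun f => f.2 = e.2).image Prod.fst).card = colDeg F e.2 := by
      refine Finset.card_image_of_injOn fun f hf g hg hfg => Prod.ext hfg ?_
      exact (Finset.mem_filter.1 hf).2.trans (Finset.mem_filter.1 hg).2.symm
    rw [subDeg, ← h1, ← h2, ← Set.ncard_coe_finset]
    congr 1
    ext w
    rw [SimpleGraph.Subgraph.mem_neighborSet, Finset.mem_coe, Finset.mem_image]
    constructor
    · rintro (hw | hw)
      · exact absurd (hS _ (hFE hw)).1 (hS e (hFE he)).2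
      · exact ⟨_, Finset.mem_filter.2 ⟨hw, rfl⟩, rfl⟩
    · rintro ⟨f, hf, rfl⟩
      obtain ⟨hf, hfe⟩ := Finset.mem_filter.1 hf
      rw [← hfe]
      exact Or.inr hf

theorem card_filter_adj {W : Type*} [Fintype W] (G : SimpleGraph W)
    [DecidableRel G.Adj] :
    (Finset.univ.filter fun e : W × W => G.Adj e.1 e.2).card = 2 * edgeCount G := by
  classical
  rw [edgeCount, ← SimpleGraph.coe_edgeFinset, Set.ncard_coe_finset,
    ← SimpleGraph.sum_degrees_eq_twice_card_edges,
    Finset.card_eq_sum_card_fiberwise (f := Prod.fst) (t := Finset.univ) (by simp)]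
  refine Finset.sum_congr rfl fun v _ => ?_
  rw [← SimpleGraph.card_neighborFinset_eq_degree]
  refine Finset.card_nbij' Prod.snd (fun w => (v, w)) ?_ ?_ ?_ ?_
  · rintro ⟨u, w⟩ h
    have : G.Adj u w ∧ u = v := by simpa using h
    simpa using this.2 ▸ this.1
  · intro w h
    simp_all
  · rintro ⟨u, w⟩ h
    simp_all
  · intro w h
    rfl

/-- A bipartite graph on few vertices with large minimum degree has a regular subgraph. -/
theorem exists_forall_hasRegularPart_of_le_degree (q : ℕ) [Fact q.Prime] :
    ∃ c : ℕ, ∀ (W : Type*) [DecidableEq W] [Fintype W] (E : Finset (W × W)) (d : ℕ),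
      E.Nonempty → (∀ e ∈ E, d ≤ rowDeg E e.1 ∧ d ≤ colDeg E e.2) →
      c * (Nat.log 2 (Nat.log 2 (Fintype.card W)) + 1) ≤ d → HasRegularPart E q := by
  obtain ⟨c, hc⟩ := exists_forall_hasRegularPart q
  refine ⟨c, fun W _ _ E d hne hE hd => ?_⟩
  have main : ∀ E : Finset (W × W), E.Nonempty → (∀ e ∈ E, d ≤ rowDeg E e.1 ∧ d ≤ colDeg E e.2) →
      (E.image Prod.fst).card ≤ (E.image Prod.snd).card → HasRegularPart E q := by
    intro E hne hE hcard
    obtain ⟨F, hFE, hFB, hFd⟩ := exists_subset_colDeg_eq (E := E) (B := E.image Prod.snd) (d := d)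
      fun b hb => by
        obtain ⟨e, he, rfl⟩ := Finset.mem_image.1 hb
        exact (hE e he).2
    refine (hc W W F (E.image Prod.fst) (E.image Prod.snd) d (Fintype.card W)
      (fun e he => Finset.mem_image_of_mem _ (hFE he)) hFB hcard (hne.image _) hFd ?_ hd).mono hFE
    intro a
    rw [rowDeg, ← Finset.card_univ]
    refine Finset.card_le_card_of_injOn Prod.snd (fun _ _ => Finset.mem_univ _) ?_
    exact fun f hf g hg hfg =>
      Prod.ext ((Finset.mem_filter.1 hf).2.trans (Finset.mem_filter.1 hg).2.symm) hfg
  rcases le_total (E.image Prod.fst).card (E.image Prod.snd).card with h | h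
  · exact main E hne hE h
  · refine HasRegularPart.of_map_prodComm (main _ hne.map ?_ ?_)
    · intro e he
      obtain ⟨f, hf, rfl⟩ := Finset.mem_map.1 he
      rw [rowDeg_map_prodComm, colDeg_map_prodComm]
      exact (hE f hf).symm
    · rw [Finset.map_eq_image, Finset.image_image, Finset.image_image]
      exact h

/-- For every positive integer `k` there is `C = C(k)` such that every graph on `n ≥ 4`
vertices with average degree at least `C · log₂ log₂ n` contains a nonempty `k`-regular
subgraph. -/
theorem erdos_sauer_loglog_n (k : ℕ) (hk : 0 < k) :
    ∃ C : ℝ, ∀ (V : Type) [Fintype V] (G : SimpleGraph V),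
      4 ≤ Fintype.card V →
      C * Real.logb 2 (Real.logb 2 (Fintype.card V : ℝ)) ≤ avgDeg G →
      HasRegularSubgraph G k := by
  classical
  obtain ⟨q, hkq, hq⟩ := Nat.exists_infinite_primes k
  have : Fact q.Prime := ⟨hq⟩
  obtain ⟨c, hc⟩ := exists_forall_hasRegularPart_of_le_degree q
  refine ⟨8 * c + 1, fun V _ G hn hG => ?_⟩
  set n := Fintype.card V with hn'
  have hn0 : (0 : ℝ) < n := by
    have : 0 < n := by omega
    exact_mod_cast this
  obtain ⟨d, hd⟩ : ∃ d, d = c * (Nat.log 2 (Nat.log 2 n) + 1) := ⟨_, rfl⟩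
  have hlog2 : (2 : ℝ) ≤ Real.logb 2 n := by
    rw [Real.le_logb_iff_rpow_le one_lt_two hn0]
    norm_num
    exact_mod_cast hn
  have hloglog : 1 ≤ Real.logb 2 (Real.logb 2 n) := by
    rw [Real.le_logb_iff_rpow_le one_lt_two (by linarith)]
    simpa using hlog2
  have hfloor : (Nat.log 2 (Nat.log 2 n) : ℝ) ≤ Real.logb 2 (Real.logb 2 n) := by
    have h1 : (Nat.log 2 n : ℝ) ≤ Real.logb 2 n := by exact_mod_cast Real.natLog_le_logb n 2
    have h2 : 0 < Nat.log 2 n := Nat.log_pos one_lt_two (by omega)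
    refine le_trans (by exact_mod_cast Real.natLog_le_logb (Nat.log 2 n) 2) ?_
    exact Real.logb_le_logb_of_le one_lt_two (by exact_mod_cast h2) h1
  set E : Finset (V × V) := Finset.univ.filter fun e => G.Adj e.1 e.2 with hE
  have hdE : 4 * (d * n) < E.card := by
    have h1 : (4 * d : ℝ) < avgDeg G := by
      refine lt_of_lt_of_le ?_ hG
      have h2 : (c : ℝ) * (Nat.log 2 (Nat.log 2 n) + 1) ≤
          c * (2 * Real.logb 2 (Real.logb 2 n)) := by
        gcongr
        linarith
      rw [hd]
      push_cast
      linarith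
    rw [avgDeg, lt_div_iff₀ hn0] at h1
    have hEcard : E.card = 2 * edgeCount G := card_filter_adj G
    rw [hEcard]
    have h2 : 4 * d * n < 2 * edgeCount G := by exact_mod_cast h1
    rwa [mul_assoc] at h2
  obtain ⟨S, hS⟩ := exists_cut E fun e he => (Finset.mem_filter.1 he).2.ne
  obtain ⟨F, hF, hFne, hFd⟩ := exists_subset_lt_degree (E := E.filter fun e => e.1 ∈ S ∧ e.2 ∉ S)
    (A := S) (B := Sᶜ) (d := d) (fun e he => (Finset.mem_filter.1 he).2.1)
    (fun e he => Finset.mem_compl.2 (Finset.mem_filter.1 he).2.2) (by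
      rw [Finset.card_add_card_compl, ← hn']
      omega)
  refine HasRegularPart.hasRegularSubgraph (E := F) (S := S) (HasRegularPart.of_le hk hkq
    (hc V F d hFne (fun e he => ⟨(hFd e he).1.le, (hFd e he).2.le⟩) hd.ge)) ?_ ?_
  · exact fun e he => (Finset.mem_filter.1 (Finset.mem_filter.1 (hF he)).1).2
  · exact fun e he => (Finset.mem_filter.1 (hF he)).2
end

section
/- Let k be a positive integer and let H be a K_{k,k}-free bipartite graph with parts S and T such that every vertex u ∈ S satisfies d_H(u) ≥ k·|T|^{1−1/k}. Then e(H) ≤ k·|T|. -/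
variable {V : Type*}

/-- For `k ≤ x`, the generalized binomial coefficient `x choose k` is at least `(x / k) ^ k`. -/
theorem div_pow_le_descPochhammer_eval_div_factorial {k : ℕ} {x : ℝ} (hx : (k : ℝ) ≤ x) :
    (x / k) ^ k ≤ (descPochhammer ℝ k).eval x / k.factorial := by
  have hfac : (k.factorial : ℝ) = ∏ i ∈ Finset.range k, ((k : ℝ) - i) := by
    rw [← descPochhammer_eval_eq_prod_range, descPochhammer_eval_eq_descFactorial,
      Nat.descFactorial_self]
  rw [le_div_iff₀ (by positivity), hfac, descPochhammer_eval_eq_prod_range,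
    ← Finset.card_range k, ← Finset.prod_const, Finset.card_range, ← Finset.prod_mul_distrib]
  refine Finset.prod_le_prod (fun i hi ↦ ?_) (fun i hi ↦ ?_) <;>
    have hik : (i : ℝ) + 1 ≤ k := by exact_mod_cast Finset.mem_range.mp hi
  · exact mul_nonneg (div_nonneg (by linarith [Nat.cast_nonneg (α := ℝ) k]) (by positivity))
      (by linarith)
  · have hk : (0 : ℝ) < k := by linarith [Nat.cast_nonneg (α := ℝ) i]
    have h1 : 1 ≤ x / k := (one_le_div hk).mpr hx
    have h2 : x / k * k = x := div_mul_cancel₀ x hk.ne'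
    nlinarith [mul_le_mul_of_nonneg_right h1 (Nat.cast_nonneg (α := ℝ) i)]

/-- Double counting of `k`-stars: in a `K_{k,k}`-free graph every `k`-subset of `S` has fewer
than `k` common neighbours in `T`. -/
theorem sum_choose_degree_le_of_kkkFree {V : Type*} [Fintype V] {G : SimpleGraph V}
    [DecidableRel G.Adj] {k : ℕ} {S T : Finset V}
    (hbip : G.IsBipartiteWith (S : Set V) (T : Set V)) (hfree : KkkFree G k) :
    ∑ v ∈ T, (G.degree v).choose k ≤ (S.card).choose k * (k - 1) := by
  classical
  have hcount : ∀ v ∈ T, (G.degree v).choose k =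
      ((S.powersetCard k).bipartiteAbove (fun v A ↦ A ⊆ G.neighborFinset v) v).card := by
    intro v hv
    rw [← G.card_neighborFinset_eq_degree, ← Finset.card_powersetCard]
    congr 1
    ext A
    simp only [Finset.mem_powersetCard, Finset.mem_bipartiteAbove]
    have hsub : G.neighborFinset v ⊆ S := fun u hu ↦ by
      simpa using hbip.symm.mem_of_mem_adj (by simpa using hv) (by simpa using hu)
    exact ⟨fun h ↦ ⟨⟨h.1.trans hsub, h.2⟩, h.1⟩, fun h ↦ ⟨h.2, h.1.2⟩⟩
  rw [Finset.sum_congr rfl hcount, Finset.sum_card_bipartiteAbove_eq_sum_card_bipartiteBelow,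
    ← Finset.card_powersetCard, ← smul_eq_mul]
  refine Finset.sum_le_card_nsmul _ _ _ fun A hA ↦ ?_
  by_contra! hlt
  obtain ⟨B, hBsub, hB⟩ := Finset.exists_subset_card_eq (Nat.le_of_pred_lt hlt)
  obtain ⟨hAS, hAk⟩ := Finset.mem_powersetCard.mp hA
  have hBT : ∀ v ∈ B, v ∈ T ∧ A ⊆ G.neighborFinset v := fun v hv ↦ by
    simpa using hBsub hv
  refine hfree ⟨A, B, ?_, hAk, hB, fun u hu v hv ↦ ?_⟩
  · exact (Finset.disjoint_coe.mp hbip.disjoint).mono hAS fun v hv ↦ (hBT v hv).1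
  · exact (by simpa using (hBT v hv).2 hu : G.Adj v u).symm

/-- If `e` is at least `s` times `k * n ^ (1 - 1 / k)`, then `s ^ k ≤ n * (e / n / k) ^ k`. -/
theorem pow_le_mul_div_pow_of_mul_rpow_le {k : ℕ} (hk : 0 < k) {n s e : ℝ} (hn : 0 < n)
    (hs : 0 ≤ s) (h : s * (k * n ^ ((1 : ℝ) - 1 / (k : ℝ))) ≤ e) :
    s ^ k ≤ n * (e / n / k) ^ k := by
  have hk' : (0 : ℝ) < k := by exact_mod_cast hk
  have hpow : (n ^ ((1 : ℝ) - 1 / (k : ℝ))) ^ k * n = n ^ k := by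
    rw [← Real.rpow_mul_natCast hn.le, sub_mul, one_div_mul_cancel hk'.ne', one_mul,
      Real.rpow_sub_one hn.ne', Real.rpow_natCast, div_mul_cancel₀ _ hn.ne']
  have hle := pow_le_pow_left₀ (by positivity) h k
  rw [mul_pow, mul_pow] at hle
  rw [div_div, div_pow, mul_pow, ← mul_div_assoc, le_div_iff₀ (by positivity), ← hpow]
  nlinarith [mul_le_mul_of_nonneg_right hle hn.le]

/-- If `H` is a `K_{k,k}`-free bipartite graph with parts `S` and `T` in which every vertex
of `S` has degree at least `k·|T|^{1-1/k}`, then `e(H) ≤ k·|T|`. -/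
theorem kkkFree_degree_bound {V : Type*} [Fintype V] (k : ℕ) (hk : 0 < k)
    (H : SimpleGraph V) (S T : Set V) (hbip : BipartiteWith H S T)
    (hfree : KkkFree H k)
    (hdeg : ∀ u ∈ S, (k : ℝ) * (T.ncard : ℝ) ^ ((1 : ℝ) - 1 / (k : ℝ)) ≤ (deg H u : ℝ)) :
    edgeCount H ≤ k * T.ncard := by
  classical
  lift S to Finset V using S.toFinite
  lift T to Finset V using T.toFinite
  have hb : H.IsBipartiteWith (S : Set V) (T : Set V) :=
    ⟨hbip.1, fun u v huv ↦ hbip.2.2 huv⟩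
  have hdeg_eq : ∀ u, deg H u = H.degree u := fun u ↦ by
    rw [deg, Set.ncard_eq_toFinset_card', ← H.card_neighborFinset_eq_degree]; rfl
  have hedge : edgeCount H = H.edgeFinset.card := by
    rw [edgeCount, Set.ncard_eq_toFinset_card']; rfl
  simp only [hdeg_eq, Set.ncard_coe_finset, Finset.mem_coe] at hdeg ⊢
  rw [hedge]
  have hsumS := SimpleGraph.isBipartiteWith_sum_degrees_eq_card_edges hb
  have hsumT := SimpleGraph.isBipartiteWith_sum_degrees_eq_card_edges' hb
  generalize H.edgeFinset.card = e at *
  by_contra! hlt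
  have hT : T.Nonempty := by
    rw [Finset.nonempty_iff_ne_empty]
    rintro rfl
    simp at hsumT hlt
    omega
  have hk' : (0 : ℝ) < k := by exact_mod_cast hk
  have hn : (0 : ℝ) < T.card := by exact_mod_cast hT.card_pos
  have hlt' : (k : ℝ) * T.card < e := by exact_mod_cast hlt
  have he : (0 : ℝ) < e := lt_trans (by positivity) hlt'
  have havg : (k : ℝ) ≤ e / T.card := ((lt_div_iff₀ hn).mpr hlt').le
  have hmean : ∑ v ∈ T, (T.card : ℝ)⁻¹ * (H.degree v : ℝ) = e / T.card := by
    rw [← Finset.mul_sum, ← hsumT]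
    push_cast
    ring
  have hjensen := descPochhammer_eval_div_factorial_le_sum_choose hk.ne' (t := T)
    (fun v ↦ H.degree v) (fun _ ↦ (T.card : ℝ)⁻¹) (fun _ _ ↦ by positivity)
    (by simp [hn.ne']) (by rw [hmean]; linarith)
  rw [hmean, ← Finset.mul_sum, le_inv_mul_iff₀ hn] at hjensen
  have hlower : (T.card : ℝ) * (e / T.card / k) ^ k ≤ ∑ v ∈ T, ((H.degree v).choose k : ℝ) :=
    (mul_le_mul_of_nonneg_left (div_pow_le_descPochhammer_eval_div_factorial havg) hn.le).trans
      hjensen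
  have hupper : ∑ v ∈ T, ((H.degree v).choose k : ℝ) ≤ S.card.choose k * (k - 1 : ℕ) := by
    exact_mod_cast sum_choose_degree_le_of_kkkFree hb hfree
  have hpow : (S.card : ℝ) ^ k ≤ T.card * (e / T.card / k) ^ k := by
    refine pow_le_mul_div_pow_of_mul_rpow_le hk hn (by positivity) ?_
    rw [← hsumS, Nat.cast_sum, ← nsmul_eq_mul]
    exact Finset.card_nsmul_le_sum _ _ _ hdeg
  have hchoose := Nat.choose_le_pow_div (α := ℝ) k S.card
  have hX : 0 < (T.card : ℝ) * (e / T.card / k) ^ k := by positivity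
  generalize (T.card : ℝ) * (e / T.card / k) ^ k = X at *
  have hfac : ((k - 1 : ℕ) : ℝ) < k.factorial := by
    exact_mod_cast (Nat.sub_one_lt hk.ne').trans_le k.self_le_factorial
  have hfac_pos : (0 : ℝ) < k.factorial := by positivity
  have hchain : X ≤ X / k.factorial * (k - 1 : ℕ) :=
    (hlower.trans hupper).trans (by gcongr; exact hchoose.trans (by gcongr))
  rw [div_mul_eq_mul_div, le_div_iff₀ hfac_pos] at hchain
  exact absurd (le_of_mul_le_mul_left hchain hX) (not_le.mpr hfac)
end

section
/- Let k be a positive integer and let G be a K_{k,k}-free bipartite graph with parts A and B such that every vertex u ∈ A satisfies d_G(u) ≤ m. Then G has a spanning subgraph G′ (a subgraph on the same vertex set whose edge set is a subset of E(G)) such that e(G′) ≥ e(G)/(k+1) and, for any two distinct vertices u, u′ ∈ A, the number of common neighbours of u and u′ in G′ is at most k·m^{1−1/k}. -/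
variable {V : Type*}

theorem div_pow_le_choose {k n : ℕ} (hkn : k ≤ n) :
    ((n : ℝ) / k) ^ k ≤ n.choose k := by
  induction k generalizing n with
  | zero => simp
  | succ k ih =>
    obtain ⟨n, rfl⟩ : ∃ j, n = j + 1 := ⟨n - 1, by omega⟩
    have hkn' : k ≤ n := by omega
    have h := Nat.add_one_mul_choose_eq n k
    have h' : ((n : ℝ) + 1) * n.choose k = (n + 1).choose (k + 1) * (k + 1) := by exact_mod_cast h
    have e : (((n + 1).choose (k + 1) : ℕ) : ℝ) = ((n : ℝ) + 1) / (k + 1) * n.choose k := by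
      field_simp
      linarith
    rw [e, pow_succ']
    push_cast
    refine mul_le_mul_of_nonneg_left (le_trans ?_ (ih hkn')) (by positivity)
    rcases Nat.eq_zero_or_pos k with rfl | hk
    · simp
    · refine pow_le_pow_left₀ (by positivity) ?_ _
      have hk' : (0 : ℝ) < k := by exact_mod_cast hk
      have : (k : ℝ) ≤ n := by exact_mod_cast hkn'
      rw [div_le_div_iff₀ (by positivity) hk']
      nlinarith

theorem tangent_le_choose {k : ℕ} (hk : 0 < k) (n : ℕ) {b : ℝ} (hb : 1 ≤ b) :
    b ^ (k - 1) * (n - (k - 1) * b) ≤ n.choose k := by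
  have hk' : (1 : ℝ) ≤ k := by exact_mod_cast hk
  rcases lt_or_ge n k with hn | hn
  · have h1 : (n : ℝ) + 1 ≤ k := by exact_mod_cast hn
    have h2 : (n : ℝ) - (k - 1) * b ≤ 0 := by nlinarith
    have h3 : (0 : ℝ) ≤ b ^ (k - 1) := by positivity
    exact (mul_nonpos_of_nonneg_of_nonpos h3 h2).trans (by positivity)
  · refine le_trans ?_ (div_pow_le_choose hn)
    have hb0 : (0 : ℝ) < b := by linarith
    have hB := one_add_mul_sub_le_pow (a := (n : ℝ) / (k * b))
      (le_trans (by norm_num) (show (0 : ℝ) ≤ _ by positivity)) k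
    have hbk : b ^ k = b ^ (k - 1) * b := by rw [← pow_succ, Nat.sub_add_cancel hk]
    calc b ^ (k - 1) * (n - (k - 1) * b)
        = b ^ k * (1 + k * ((n : ℝ) / (k * b) - 1)) := by
          rw [hbk]; field_simp; ring
      _ ≤ b ^ k * ((n : ℝ) / (k * b)) ^ k := mul_le_mul_of_nonneg_left hB (by positivity)
      _ = ((n : ℝ) / k) ^ k := by rw [← mul_pow]; congr 1; field_simp

open scoped Classical in
theorem sum_choose_card_le {α β : Type*} (X : Finset α) (T : Finset β) (r : β → α → Prop)
    (k : ℕ) (hr : ∀ S ⊆ T, S.card = k → (X.filter fun x => ∀ i ∈ S, r i x).card < k) :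
    ∑ x ∈ X, (T.filter fun i => r i x).card.choose k ≤ (k - 1) * T.card.choose k := by
  calc ∑ x ∈ X, (T.filter fun i => r i x).card.choose k
      = ∑ x ∈ X, ((T.powersetCard k).filter fun S => ∀ i ∈ S, r i x).card := by
        refine Finset.sum_congr rfl fun x _ => ?_
        rw [← Finset.card_powersetCard]
        congr 1
        ext S
        simp only [Finset.mem_powersetCard, Finset.mem_filter, Finset.subset_iff]
        grind
    _ = ∑ S ∈ T.powersetCard k, (X.filter fun x => ∀ i ∈ S, r i x).card := by
        simpa only [Finset.bipartiteAbove, Finset.bipartiteBelow] using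
          Finset.sum_card_bipartiteAbove_eq_sum_card_bipartiteBelow
            (s := X) (t := T.powersetCard k) (fun x S => ∀ i ∈ S, r i x)
    _ ≤ ∑ S ∈ T.powersetCard k, (k - 1) := by
        refine Finset.sum_le_sum fun S hS => ?_
        rw [Finset.mem_powersetCard] at hS
        have := hr S hS.1 hS.2
        omega
    _ = (k - 1) * T.card.choose k := by
        rw [Finset.sum_const, Finset.card_powersetCard, smul_eq_mul, mul_comm]

theorem pow_le_mul_pow {k : ℕ} (hk : 0 < k) {d m t b E : ℝ} (hd : 0 < d) (hdm : d ≤ m)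
    (ht : 0 ≤ t) (hE0 : 0 ≤ E) (hE : E ^ k = m ^ (k - 1)) (h : t * E ≤ d * b) :
    t ^ k ≤ d * b ^ k := by
  have h1 : (t * E) ^ k ≤ (d * b) ^ k := pow_le_pow_left₀ (by positivity) h k
  have h2 : d ^ (k - 1) ≤ m ^ (k - 1) := pow_le_pow_left₀ hd.le hdm _
  have h3 : d ^ k = d ^ (k - 1) * d := by rw [← pow_succ, Nat.sub_add_cancel hk]
  rw [mul_pow, mul_pow, hE, h3] at h1
  have h4 : d ^ (k - 1) * t ^ k ≤ d ^ (k - 1) * (d * b ^ k) := by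
    nlinarith [mul_le_mul_of_nonneg_left h2 (show 0 ≤ t ^ k by positivity)]
  exact le_of_mul_le_mul_left h4 (by positivity)

open scoped Classical in
/-- If at most `k - 1` points lie in any `k` of the sets and every set is large, then the sets
have average degree at most `k`. -/
theorem sum_card_le_of_large {α β : Type*} (X : Finset α) (T : Finset β) (r : β → α → Prop)
    {k m : ℕ} (hk : 0 < k) (hm : X.card ≤ m) {E : ℝ} (hE0 : 0 ≤ E)
    (hE : E ^ k = (m : ℝ) ^ (k - 1))
    (hT : ∀ i ∈ T, k * E ≤ ((X.filter fun x => r i x).card : ℝ))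
    (hr : ∀ S ⊆ T, S.card = k → (X.filter fun x => ∀ i ∈ S, r i x).card < k) :
    ∑ i ∈ T, (X.filter fun x => r i x).card ≤ k * X.card := by
  by_contra! hlt
  obtain ⟨W, hW⟩ : ∃ W, W = ∑ i ∈ T, (X.filter fun x => r i x).card := ⟨_, rfl⟩
  rw [← hW] at hlt
  have hWx : W = ∑ x ∈ X, (T.filter fun i => r i x).card := by
    rw [hW]
    simpa only [Finset.bipartiteAbove, Finset.bipartiteBelow] using
      Finset.sum_card_bipartiteAbove_eq_sum_card_bipartiteBelow (s := T) (t := X) r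
  have hX : 0 < X.card := by
    rw [Finset.card_pos]
    by_contra h
    rw [Finset.not_nonempty_iff_eq_empty] at h
    simp [hWx, h] at hlt
  have ht : 0 < T.card := by
    rw [Finset.card_pos]
    by_contra h
    rw [Finset.not_nonempty_iff_eq_empty] at h
    simp [hW, h] at hlt
  have hX' : (0 : ℝ) < X.card := by exact_mod_cast hX
  have ht' : (0 : ℝ) < T.card := by exact_mod_cast ht
  have hk' : (0 : ℝ) < k := by exact_mod_cast hk
  have hm' : (X.card : ℝ) ≤ m := by exact_mod_cast hm
  obtain ⟨b, hb⟩ : ∃ b : ℝ, b = W / (k * X.card) := ⟨_, rfl⟩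
  have hWb : (W : ℝ) = k * X.card * b := by rw [hb]; field_simp
  have hlt' : (k : ℝ) * X.card < W := by exact_mod_cast hlt
  have hb1 : 1 ≤ b := by rw [hb, one_le_div (mul_pos hk' hX')]; exact hlt'.le
  have hWT : (T.card : ℝ) * (k * E) ≤ W := by
    rw [hW, Nat.cast_sum, ← nsmul_eq_mul]
    exact Finset.card_nsmul_le_sum _ _ _ hT
  have hbt : T.card * E ≤ X.card * b := by
    have : (k : ℝ) * (T.card * E) ≤ k * (X.card * b) := by linarith
    exact le_of_mul_le_mul_left this hk'
  have hpow : (T.card : ℝ) ^ k ≤ X.card * b ^ k :=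
    pow_le_mul_pow hk hX' hm' ht'.le hE0 hE hbt
  have hlow : X.card * b ^ k ≤ ∑ x ∈ X, (((T.filter fun i => r i x).card.choose k : ℕ) : ℝ) := by
    refine le_trans (le_of_eq ?_) (Finset.sum_le_sum fun x _ => tangent_le_choose hk _ hb1)
    rw [← Finset.mul_sum, Finset.sum_sub_distrib, ← Nat.cast_sum, ← hWx, hWb, Finset.sum_const,
      nsmul_eq_mul]
    have hbk : b ^ k = b ^ (k - 1) * b := by rw [← pow_succ, Nat.sub_add_cancel hk]
    rw [hbk]; ring
  have hup := sum_choose_card_le X T r k hr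
  have hup' : ∑ x ∈ X, (((T.filter fun i => r i x).card.choose k : ℕ) : ℝ)
      ≤ ((k - 1 : ℕ) : ℝ) * T.card.choose k := by exact_mod_cast hup
  have hch : (T.card.choose k : ℝ) * k.factorial ≤ (T.card : ℝ) ^ k := by
    have := Nat.choose_le_pow_div (α := ℝ) k T.card
    rwa [le_div_iff₀ (by positivity)] at this
  have hfac : ((k - 1 : ℕ) : ℝ) + 1 ≤ k.factorial := by
    have := Nat.self_le_factorial k
    exact_mod_cast (by omega : k - 1 + 1 ≤ k.factorial)
  have hpos : (0 : ℝ) < (T.card : ℝ) ^ k := pow_pos ht' k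
  have hc : (0 : ℝ) < T.card.choose k := by
    by_contra! h
    have : ((k - 1 : ℕ) : ℝ) * T.card.choose k ≤ 0 :=
      mul_nonpos_of_nonneg_of_nonpos (by positivity) h
    linarith
  nlinarith

open scoped Classical in
/-- A linearised form of Turán's bound on the independence number. -/
theorem exists_independent_subset {V : Type*} (H : SimpleGraph V) (k : ℕ) (S : Finset V) :
    ∃ I ⊆ S, (∀ u ∈ I, ∀ v ∈ I, ¬ H.Adj u v) ∧
      (1 + 2 * k) * S.card ≤
        (1 + k) ^ 2 * I.card + ∑ u ∈ S, (S.filter fun v => H.Adj u v).card := by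
  induction S using Finset.strongInduction with
  | H S ih =>
  rcases S.eq_empty_or_nonempty with rfl | hS
  · exact ⟨∅, by simp⟩
  obtain ⟨w, hw, hmin⟩ := S.exists_min_image (fun u => (S.filter fun v => H.Adj u v).card) hS
  set N := S.filter fun v => H.Adj w v with hN
  have hwN : w ∉ N := by simp [hN]
  set R := insert w N with hR
  have hRS : R ⊆ S := Finset.insert_subset hw (Finset.filter_subset _ _)
  have hRc : R.card = N.card + 1 := Finset.card_insert_of_notMem hwN
  obtain ⟨I, hIS, hI, hcard⟩ := ih (S \ R)
    (Finset.sdiff_ssubset hRS ⟨w, Finset.mem_insert_self _ _⟩)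
  have hwI : w ∉ I := fun h => by
    have := hIS h
    simp [hR] at this
  have hnadj : ∀ v ∈ I, ¬ H.Adj w v := fun v hv hadj => by
    have := hIS hv
    simp [hR, hN, hadj] at this
    tauto
  refine ⟨insert w I, Finset.insert_subset hw (hIS.trans Finset.sdiff_subset), ?_, ?_⟩
  · intro u hu v hv
    rw [Finset.mem_insert] at hu hv
    rcases hu with rfl | hu <;> rcases hv with rfl | hv
    · exact H.loopless.irrefl _
    · exact hnadj v hv
    · exact fun h => hnadj u hu h.symm
    · exact hI u hu v hv
  · rw [Finset.card_insert_of_notMem hwI, ← Finset.sum_sdiff hRS]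
    have h1 : ∑ u ∈ S \ R, ((S \ R).filter fun v => H.Adj u v).card
        ≤ ∑ u ∈ S \ R, (S.filter fun v => H.Adj u v).card :=
      Finset.sum_le_sum fun u _ => Finset.card_le_card
        (Finset.filter_subset_filter _ Finset.sdiff_subset)
    have h2 : R.card * N.card ≤ ∑ u ∈ R, (S.filter fun v => H.Adj u v).card :=
      Finset.card_nsmul_le_sum _ _ _ fun u hu => hmin u (hRS hu)
    have h3 : (S \ R).card + R.card = S.card := Finset.card_sdiff_add_card_eq_card hRS
    rw [hRc] at h2 h3
    rw [← h3]
    have h4 : (1 + 2 * k) * (N.card + 1) ≤ (1 + k) ^ 2 + (N.card + 1) * N.card := by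
      zify
      nlinarith [sq_nonneg ((k : ℤ) - N.card)]
    nlinarith

theorem edgeCount_eq_sum {V : Type*} [Fintype V] (G : SimpleGraph V) (A : Set V)
    (I : V → Finset V) (hadj : ∀ u v, G.Adj u v ↔ u ∈ I v ∨ v ∈ I u)
    (hA : ∀ u v, u ∈ I v → u ∈ A ∧ v ∉ A) :
    edgeCount G = ∑ v, (I v).card := by
  classical
  rw [edgeCount, ← Finset.card_sigma, ← Set.ncard_coe_finset]
  symm
  refine Set.ncard_congr (fun p _ => s(p.2, p.1)) ?_ ?_ ?_
  · rintro ⟨v, u⟩ h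
    simp only [Finset.coe_sigma, Set.mem_sigma_iff, Finset.mem_coe] at h
    exact (hadj u v).2 (Or.inl h.2)
  · rintro ⟨v, u⟩ ⟨v', u'⟩ h h' he
    simp only [Finset.coe_sigma, Set.mem_sigma_iff, Finset.mem_coe] at h h'
    have h1 := hA _ _ h.2
    have h2 := hA _ _ h'.2
    rw [Sym2.eq_iff] at he
    rcases he with ⟨rfl, rfl⟩ | ⟨rfl, rfl⟩
    · rfl
    · exact absurd h1.1 h2.2
  · intro e
    induction e using Sym2.ind with
    | _ u v =>
      intro he
      rcases (hadj u v).1 he with h | h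
      · exact ⟨⟨v, u⟩, by simpa using h, rfl⟩
      · exact ⟨⟨u, v⟩, by simpa using h, Sym2.eq_swap⟩

/-- Every `K_{k,k}`-free bipartite graph with parts `A`, `B` in which every vertex of `A`
has degree at most `m` has a spanning subgraph `G'` with `e(G') ≥ e(G)/(k+1)` in which any
two distinct vertices of `A` have at most `k·m^{1-1/k}` common neighbours. -/
theorem clean_large_codegrees {V : Type*} [Fintype V] (k m : ℕ) (hk : 0 < k)
    (G : SimpleGraph V) (A B : Set V) (hbip : BipartiteWith G A B)
    (hfree : KkkFree G k) (hdeg : ∀ u ∈ A, deg G u ≤ m) :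
    ∃ G' : SimpleGraph V, G' ≤ G ∧
      (edgeCount G : ℝ) / ((k : ℝ) + 1) ≤ (edgeCount G' : ℝ) ∧
      ∀ u ∈ A, ∀ u' ∈ A, u ≠ u' →
        (codeg G' u u' : ℝ) ≤ (k : ℝ) * (m : ℝ) ^ ((1 : ℝ) - 1 / (k : ℝ)) := by
  classical
  obtain ⟨hdisj, -, hAB⟩ := hbip
  have hnot : ∀ {u v}, G.Adj u v → u ∈ A → v ∉ A := fun {u v} h hu hv => by
    rcases hAB h with ⟨-, h2⟩ | ⟨h1, -⟩
    · exact Set.disjoint_left.1 hdisj hv h2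
    · exact Set.disjoint_left.1 hdisj hu h1
  have hone : ∀ {u v}, G.Adj u v → u ∈ A ∨ v ∈ A := fun {u v} h =>
    (hAB h).imp And.left And.right
  set E : ℝ := (m : ℝ) ^ ((1 : ℝ) - 1 / (k : ℝ)) with hEdef
  have hk' : (0 : ℝ) < k := by exact_mod_cast hk
  have hE0 : 0 ≤ E := by positivity
  have hE : E ^ k = (m : ℝ) ^ (k - 1) := by
    rw [hEdef, ← Real.rpow_natCast, ← Real.rpow_mul (by positivity), ← Real.rpow_natCast,
      Nat.cast_sub hk]
    congr 1
    field_simp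
    simp
  let N : V → Finset V := fun v => Finset.univ.filter fun u => G.Adj v u
  have hcodeg : ∀ u u', codeg G u u' = ((N u).filter fun v => G.Adj u' v).card := fun u u' => by
    rw [codeg, ← Set.ncard_coe_finset]
    congr 1
    ext v
    simp [N]
  have hdegN : ∀ u, deg G u = (N u).card := fun u => by
    rw [deg, ← Set.ncard_coe_finset]
    congr 1
    ext v
    simp [N]
  let H : SimpleGraph V :=
    { Adj := fun u u' => u ≠ u' ∧ u ∈ A ∧ u' ∈ A ∧ k * E < (codeg G u u' : ℝ)
      symm := ⟨fun u u' ⟨h1, h2, h3, h4⟩ => ⟨h1.symm, h3, h2, by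
        rwa [codeg, Set.inter_comm]⟩⟩
      loopless := ⟨fun u h => h.1 rfl⟩ }
  let S : V → Finset V := fun v => Finset.univ.filter fun u => G.Adj u v ∧ u ∈ A
  have hS : ∀ u v, u ∈ S v ↔ G.Adj u v ∧ u ∈ A := fun u v => by simp [S]
  choose I hIS hI hcard using fun v => exists_independent_subset H k (S v)
  have hIA : ∀ u v, u ∈ I v → G.Adj u v ∧ u ∈ A := fun u v h => (hS u v).1 (hIS v h)
  let G' : SimpleGraph V :=
    { Adj := fun u v => u ∈ I v ∨ v ∈ I u
      symm := ⟨fun u v h => h.symm⟩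
      loopless := ⟨fun u h => G.loopless.irrefl u (hIA u u (h.elim id id)).1⟩ }
  have hle : G' ≤ G := fun u v h => h.elim (fun h => (hIA _ _ h).1) fun h => (hIA _ _ h).1.symm
  have heG : edgeCount G = ∑ v, (S v).card := by
    refine edgeCount_eq_sum G A S (fun u v => ?_) fun u v h => ?_
    · rw [hS, hS, G.adj_comm v u]
      exact ⟨fun h => (hone h).imp (fun h' => ⟨h, h'⟩) fun h' => ⟨h, h'⟩,
        fun h => h.elim And.left And.left⟩
    · rw [hS] at h
      exact ⟨h.2, hnot h.1 h.2⟩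
  have heG' : edgeCount G' = ∑ v, (I v).card :=
    edgeCount_eq_sum G' A I (fun u v => Iff.rfl) fun u v h =>
      ⟨(hIA u v h).2, hnot (hIA u v h).1 (hIA u v h).2⟩
  have heA : edgeCount G = ∑ u ∈ Finset.univ.filter (· ∈ A), (N u).card := by
    rw [heG]
    have := Finset.sum_card_bipartiteAbove_eq_sum_card_bipartiteBelow
      (s := Finset.univ.filter (· ∈ A)) (t := Finset.univ) G.Adj
    simp only [Finset.bipartiteAbove, Finset.bipartiteBelow, Finset.filter_filter] at this
    rw [this]
    refine Finset.sum_congr rfl fun v _ => ?_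
    congr 1
    ext u
    simp [S, and_comm]
  have hheavy : ∀ u ∈ A,
      ∑ u' ∈ Finset.univ.filter (fun u' => H.Adj u u'), codeg G u u' ≤ k * (N u).card := by
    intro u hu
    simp only [hcodeg]
    refine sum_card_le_of_large (N u) _ (fun u' v => G.Adj u' v) hk
      ((hdegN u).symm.trans_le (hdeg u hu)) hE0 hE ?_ ?_
    · intro u' hu'
      rw [← hcodeg]
      exact (Finset.mem_filter.1 hu').2.2.2.2.le
    · intro Q hQ hQk
      by_contra! hge
      obtain ⟨T, hT, hTk⟩ := Finset.exists_subset_card_eq hge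
      have hQT : ∀ a ∈ Q, ∀ v ∈ T, G.Adj a v := fun a ha v hv => by
        have := hT hv
        simp only [Finset.mem_filter] at this
        exact this.2 a ha
      refine hfree ⟨Q, T, ?_, hQk, hTk, hQT⟩
      rw [Finset.disjoint_left]
      intro a ha haT
      exact G.loopless.irrefl a (hQT a ha a haT)
  have hsum : ∑ v, ∑ u ∈ S v, ((S v).filter fun u' => H.Adj u u').card ≤ k * edgeCount G := by
    calc ∑ v, ∑ u ∈ S v, ((S v).filter fun u' => H.Adj u u').card
        = ∑ u ∈ Finset.univ.filter (· ∈ A), ∑ v ∈ N u,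
            ((S v).filter fun u' => H.Adj u u').card := by
          refine Finset.sum_comm' fun v u => ?_
          simp [S, N, and_comm]
      _ = ∑ u ∈ Finset.univ.filter (· ∈ A),
            ∑ u' ∈ Finset.univ.filter (fun u' => H.Adj u u'), codeg G u u' := by
          refine Finset.sum_congr rfl fun u _ => ?_
          simp only [hcodeg]
          have := Finset.sum_card_bipartiteAbove_eq_sum_card_bipartiteBelow
            (s := Finset.univ.filter (fun u' => H.Adj u u')) (t := N u) G.Adj
          simp only [Finset.bipartiteAbove, Finset.bipartiteBelow, Finset.filter_filter] at this
          rw [this]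
          refine Finset.sum_congr rfl fun v _ => ?_
          congr 1
          ext u'
          simp only [S, Finset.mem_filter, Finset.mem_univ, true_and]
          exact ⟨fun h => ⟨h.2, h.1.1⟩, fun h => ⟨⟨h.2, h.1.2.2.1⟩, h.1⟩⟩
      _ ≤ ∑ u ∈ Finset.univ.filter (· ∈ A), k * (N u).card :=
          Finset.sum_le_sum fun u hu => hheavy u (Finset.mem_filter.1 hu).2
      _ = k * edgeCount G := by rw [heA, Finset.mul_sum]
  refine ⟨G', hle, ?_, ?_⟩
  · have h := Finset.sum_le_sum fun v (_ : v ∈ Finset.univ) => hcard v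
    rw [← Finset.mul_sum, Finset.sum_add_distrib, ← Finset.mul_sum, ← heG, ← heG'] at h
    have h1 : (1 + 2 * k) * edgeCount G ≤ (1 + k) ^ 2 * edgeCount G' + k * edgeCount G :=
      h.trans (Nat.add_le_add_left (by convert hsum) _)
    have h2 : (1 + k) * edgeCount G ≤ (1 + k) * ((1 + k) * edgeCount G') := by nlinarith
    have h3 : edgeCount G ≤ (1 + k) * edgeCount G' := Nat.le_of_mul_le_mul_left h2 (by omega)
    have h4 : (edgeCount G : ℝ) ≤ (1 + k) * edgeCount G' := by exact_mod_cast h3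
    rw [div_le_iff₀ (by positivity)]
    linarith
  · intro u hu u' hu' hne
    by_cases hadj : H.Adj u u'
    · have : G'.neighborSet u ∩ G'.neighborSet u' = ∅ := by
        rw [Set.eq_empty_iff_forall_notMem]
        rintro w ⟨h1 : G'.Adj u w, h2 : G'.Adj u' w⟩
        have hw := hnot (hle h1) hu
        exact hI w u (h1.resolve_right fun h => hw (hIA _ _ h).2)
          u' (h2.resolve_right fun h => hw (hIA _ _ h).2) hadj
      rw [codeg, this]
      simp only [Set.ncard_empty, Nat.cast_zero]
      positivity
    · have h1 : (codeg G u u' : ℝ) ≤ k * E := by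
        by_contra! h
        exact hadj ⟨hne, hu, hu', h⟩
      refine le_trans ?_ h1
      have hsub : G'.neighborSet u ∩ G'.neighborSet u' ⊆ G.neighborSet u ∩ G.neighborSet u' :=
        fun w hw => ⟨hle hw.1, hle hw.2⟩
      exact_mod_cast Set.ncard_le_ncard hsub (Set.toFinite _)
end

section
/- Let L ≥ δ ≥ 2 with δ a positive integer, and let G be an (L, δ)-almost-biregular bipartite graph. Then G has a 64-almost-regular subgraph with average degree at least δ/(16·log₂ L). -/
variable {V : Type*}

open Finset in
open scoped Classical in
/-- Minimal-counterexample cleaning: a dense piece of a graph of bounded degree contains an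
almost regular subgraph of at least the same density. -/
lemma hasAlmostRegularSubgraph_of_dense {V : Type*} [Fintype V] {G H : SimpleGraph V}
    (hHG : H ≤ G) (W₀ : Finset V) (hW₀ : W₀.Nonempty) (q K : ℝ) (hq : 0 < q) (Δ : ℕ)
    (hΔ : ∀ v, #{u ∈ W₀ | H.Adj v u} ≤ Δ)
    (hp : q * #W₀ ≤ ∑ v ∈ W₀, (#{u ∈ W₀ | H.Adj v u} : ℝ)) (hK : 2 * Δ ≤ K * q) :
    HasAlmostRegularSubgraph G K q := by
  obtain ⟨W, hW, hmin⟩ := exists_min_image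
    {W ∈ W₀.powerset | W.Nonempty ∧ q * #W ≤ ∑ v ∈ W, (#{u ∈ W | H.Adj v u} : ℝ)} card
    ⟨W₀, by simp [hW₀, hp]⟩
  simp only [mem_filter, mem_powerset] at hW hmin
  obtain ⟨hWW₀, hWne, hWp⟩ := hW
  have hlow : ∀ w ∈ W, q ≤ 2 * (#{u ∈ W | H.Adj w u} : ℝ) := by
    intro w hw
    by_contra! hlt
    have hsplit : ∑ v ∈ W, (#{u ∈ W | H.Adj v u} : ℝ)
        = ∑ v ∈ W.erase w, (#{u ∈ W.erase w | H.Adj v u} : ℝ)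
          + 2 * (#{u ∈ W | H.Adj w u} : ℝ) := by
      have h1 : ∀ v, (#{u ∈ W | H.Adj v u} : ℝ)
          = #{u ∈ W.erase w | H.Adj v u} + (if H.Adj w v then 1 else 0 : ℝ) := by
        intro v
        rw [← insert_erase hw, filter_insert, erase_insert (notMem_erase _ _)]
        by_cases hv : H.Adj v w
        · rw [if_pos hv, if_pos hv.symm, card_insert_of_notMem (by simp)]
          push_cast
          ring
        · rw [if_neg hv, if_neg (fun h => hv h.symm), add_zero]
      have h2 : (#{u ∈ W | H.Adj w u} : ℝ) = #{u ∈ W.erase w | H.Adj w u} := by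
        rw [h1 w]; simp
      have h3 : ∑ v ∈ W.erase w, (if H.Adj w v then 1 else 0 : ℝ)
          = #{u ∈ W.erase w | H.Adj w u} := by
        simp
      rw [← add_sum_erase _ _ hw, sum_congr rfl (fun v _ => h1 v), sum_add_distrib, h3, h2]
      ring
    have hcard : (#(W.erase w) : ℝ) = #W - 1 := by
      rw [card_erase_of_mem hw, Nat.cast_sub (card_pos.2 hWne)]; simp
    rcases (W.erase w).eq_empty_or_nonempty with he | hne
    · rw [hsplit, he] at hWp
      have : (1 : ℝ) ≤ #W := by exact_mod_cast card_pos.2 hWne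
      simp only [sum_empty] at hWp
      nlinarith
    · have := hmin (W.erase w) ⟨(erase_subset _ _).trans hWW₀, hne, by
        rw [hcard]; linarith⟩
      exact absurd this (by simpa using card_erase_lt_of_mem hw)
  let F : G.Subgraph :=
    { verts := W
      Adj := fun u v => u ∈ W ∧ v ∈ W ∧ H.Adj u v
      adj_sub := fun h => hHG h.2.2
      edge_vert := fun h => h.1
      symm := ⟨fun u v h => ⟨h.2.1, h.1, h.2.2.symm⟩⟩ }
  have hdeg : ∀ v ∈ W, subDeg F v = #{u ∈ W | H.Adj v u} := by
    intro v hv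
    rw [subDeg, ← Set.ncard_coe_finset]
    congr 1
    ext u
    simp [F, hv]
  have hedge : 2 * (subEdgeCount F : ℝ) = ∑ v ∈ W, (#{u ∈ W | H.Adj v u} : ℝ) := by
    have h1 := F.spanningCoe.sum_degrees_eq_twice_card_edges
    have h2 : #F.spanningCoe.edgeFinset = subEdgeCount F := by
      rw [subEdgeCount, ← Set.ncard_coe_finset]
      congr 1
      ext e
      induction e with
      | _ u v => simp
    have h3 : ∀ v, F.spanningCoe.degree v = if v ∈ W then #{u ∈ W | H.Adj v u} else 0 := by
      intro v
      rw [← SimpleGraph.card_neighborFinset_eq_degree]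
      split_ifs with hv
      · congr 1
        ext u
        simp [F, hv]
      · rw [card_eq_zero]
        ext u
        simp [F, hv]
    rw [h2, sum_congr rfl (fun v _ => h3 v), sum_ite_mem, univ_inter] at h1
    exact_mod_cast h1.symm
  refine ⟨F, hWne, ?_, ?_⟩
  · intro v hv w hw
    rw [hdeg v hv, hdeg w hw]
    have h1 : (#{u ∈ W | H.Adj v u} : ℝ) ≤ Δ := by
      exact_mod_cast (card_le_card (filter_subset_filter _ hWW₀)).trans (hΔ v)
    have h2 := hlow w hw
    have h3 : 0 ≤ K := by
      by_contra! hneg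
      have : (0 : ℝ) ≤ Δ := by positivity
      nlinarith
    nlinarith
  · have hcard : F.verts.ncard = #W := Set.ncard_coe_finset W
    rw [subAvgDeg, hedge, hcard, le_div_iff₀ (by exact_mod_cast card_pos.2 hWne)]
    exact hWp

open Finset in
open scoped Classical in
/-- Greedy assignment: the vertices of `T` successively choose `d` neighbours whose load is still
less than `M`, those in `U` succeeding. -/
lemma exists_greedy_assignment {V : Type*} (N : V → Finset V) (d M : ℕ) (T : Finset V) :
    ∃ U ⊆ T, ∃ f : V → Finset V, (∀ b ∈ U, f b ⊆ N b ∧ #(f b) = d) ∧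
      (∀ a, #{b ∈ U | a ∈ f b} ≤ M) ∧
      ∀ b ∈ T \ U, #{a ∈ N b | #{b ∈ U | a ∈ f b} < M} < d := by
  induction T using Finset.induction_on with
  | empty => exact ⟨∅, subset_rfl, fun _ => ∅, by simp, by simp, by simp⟩
  | insert c T hc ih =>
    obtain ⟨U, hU, f, hf, hM, hfail⟩ := ih
    by_cases hd : #{a ∈ N c | #{b ∈ U | a ∈ f b} < M} < d
    · refine ⟨U, hU.trans (subset_insert _ _), f, hf, hM, fun b hb => ?_⟩
      rw [mem_sdiff, mem_insert] at hb
      rcases hb with ⟨rfl | hb, hbU⟩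
      · exact hd
      · exact hfail b (mem_sdiff.2 ⟨hb, hbU⟩)
    · push Not at hd
      obtain ⟨g, hg, hgd⟩ := exists_subset_card_eq hd
      have hcU : c ∉ U := fun h => hc (hU h)
      have hload : ∀ a, #{b ∈ insert c U | a ∈ Function.update f c g b}
          = #{b ∈ U | a ∈ f b} + if a ∈ g then 1 else 0 := by
        intro a
        have h1 : {b ∈ U | a ∈ Function.update f c g b} = {b ∈ U | a ∈ f b} := by
          refine filter_congr fun b hb => ?_
          rw [Function.update_of_ne (ne_of_mem_of_not_mem hb hcU)]
        rw [filter_insert, h1, Function.update_self]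
        split_ifs with h
        · rw [card_insert_of_notMem (by simp [hcU])]
        · rfl
      refine ⟨insert c U, insert_subset_insert _ hU, Function.update f c g, ?_, ?_, ?_⟩
      · intro b hb
        rcases mem_insert.1 hb with rfl | hb
        · rw [Function.update_self]
          exact ⟨hg.trans (filter_subset _ _), hgd⟩
        · rw [Function.update_of_ne (ne_of_mem_of_not_mem hb hcU)]
          exact hf b hb
      · intro a
        rw [hload]
        split_ifs with h
        · exact (mem_filter.1 (hg h)).2
        · exact hM a
      · intro b hb
        rw [mem_sdiff, mem_insert, mem_insert, not_or] at hb
        refine lt_of_le_of_lt (card_le_card ?_)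
          (hfail b (mem_sdiff.2 ⟨hb.1.resolve_left hb.2.1, hb.2.2⟩))
        intro a ha
        rw [mem_filter, hload] at ha
        exact mem_filter.2 ⟨ha.1, by omega⟩

open Finset in
open scoped Classical in
/-- Either there is an almost regular subgraph, or the bipartite graph between `S` and `T` contains
a part that is eight times denser, with the degrees on the `T` side dropping by at most `d`. -/
lemma almostRegular_or_density_increment {V : Type*} [Fintype V] (G : SimpleGraph V)
    (S T : Finset V) (hST : Disjoint S T) (hcard : #S ≤ #T) (hT : T.Nonempty)
    (d r : ℕ) (hd : 0 < d) (hr : ∀ b ∈ T, r ≤ #{a ∈ S | G.Adj b a}) :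
    HasAlmostRegularSubgraph G 64 (2 * d / 3) ∨
      ∃ R ⊆ S, ∃ T' ⊆ T, T'.Nonempty ∧ #R ≤ #T' ∧ 8 * (#T * #R) ≤ #S * #T' ∧
        ∀ b ∈ T', r ≤ #{a ∈ R | G.Adj b a} + d := by
  obtain ⟨U, hU, f, hf, hM, hfail⟩ :=
    exists_greedy_assignment (fun b => {a ∈ S | G.Adj b a}) d (8 * d) T
  have hfS : ∀ b ∈ U, ∀ a ∈ f b, a ∈ S ∧ G.Adj b a := fun b hb a ha =>
    mem_filter.1 ((hf b hb).1 ha)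
  have hsum : ∑ a ∈ S, #{b ∈ U | a ∈ f b} = d * #U := by
    have := sum_card_bipartiteAbove_eq_sum_card_bipartiteBelow (s := S) (t := U)
      (fun a b => a ∈ f b)
    simp only [bipartiteAbove, bipartiteBelow] at this
    rw [this, mul_comm, ← smul_eq_mul, ← sum_const]
    refine sum_congr rfl fun b hb => ?_
    rw [← (hf b hb).2]
    congr 1
    ext a
    simp only [mem_filter]
    exact ⟨fun h => h.2, fun h => ⟨(hfS b hb a h).1, h⟩⟩
  by_cases hbig : #S ≤ 2 * #U ∧ U.Nonempty
  · left
    obtain ⟨hbig, hUne⟩ := hbig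
    have hSU : Disjoint S U := hST.mono_right hU
    obtain ⟨H, hH⟩ : ∃ H : SimpleGraph V,
        ∀ u v, H.Adj u v ↔ (u ∈ U ∧ v ∈ f u) ∨ (v ∈ U ∧ u ∈ f v) :=
      ⟨{ Adj := fun u v => (u ∈ U ∧ v ∈ f u) ∨ (v ∈ U ∧ u ∈ f v)
         symm := ⟨fun u v h => h.symm⟩
         loopless := ⟨fun u h => by
           rcases h with h | h <;> exact G.loopless.irrefl u (hfS u h.1 u h.2).2⟩ },
        fun _ _ => Iff.rfl⟩
    have hHG : H ≤ G := by
      intro u v huv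
      rcases (hH u v).1 huv with h | h
      · exact (hfS u h.1 v h.2).2
      · exact (hfS v h.1 u h.2).2.symm
    refine hasAlmostRegularSubgraph_of_dense hHG (S ∪ U) (hUne.mono subset_union_right) _ _
      (by positivity) (9 * d) ?_ ?_ ?_
    · intro v
      have h1 : {u ∈ S ∪ U | H.Adj v u} ⊆
          (if v ∈ U then f v else ∅) ∪ {b ∈ U | v ∈ f b} := by
        intro u hu
        rcases (hH v u).1 (mem_filter.1 hu).2 with h | h
        · exact mem_union_left _ (by rw [if_pos h.1]; exact h.2)
        · exact mem_union_right _ (mem_filter.2 h)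
      have h2 : #(if v ∈ U then f v else ∅) ≤ d := by
        split_ifs with h
        · exact (hf v h).2.le
        · simp
      have := (card_le_card h1).trans (card_union_le _ _)
      have := hM v
      omega
    · have h1 : d * #U ≤ ∑ v ∈ S, #{u ∈ S ∪ U | H.Adj v u} := by
        rw [← hsum]
        refine sum_le_sum fun a _ => card_le_card fun b hb => ?_
        rw [mem_filter] at hb ⊢
        exact ⟨mem_union_right _ hb.1, (hH a b).2 (Or.inr hb)⟩
      have h2 : d * #U ≤ ∑ v ∈ U, #{u ∈ S ∪ U | H.Adj v u} := by
        rw [mul_comm, ← smul_eq_mul, ← sum_const]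
        refine sum_le_sum fun b hb => ?_
        rw [← (hf b hb).2]
        refine card_le_card fun a ha => mem_filter.2 ⟨?_, (hH b a).2 (Or.inl ⟨hb, ha⟩)⟩
        exact mem_union_left _ (hfS b hb a ha).1
      have h3 : ((d * #U + d * #U : ℕ) : ℝ) ≤
          (∑ v ∈ S ∪ U, #{u ∈ S ∪ U | H.Adj v u} : ℕ) := by
        rw [sum_union hSU]
        exact_mod_cast add_le_add h1 h2
      push_cast at h3
      refine le_trans ?_ h3
      rw [card_union_of_disjoint hSU]
      have h4 : (#S : ℝ) ≤ 2 * #U := by exact_mod_cast hbig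
      have h5 : (d : ℝ) * #S ≤ d * (2 * #U) := by gcongr
      push_cast
      linarith
    · push_cast
      have : (0 : ℝ) ≤ d := by positivity
      linarith
  · right
    have hsmall : 2 * #U ≤ #S := by
      by_contra! hlt
      exact hbig ⟨hlt.le, card_pos.1 (by omega)⟩
    have hR : 16 * #{a ∈ S | 8 * d ≤ #{b ∈ U | a ∈ f b}} ≤ #S := by
      have h1 : #{a ∈ S | 8 * d ≤ #{b ∈ U | a ∈ f b}} * (8 * d) ≤ d * #U := by
        rw [← hsum, ← smul_eq_mul, ← sum_const]
        exact (sum_le_sum fun a ha => (mem_filter.1 ha).2).trans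
          (sum_le_sum_of_subset (filter_subset _ _))
      have h2 : 8 * #{a ∈ S | 8 * d ≤ #{b ∈ U | a ∈ f b}} ≤ #U :=
        Nat.le_of_mul_le_mul_left (by linarith) hd
      omega
    have hT' : #(T \ U) + #U = #T := card_sdiff_add_card_eq_card hU
    have hTpos := hT.card_pos
    refine ⟨{a ∈ S | 8 * d ≤ #{b ∈ U | a ∈ f b}}, filter_subset _ _, T \ U, sdiff_subset,
      card_pos.1 (by omega), by omega, ?_, ?_⟩
    · have : #T ≤ 2 * #(T \ U) := by omega
      nlinarith
    · intro b hb
      have h1 := hfail b hb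
      have h2 := hr b (mem_sdiff.1 hb).1
      have h3 : {a ∈ S | G.Adj b a} ⊆
          {a ∈ ({a ∈ S | 8 * d ≤ #{b ∈ U | a ∈ f b}} : Finset V) | G.Adj b a} ∪
          {a ∈ ({a ∈ S | G.Adj b a} : Finset V) | #{b ∈ U | a ∈ f b} < 8 * d} := by
        intro a ha
        rw [mem_filter] at ha
        simp only [mem_union, mem_filter, ha, true_and, and_true]
        exact le_or_gt _ _
      have := (card_le_card h3).trans (card_union_le _ _)
      omega

open Finset in
open scoped Classical in
lemma almostRegular_or_iterated_density_increment {V : Type*} [Fintype V] (G : SimpleGraph V)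
    (A B : Finset V) (hAB : Disjoint A B) (hcard : #A ≤ #B) (hB : B.Nonempty)
    (d δ : ℕ) (hd : 0 < d) (hδ : ∀ b ∈ B, δ ≤ #{a ∈ A | G.Adj b a}) (k : ℕ) :
    HasAlmostRegularSubgraph G 64 (2 * d / 3) ∨
      ∃ S ⊆ A, ∃ T ⊆ B, T.Nonempty ∧ #S ≤ #T ∧ 8 ^ k * (#B * #S) ≤ #A * #T ∧
        ∀ b ∈ T, δ ≤ #{a ∈ S | G.Adj b a} + k * d := by
  induction k with
  | zero => exact .inr ⟨A, subset_rfl, B, subset_rfl, hB, hcard, by simp [mul_comm],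
      by simpa using hδ⟩
  | succ k ih =>
    rcases ih with h | ⟨S, hS, T, hT, hTne, hST, hdens, hdeg⟩
    · exact .inl h
    rcases almostRegular_or_density_increment G S T (hAB.mono hS hT) hST hTne d (δ - k * d) hd
      (fun b hb => by have := hdeg b hb; omega) with h | ⟨R, hR, T', hT', hne, hRT, hdens', hdeg'⟩
    · exact .inl h
    refine .inr ⟨R, hR.trans hS, T', hT'.trans hT, hne, hRT, ?_, fun b hb => ?_⟩
    · refine Nat.le_of_mul_le_mul_left ?_ hTne.card_pos
      calc #T * (8 ^ (k + 1) * (#B * #R)) = 8 ^ k * #B * (8 * (#T * #R)) := by ring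
        _ ≤ 8 ^ k * #B * (#S * #T') := by gcongr
        _ = 8 ^ k * (#B * #S) * #T' := by ring
        _ ≤ #A * #T * #T' := by gcongr
        _ = #T * (#A * #T') := by ring
    · have := hdeg' b hb
      rw [add_mul]
      omega


lemma HasAlmostRegularSubgraph.mono {V : Type*} {G : SimpleGraph V} {K c c' : ℝ}
    (h : HasAlmostRegularSubgraph G K c) (hc : c' ≤ c) : HasAlmostRegularSubgraph G K c' := by
  obtain ⟨H, hne, hreg, havg⟩ := h
  exact ⟨H, hne, hreg, hc.trans havg⟩

lemma deg_eq_degree {V : Type*} (G : SimpleGraph V) (v : V) [Fintype (G.neighborSet v)] :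
    deg G v = G.degree v := by
  rw [deg, ← SimpleGraph.card_neighborSet_eq_degree, Set.ncard_eq_toFinset_card', Set.toFinset_card]

open Finset in
/-- A single edge is a subgraph of average degree one. -/
lemma hasAlmostRegularSubgraph_of_adj {V : Type*} [Fintype V] {G : SimpleGraph V} {u v : V}
    (h : G.Adj u v) : HasAlmostRegularSubgraph G 64 1 := by
  classical
  have hcard : #{u, v} = 2 := card_pair h.ne
  refine hasAlmostRegularSubgraph_of_dense le_rfl {u, v} ⟨u, by simp⟩ 1 64 one_pos 2
    (fun w => hcard ▸ card_filter_le _ _) ?_ (by norm_num)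
  rw [hcard, sum_pair h.ne, filter_insert, filter_singleton, filter_insert, filter_singleton]
  norm_num [h, h.symm]

/-- Every `(L, δ)`-almost-biregular graph with `L ≥ δ ≥ 2` has a `64`-almost-regular
subgraph with average degree at least `δ/(16·log₂ L)`. -/
theorem almost_bireg_to_almost_reg {V : Type*} [Fintype V] (G : SimpleGraph V)
    (A B : Set V) (L : ℝ) (δ : ℕ) (hδ : 2 ≤ δ) (hL : (δ : ℝ) ≤ L)
    (h : IsAlmostBiregular G A B L δ) :
    HasAlmostRegularSubgraph G 64 ((δ : ℝ) / (16 * Real.logb 2 L)) := by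
  classical
  obtain ⟨⟨hdisj, -, hadj⟩, hAne, hdegB, hD, hdegA⟩ := h
  lift A to Finset V using A.toFinite
  lift B to Finset V using B.toFinite
  rw [Set.ncard_coe_finset] at hD hdegA
  rw [Finset.coe_nonempty] at hAne
  have hdegB' : ∀ b ∈ B, G.degree b = δ := fun b hb => by
    rw [← deg_eq_degree, hdegB b (by simpa using hb)]
  have hedges : (edgeCount G : ℝ) = B.card * δ := by
    have h1 := SimpleGraph.isBipartiteWith_sum_degrees_eq_card_edges' (G := G) ⟨hdisj, hadj⟩
    rw [Finset.sum_congr rfl hdegB', Finset.sum_const, smul_eq_mul] at h1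
    rw [edgeCount, ← SimpleGraph.coe_edgeFinset, Set.ncard_coe_finset, ← h1]
    push_cast
    rfl
  have hApos : (0 : ℝ) < A.card := by exact_mod_cast hAne.card_pos
  have hδpos : (0 : ℝ) < δ := by exact_mod_cast (by omega : 0 < δ)
  have hL2 : (2 : ℝ) ≤ L := le_trans (by exact_mod_cast hδ) hL
  have hcard : A.card ≤ B.card := by
    rw [hedges, le_div_iff₀ hApos, mul_comm] at hD
    exact_mod_cast le_of_mul_le_mul_right hD hδpos
  have hBne : B.Nonempty := Finset.card_pos.1 (hAne.card_pos.trans_le hcard)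
  have hlog : 1 ≤ Real.logb 2 L := by
    rw [Real.le_logb_iff_rpow_le (by norm_num) (by linarith)]
    simpa using hL2
  obtain ⟨k, hk⟩ : ∃ k, k = ⌈Real.logb 2 L⌉₊ := ⟨_, rfl⟩
  have hkL : L ≤ 2 ^ k := by
    rw [← Real.rpow_natCast, ← Real.logb_le_iff_le_rpow (by norm_num) (by linarith), hk]
    exact Nat.le_ceil _
  have hk1 : 1 ≤ k := by
    rw [hk]
    exact Nat.one_le_ceil_iff.2 (by linarith)
  have hk2 : (k : ℝ) ≤ 2 * Real.logb 2 L := by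
    have := Nat.ceil_lt_add_one (a := Real.logb 2 L) (by linarith)
    rw [hk]
    linarith
  rcases Nat.eq_zero_or_pos (δ / (2 * k)) with hd | hd
  · have hδk : δ < 2 * k := (Nat.div_eq_zero_iff_lt (by omega)).1 hd
    obtain ⟨b, hb⟩ := hBne
    obtain ⟨a, ha⟩ : ∃ a, G.Adj b a := by
      rw [← G.degree_pos_iff_exists_adj, hdegB' b hb]
      omega
    refine (hasAlmostRegularSubgraph_of_adj ha).mono ?_
    rw [div_le_one (by positivity)]
    have : (δ : ℝ) < 2 * k := by exact_mod_cast hδk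
    linarith
  obtain ⟨d, hd_def⟩ : ∃ d, d = δ / (2 * k) := ⟨_, rfl⟩
  rw [← hd_def] at hd
  have hkd : 2 * (k * d) ≤ δ := by
    rw [← mul_assoc, hd_def]
    exact Nat.mul_div_le _ _
  have hdδ : δ ≤ 4 * k * d := by
    have h1 : δ < 2 * k * (d + 1) := by
      rw [hd_def]
      exact Nat.lt_mul_div_succ _ (by omega)
    nlinarith
  have hN : ∀ b ∈ B, Finset.filter (fun a => G.Adj b a) A = G.neighborFinset b := by
    intro b hb
    ext a
    simp only [Finset.mem_filter, SimpleGraph.mem_neighborFinset, and_iff_right_iff_imp]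
    intro hba
    rcases hadj hba with h | h
    · exact absurd (by simpa using hb) (Set.disjoint_left.1 hdisj h.1)
    · simpa using h.2
  rcases almostRegular_or_iterated_density_increment G A B (by simpa using hdisj) hcard hBne d δ hd
    (fun b hb => by
      have := hdegB' b hb
      rw [← SimpleGraph.card_neighborFinset_eq_degree, ← hN b hb] at this
      convert this.ge) k with h | ⟨S, hS, T, hT, hTne, hST, hdens, hdeg⟩
  · refine h.mono ?_
    rw [div_le_iff₀ (by positivity)]
    have h1 : (δ : ℝ) ≤ 4 * k * d := by exact_mod_cast hdδ
    have h2 : (k : ℝ) * d ≤ 2 * Real.logb 2 L * d := by gcongr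
    have h3 : 0 ≤ Real.logb 2 L * d := by positivity
    linarith
  · exfalso
    have hcount : ∑ b ∈ T, (Finset.filter (fun a => G.Adj b a) S).card
        = ∑ a ∈ S, (Finset.filter (fun b => G.Adj b a) T).card := by
      simpa only [Finset.bipartiteAbove, Finset.bipartiteBelow] using
        Finset.sum_card_bipartiteAbove_eq_sum_card_bipartiteBelow (s := T) (t := S)
          (fun b a => G.Adj b a)
    have hlow : T.card * δ ≤ 2 * ∑ b ∈ T, (Finset.filter (fun a => G.Adj b a) S).card := by
      rw [Finset.mul_sum, ← smul_eq_mul, ← Finset.sum_const]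
      refine Finset.sum_le_sum fun b hb => ?_
      have h1 : δ ≤ (Finset.filter (fun a => G.Adj b a) S).card + k * d := by
        convert hdeg b hb
      omega
    have hup : ((∑ a ∈ S, (Finset.filter (fun b => G.Adj b a) T).card : ℕ) : ℝ)
        ≤ S.card * (L * (B.card * δ / A.card)) := by
      rw [Nat.cast_sum, ← nsmul_eq_mul, ← Finset.sum_const]
      refine Finset.sum_le_sum fun a ha => ?_
      rw [← hedges]
      refine le_trans ?_ (hdegA a (by simpa using hS ha))
      rw [deg_eq_degree, ← SimpleGraph.card_neighborFinset_eq_degree]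
      refine Nat.cast_le.2 (Finset.card_le_card fun b hb => ?_)
      simpa using (Finset.mem_filter.1 hb).2.symm
    rw [← hcount] at hup
    have hlow' : (T.card : ℝ) * δ
        ≤ 2 * (∑ b ∈ T, (Finset.filter (fun a => G.Adj b a) S).card : ℕ) := by
      exact_mod_cast hlow
    have hdens' : (8 : ℝ) ^ k * (B.card * S.card) ≤ A.card * T.card := by exact_mod_cast hdens
    have hTpos : (0 : ℝ) < T.card := by exact_mod_cast hTne.card_pos
    have h1 : (T.card : ℝ) * A.card ≤ 2 * L * (B.card * S.card) := by
      have h2 := hlow'.trans (mul_le_mul_of_nonneg_left hup zero_le_two)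
      have h3 : (2 : ℝ) * (S.card * (L * (B.card * δ / A.card)))
          = 2 * L * (B.card * S.card) * δ / A.card := by ring
      rw [h3, le_div_iff₀ hApos] at h2
      refine le_of_mul_le_mul_right ?_ hδpos
      linarith
    have h8 : 2 * L < 8 ^ k := by
      have h4 : (4 : ℝ) ≤ 4 ^ k := by
        simpa using pow_le_pow_right₀ (by norm_num : (1 : ℝ) ≤ 4) hk1
      have h5 : (8 : ℝ) ^ k = 2 ^ k * 4 ^ k := by rw [← mul_pow]; norm_num
      rw [h5]
      nlinarith
    have h6 : (0 : ℝ) < B.card * S.card := by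
      by_contra! h7
      have : 0 < (T.card : ℝ) * A.card := by positivity
      nlinarith
    nlinarith
end
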